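/- arXiv:math/0411051 — 5 statements merged into one kernel-verified Lean document; each statement's English description precedes it below -/
import Mathlib

section
/- Assume the generality assumption, and suppose Z_A and Z_B have exactly r ≤ 6 common points. Then N_{A,B} ≤ 120 − r. -/
/-!
Common setup (k algebraically closed, `V = k⁵`, matrices `A₁` (2×4) and `B₁` (3×2) with
entries in `V`):

* A dual vector is represented by `φ : Fin 5 → k`, acting on `v : V` by `Σ l, φ l * v l`;
  `rankOneLocus A` is the (affine cone, minus 0, over the) locus in `P(V*)` where the
  matrix `A` has rank 1.
* `C_A` is a smooth rational normal quartic curve iff its cone is the image of the cone over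
  the standard quartic `(s:t) ↦ (s⁴, s³t, s²t², st³, t⁴)` under a linear automorphism;
  similarly `S_B` is a (smooth) rational cubic surface scroll iff its cone is the image of
  the cone over the standard scroll `S(1,2)`, `(a,b;s:t) ↦ (as, at, bs², bst, bt²)`.
  (Over an algebraically closed field the parametrized sets are the full affine cones.)
* `V_A` is the span of the 4 columns of `A₁` in `V ⊕ V`, `V_B` the span of the 3 rows of
  `B₁`; the double (Veronese) embeddings into `P(⋀²V)` have as affine cones the sets
  `coneZ V_A`, `coneZ V_B` of wedges `v₁ ∧ v₂` with `(v₁,v₂)` in `V_A` resp. `V_B`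
  (computed in the exterior algebra).  `gammaSet` is the set `Z_A ∩ Z_B` of common points,
  a subset of the projectivization of the exterior algebra.
-/

open ExteriorAlgebra

/-- The affine cone over the standard rational normal quartic curve. -/
def coneQuartic (k : Type*) [Field k] : Set (Fin 5 → k) :=
  {w | ∃ s t : k, w = ![s ^ 4, s ^ 3 * t, s ^ 2 * t ^ 2, s * t ^ 3, t ^ 4]}

/-- The affine cone over the standard smooth rational cubic surface scroll `S(1,2)`. -/
def coneScroll (k : Type*) [Field k] : Set (Fin 5 → k) :=
  {w | ∃ a b s t : k, w = ![a * s, a * t, b * s ^ 2, b * s * t, b * t ^ 2]}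

/-- The rank-one locus in `P(V*)` (as an affine cone minus the origin) of a matrix with
entries in `V = k⁵`. -/
def rankOneLocus {k : Type*} [Field k] {m n : ℕ}
    (A : Matrix (Fin m) (Fin n) (Fin 5 → k)) : Set (Fin 5 → k) :=
  {φ | (Matrix.of fun i j => ∑ l, φ l * A i j l).rank = 1}

/-- `C_A` is a smooth rational normal quartic curve. -/
def IsRNQuartic {k : Type*} [Field k] {m n : ℕ}
    (A : Matrix (Fin m) (Fin n) (Fin 5 → k)) : Prop :=
  ∃ g : (Fin 5 → k) ≃ₗ[k] (Fin 5 → k), rankOneLocus A ∪ {0} = g '' coneQuartic k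

/-- `S_B` is a smooth rational cubic surface scroll. -/
def IsCubicScroll {k : Type*} [Field k] {m n : ℕ}
    (B : Matrix (Fin m) (Fin n) (Fin 5 → k)) : Prop :=
  ∃ g : (Fin 5 → k) ≃ₗ[k] (Fin 5 → k), rankOneLocus B ∪ {0} = g '' coneScroll k

/-- The span of the columns of `A₁` in `V ⊕ V`. -/
def colSpace {k : Type*} [Field k]
    (A₁ : Matrix (Fin 2) (Fin 4) (Fin 5 → k)) : Submodule k ((Fin 5 → k) × (Fin 5 → k)) :=
  Submodule.span k (Set.range fun j => (A₁ 0 j, A₁ 1 j))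

/-- The span of the rows of `B₁` in `V ⊕ V`. -/
def rowSpace {k : Type*} [Field k]
    (B₁ : Matrix (Fin 3) (Fin 2) (Fin 5 → k)) : Submodule k ((Fin 5 → k) × (Fin 5 → k)) :=
  Submodule.span k (Set.range fun i => (B₁ i 0, B₁ i 1))

/-- The affine cone (inside the exterior algebra) over the image `Z_W ⊆ P(⋀²V)` of `P(W)`
under the double (quadratic Veronese) embedding `(v₁,v₂) ↦ v₁ ∧ v₂`. -/
def coneZ {k : Type*} [Field k] (W : Submodule k ((Fin 5 → k) × (Fin 5 → k))) :
    Set (ExteriorAlgebra k (Fin 5 → k)) :=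
  {ω | ∃ p ∈ W, ω = ι k p.1 * ι k p.2}

/-- The set `Γ = Z_A ∩ Z_B` of common points, inside the projectivization. -/
def gammaSet {k : Type*} [Field k]
    (A₁ : Matrix (Fin 2) (Fin 4) (Fin 5 → k)) (B₁ : Matrix (Fin 3) (Fin 2) (Fin 5 → k)) :
    Set (Projectivization k (ExteriorAlgebra k (Fin 5 → k))) :=
  {z | ∃ (ω : ExteriorAlgebra k (Fin 5 → k)) (hω : ω ≠ 0),
    z = Projectivization.mk k ω hω ∧ ω ∈ coneZ (colSpace A₁) ∩ coneZ (rowSpace B₁)}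


lemma ext_contract_mem {k : Type*} [Field k] (d : Module.Dual k (Fin 5 → k)) (n : ℕ)
    (x : ExteriorAlgebra k (Fin 5 → k)) (hx : x ∈ ⋀[k]^n (Fin 5 → k)) :
    CliffordAlgebra.contractLeft (Q := (0 : QuadraticForm k (Fin 5 → k))) d x
      ∈ ⋀[k]^(n - 1) (Fin 5 → k) ∧
    (n = 0 → CliffordAlgebra.contractLeft (Q := (0 : QuadraticForm k (Fin 5 → k))) d x = 0) := by
  induction hx using Submodule.pow_induction_on_left' with
  | algebraMap r =>
    have h := CliffordAlgebra.contractLeft_algebraMap (Q := (0 : QuadraticForm k (Fin 5 → k))) d r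
    refine ⟨?_, fun _ => h⟩
    erw [h]; exact Submodule.zero_mem _
  | add x y i hx hy ihx ihy =>
    refine ⟨?_, fun hi => ?_⟩
    · rw [map_add]; exact Submodule.add_mem _ ihx.1 ihy.1
    · rw [map_add, ihx.2 hi, ihy.2 hi, add_zero]
  | mem_mul m hm i x hx ih =>
    obtain ⟨a, rfl⟩ := hm
    refine ⟨?_, fun hi => absurd hi (Nat.succ_ne_zero _)⟩
    have h := CliffordAlgebra.contractLeft_ι_mul (Q := (0 : QuadraticForm k (Fin 5 → k))) (d := d) a x
    erw [h]
    refine Submodule.sub_mem _ (Submodule.smul_mem _ _ hx) ?_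
    rcases i with _ | i
    · rw [ih.2 rfl, mul_zero]; exact Submodule.zero_mem _
    · have := ih.1
      simp only [Nat.succ_eq_add_one, Nat.add_sub_cancel] at this ⊢
      rw [exteriorPower, pow_succ']
      exact Submodule.mul_mem_mul ⟨a, rfl⟩ this

lemma ext_top {k : Type*} [Field k] :
    ∃ (e : ExteriorAlgebra k (Fin 5 → k)) (θ : ExteriorAlgebra k (Fin 5 → k) →ₗ[k] k),
      θ e = 1 ∧ ∀ φ ψ : Module.Dual k (Fin 5 → k), ∃ η ∈ ⋀[k]^3 (Fin 5 → k),
        ∀ w₁ w₂ : Fin 5 → k, ι k w₁ * ι k w₂ * η = (φ w₂ * ψ w₁ - φ w₁ * ψ w₂) • e := by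
  classical
  let b := Pi.basisFun k (Fin 5)
  let e : ExteriorAlgebra k (Fin 5 → k) := ιMulti k 5 b
  let fam : ∀ i, (Fin 5 → k) [⋀^Fin i]→ₗ[k] k := fun i =>
    if h : i = 5 then h ▸ b.det else 0
  have he : e ∈ ⋀[k]^5 (Fin 5 → k) := ιMulti_range k 5 ⟨_, rfl⟩
  have hv : ∀ v, ι k v * e = 0 := by
    intro v
    have h6 : ιMulti k 6 (Matrix.vecCons v b) = ι k v * e := by
      rw [ιMulti_succ_apply]; simp [e]
    rw [← h6]
    apply AlternatingMap.map_linearDependent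
    intro hli
    have := hli.fintype_card_le_finrank
    simp at this
  refine ⟨e, liftAlternating (R := k) fam, ?_, ?_⟩
  · rw [liftAlternating_apply_ιMulti]
    simp only [fam, dite_true]
    exact b.det_self
  · intro φ ψ
    let C := fun (d : Module.Dual k (Fin 5 → k)) (x : ExteriorAlgebra k (Fin 5 → k)) =>
      (CliffordAlgebra.contractLeft (Q := (0 : QuadraticForm k (Fin 5 → k))) d x : ExteriorAlgebra k (Fin 5 → k))
    have hC : ∀ d a x, C d (ι k a * x) = d a • x - ι k a * C d x := fun d a x =>
      CliffordAlgebra.contractLeft_ι_mul (Q := (0 : QuadraticForm k (Fin 5 → k))) (d := d) a x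
    have hC0 : ∀ d, C d 0 = 0 := fun d => map_zero _
    have hCs : ∀ d (r : k) x, C d (r • x) = r • C d x := fun d r x => map_smul _ _ _
    have h1 : ∀ d a, ι k a * C d e = d a • e := by
      intro d a
      have := hC d a e
      rw [hv, hC0] at this
      exact (sub_eq_zero.mp this.symm).symm
    refine ⟨C φ (C ψ e), ?_, ?_⟩
    · exact (ext_contract_mem φ 4 _ (ext_contract_mem ψ 5 _ he).1).1
    · intro w₁ w₂
      have h2 : ι k w₂ * C φ (C ψ e) = φ w₂ • C ψ e - ψ w₂ • C φ e := by
        have := hC φ w₂ (C ψ e)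
        rw [h1, hCs] at this
        rw [this]; abel
      rw [mul_assoc, h2, mul_sub, mul_smul_comm, mul_smul_comm, h1, h1, smul_smul, smul_smul, ← sub_smul]
      congr 1; ring

lemma ext_two_comm {k : Type*} [Field k] (β : ExteriorAlgebra k (Fin 5 → k))
    (hβ : β ∈ ⋀[k]^2 (Fin 5 → k)) (v : Fin 5 → k) : β * ι k v = ι k v * β := by
  have hsw : ∀ x y : Fin 5 → k, ι k x * ι k y = - (ι k y * ι k x) := fun x y =>
    eq_neg_of_add_eq_zero_left (ι_add_mul_swap x y)
  rw [exteriorPower, pow_two] at hβ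
  induction hβ using Submodule.mul_induction_on' with
  | mem_mul_mem m hm n hn =>
    obtain ⟨a, rfl⟩ := hm
    obtain ⟨c, rfl⟩ := hn
    rw [mul_assoc, hsw c v, mul_neg, ← mul_assoc, hsw a v, neg_mul, neg_neg, mul_assoc]
  | add x hx y hy ihx ihy => rw [add_mul, mul_add, ihx, ihy]

lemma scroll_quad {k : Type*} [Field k] {w : Fin 5 → k} (h : w ∈ coneScroll k) :
    w 0 * w 3 = w 1 * w 2 ∧ w 0 * w 4 = w 1 * w 3 ∧ w 2 * w 4 = w 3 * w 3 := by
  obtain ⟨a, b, s, t, rfl⟩ := h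
  refine ⟨?_, ?_, ?_⟩ <;> simp <;> ring

lemma scroll_no3 {k : Type*} [Field k] (S : (Fin 3 → k) →ₗ[k] (Fin 5 → k))
    (hS : Function.Injective S) (h : ∀ c, S c ∈ coneScroll k) : False := by
  have hex : ∀ i j : Fin 5, ∃ c, S c ≠ 0 ∧ S c i = 0 ∧ S c j = 0 := by
    intro i j
    let f : (Fin 3 → k) →ₗ[k] (Fin 2 → k) :=
      LinearMap.pi ![LinearMap.proj i ∘ₗ S, LinearMap.proj j ∘ₗ S]
    have hf : LinearMap.ker f ≠ ⊥ := LinearMap.ker_ne_bot_of_finrank_lt (by simp)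
    obtain ⟨c, hc, hc0⟩ := (Submodule.ne_bot_iff _).mp hf
    refine ⟨c, fun h0 => hc0 (hS (by rw [h0, map_zero])), ?_, ?_⟩
    · have := congrFun hc 0; simpa [f] using this
    · have := congrFun hc 1; simpa [f] using this
  have hp : ∀ u v, S u 0 * S v 3 + S v 0 * S u 3 = S u 1 * S v 2 + S v 1 * S u 2 ∧
      S u 0 * S v 4 + S v 0 * S u 4 = S u 1 * S v 3 + S v 1 * S u 3 := by
    intro u v
    have h1 := scroll_quad (h u)
    have h2 := scroll_quad (h v)
    have h3 := scroll_quad (h (u + v))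
    simp only [map_add, Pi.add_apply] at h3
    constructor
    · linear_combination h3.1 - h1.1 - h2.1
    · linear_combination h3.2.1 - h1.2.1 - h2.2.1
  have hne : ∀ c, S c ≠ 0 → S c 0 = 0 → S c 1 = 0 → S c 2 = 0 → S c 3 = 0 → S c 4 = 0 → False := by
    intro c hc h0 h1 h2 h3 h4
    apply hc; ext i; fin_cases i <;> simp [*]
  obtain ⟨w, hw, hw2, hw4⟩ := hex 2 4
  have hw3 : S w 3 = 0 := by
    have := (scroll_quad (h w)).2.2
    rw [hw2, zero_mul] at this
    exact mul_self_eq_zero.mp this.symm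
  obtain ⟨v, hv, hv0, hv1⟩ := hex 0 1
  have hwv := hp w v
  simp only [hw2, hw3, hw4, hv0, hv1, zero_mul, mul_zero, add_zero] at hwv
  by_cases ha : S w 0 = 0
  · have hb : S w 1 ≠ 0 := fun hb => hne w hw ha hb hw2 hw3 hw4
    simp only [ha, zero_mul] at hwv
    have hv2 : S v 2 = 0 := by simpa [hb] using hwv.1.symm
    have hv3 : S v 3 = 0 := by simpa [hb] using hwv.2.symm
    have hv4 : S v 4 ≠ 0 := fun h4 => hne v hv hv0 hv1 hv2 hv3 h4
    obtain ⟨u, hu, hu1, hu4⟩ := hex 1 4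
    have h1 := hp w u
    have h2 := hp v u
    simp only [hw2, hw3, hw4, hv0, hv1, hv2, hv3, hu1, hu4, ha, zero_mul, mul_zero, add_zero, zero_add] at h1 h2
    have hu2 : S u 2 = 0 := by simpa [hb] using h1.1.symm
    have hu3 : S u 3 = 0 := by simpa [hb] using h1.2.symm
    have hu0 : S u 0 = 0 := by simpa [hv4] using h2.2
    exact hne u hu hu0 hu1 hu2 hu3 hu4
  · obtain ⟨u, hu, hu0, hu2⟩ := hex 0 2
    have h1 := hp w u
    simp only [hw2, hw3, hw4, hu0, hu2, zero_mul, mul_zero, add_zero, zero_add] at h1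
    have hu3 : S u 3 = 0 := by simpa [ha] using h1.1
    rw [hu3, mul_zero] at h1
    have hu4 : S u 4 = 0 := by simpa [ha] using h1.2
    have hu1 : S u 1 ≠ 0 := fun h => hne u hu hu0 h hu2 hu3 hu4
    have h2 := hp u v
    simp only [hu0, hu2, hu3, hu4, hv0, hv1, zero_mul, mul_zero, add_zero, zero_add] at h2
    have hv2 : S v 2 = 0 := by simpa [hu1] using h2.1.symm
    have hv3 : S v 3 = 0 := by simpa [hu1] using h2.2.symm
    rw [hv3, mul_zero] at hwv
    have hv4 : S v 4 = 0 := by simpa [ha] using hwv.2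
    exact hne v hv hv0 hv1 hv2 hv3 hv4

lemma scroll_vertex {k : Type*} [Field k] [Infinite k] (x : Fin 5 → k)
    (h : ∀ y ∈ coneScroll k, y ≠ 0 → y + x ∈ coneScroll k) : x = 0 := by
  classical
  obtain ⟨l, hl⟩ := Infinite.exists_notMem_finset ({0, 1} : Finset k)
  simp only [Finset.mem_insert, Finset.mem_singleton, not_or] at hl
  have hl1 : l - 1 ≠ 0 := sub_ne_zero.mpr hl.2
  have key : ∀ y ∈ coneScroll k, y ≠ 0 → l • y ∈ coneScroll k →
      y 0 * x 3 + x 0 * y 3 = y 1 * x 2 + x 1 * y 2 ∧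
      y 0 * x 4 + x 0 * y 4 = y 1 * x 3 + x 1 * y 3 := by
    intro y hy hy0 hly
    have h1 := scroll_quad (h y hy hy0)
    have h2 := scroll_quad (h _ hly (smul_ne_zero hl.1 hy0))
    have h3 := scroll_quad hy
    simp only [Pi.add_apply, Pi.smul_apply, smul_eq_mul] at h1 h2
    constructor
    · apply mul_left_cancel₀ hl1
      linear_combination h2.1 - h1.1 - (l ^ 2 - 1) * h3.1
    · apply mul_left_cancel₀ hl1
      linear_combination h2.2.1 - h1.2.1 - (l ^ 2 - 1) * h3.2.1
  have k0 := key ![1, 0, 0, 0, 0] ⟨1, 0, 1, 0, by simp⟩ (fun h => by simpa using congrFun h 0)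
    ⟨l, 0, 1, 0, by ext i; fin_cases i <;> simp⟩
  have k1 := key ![0, 1, 0, 0, 0] ⟨1, 0, 0, 1, by simp⟩ (fun h => by simpa using congrFun h 1)
    ⟨l, 0, 0, 1, by ext i; fin_cases i <;> simp⟩
  have k2 := key ![0, 0, 1, 0, 0] ⟨0, 1, 1, 0, by simp⟩ (fun h => by simpa using congrFun h 2)
    ⟨0, l, 1, 0, by ext i; fin_cases i <;> simp⟩
  have k4 := key ![0, 0, 0, 0, 1] ⟨0, 1, 0, 1, by simp⟩ (fun h => by simpa using congrFun h 4)
    ⟨0, l, 0, 1, by ext i; fin_cases i <;> simp⟩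
  simp at k0 k1 k2 k4
  ext i; fin_cases i
  · exact k4
  · exact k2.symm
  · exact k1.1.symm
  · exact k0.1
  · exact k0.2

/-- Structure of a `3 × 2` matrix whose rank-one locus is a cubic scroll: the matrices in the
image form the orthogonal complement of a rank two matrix `N`. -/
lemma scroll_struct {k : Type*} [Field k] [Infinite k] (B : Matrix (Fin 3) (Fin 2) (Fin 5 → k))
    (hB : IsCubicScroll B) :
    ∃ N : Fin 3 → Fin 2 → k,
      (∀ M : Fin 3 → Fin 2 → k, ∑ i, ∑ m, N i m * M i m = 0 →
        ∃ φ : Fin 5 → k, ∀ i m, ∑ l, φ l * B i m l = M i m) ∧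
      ∀ r : Fin 2 → k, (∀ i, ∑ m, N i m * r m = 0) → r = 0 := by
  obtain ⟨g, hg⟩ := hB
  let T : (Fin 5 → k) →ₗ[k] (Fin 3 → Fin 2 → k) :=
    { toFun := fun φ i m => ∑ l, φ l * B i m l
      map_add' := by intro x y; ext i m; simp [add_mul, Finset.sum_add_distrib]
      map_smul' := by intro c x; ext i m; simp [Finset.mul_sum, mul_assoc] }
  have hT : ∀ φ i m, T φ i m = ∑ l, φ l * B i m l := fun _ _ _ => rfl
  have hloc : ∀ φ, φ ∈ rankOneLocus B ↔ (Matrix.of (T φ)).rank = 1 := fun φ => Iff.rfl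
  have hinj : Function.Injective T := by
    rw [← LinearMap.ker_eq_bot, LinearMap.ker_eq_bot']
    intro φ hφ
    have := scroll_vertex (g.symm φ) (by
      intro y hy hy0
      have h1 : g y ∈ rankOneLocus B ∪ {0} := hg ▸ ⟨y, hy, rfl⟩
      have h2 : g y ∈ rankOneLocus B := h1.resolve_right (by simpa using hy0)
      have h3 : g y + φ ∈ rankOneLocus B ∪ {0} := by
        left
        rw [hloc] at h2 ⊢
        rwa [map_add, hφ, add_zero]
      rw [hg] at h3
      obtain ⟨z, hz, hz'⟩ := h3
      have : y + g.symm φ = z := by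
        apply g.injective; simp [hz']
      rwa [this])
    simpa using this
  have hfr : Module.finrank k (LinearMap.range T) = 5 := by
    rw [LinearMap.finrank_range_of_inj hinj]; simp
  have h6 : Module.finrank k (Fin 3 → Fin 2 → k) = 6 := by
    rw [Module.finrank_pi_fintype]; simp
  have hlt : LinearMap.range T < ⊤ := by
    rw [lt_top_iff_ne_top]; intro h
    rw [h, finrank_top, h6] at hfr; omega
  obtain ⟨f, hf0, hf⟩ := Submodule.exists_le_ker_of_lt_top _ hlt
  have hker : LinearMap.range T = LinearMap.ker f := by
    apply Submodule.eq_of_le_of_finrank_le hf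
    have h1 := LinearMap.finrank_range_add_finrank_ker f
    have h2 : LinearMap.range f = ⊤ := LinearMap.range_eq_top.mpr (LinearMap.surjective hf0)
    rw [h2, finrank_top, h6] at h1
    simp at h1
    omega
  let N : Fin 3 → Fin 2 → k := fun i m => f (Pi.single i (Pi.single m 1))
  have hfN : ∀ M, f M = ∑ i, ∑ m, N i m * M i m := by
    intro M
    have : M = ∑ i, ∑ m, M i m • (Pi.single i (Pi.single m 1) : Fin 3 → Fin 2 → k) := by
      ext i m
      fin_cases i <;> fin_cases m <;> simp [Fin.sum_univ_succ]
    conv_lhs => rw [this]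
    simp [map_sum, N, mul_comm]
  have hN1 : ∀ M : Fin 3 → Fin 2 → k, ∑ i, ∑ m, N i m * M i m = 0 →
        ∃ φ : Fin 5 → k, T φ = M := by
    intro M hM
    rw [← hfN] at hM
    have : M ∈ LinearMap.range T := by rw [hker]; exact hM
    exact this
  refine ⟨N, fun M hM => ?_, ?_⟩
  · obtain ⟨φ, hφ⟩ := hN1 M hM
    exact ⟨φ, fun i m => by rw [← hT, hφ]⟩
  · intro r hr
    by_contra hr0
    have hc : ∀ c : Fin 3 → k, ∃ φ, T φ = fun i m => c i * r m := by
      intro c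
      apply hN1
      apply Finset.sum_eq_zero
      intro i _
      calc ∑ m, N i m * (c i * r m) = c i * ∑ m, N i m * r m := by
            rw [Finset.mul_sum]; exact Finset.sum_congr rfl fun m _ => by ring
        _ = 0 := by rw [hr, mul_zero]
    choose S hS using hc
    obtain ⟨m, hm⟩ := Function.ne_iff.mp hr0
    let S' : (Fin 3 → k) →ₗ[k] (Fin 5 → k) :=
      { toFun := S
        map_add' := by
          intro x y; apply hinj; rw [map_add, hS, hS, hS]; ext i m; simp [add_mul]
        map_smul' := by
          intro x y; apply hinj; rw [map_smul, hS, hS]; ext i m; simp [mul_assoc] }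
    have hSinj : Function.Injective S' := by
      intro x y hxy
      have hxy' : S x = S y := hxy
      have h1 : T (S x) = T (S y) := by rw [hxy']
      rw [hS, hS] at h1
      ext i
      exact mul_right_cancel₀ hm (congrFun (congrFun h1 i) m)
    refine scroll_no3 (g.symm.toLinearMap ∘ₗ S') (g.symm.injective.comp hSinj) fun c => ?_
    have hmem : S c ∈ rankOneLocus B ∪ {0} := by
      by_cases hc0 : c = 0
      · right
        subst hc0
        exact map_zero S'
      · left
        rw [hloc, hS]
        have he : (Matrix.of fun i m => c i * r m) = Matrix.vecMulVec c r := rfl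
        rw [he]
        apply le_antisymm (Matrix.rank_vecMulVec_le c r)
        rw [Nat.one_le_iff_ne_zero]
        intro h0
        rw [Matrix.rank, Submodule.finrank_eq_zero, LinearMap.range_eq_bot] at h0
        have h0 : Matrix.vecMulVec c r = 0 := by
          apply Matrix.mulVec_injective
          ext x i
          simpa using congrFun (LinearMap.congr_fun h0 x) i
        obtain ⟨i, hi⟩ := Function.ne_iff.mp hc0
        have := congrFun (congrFun h0 i) m
        simp [Matrix.vecMulVec_apply] at this
        exact this.elim hi hm
    rw [hg] at hmem
    obtain ⟨z, hz, hz'⟩ := hmem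
    have : (g.symm.toLinearMap ∘ₗ S') c = z := by
      apply g.injective
      rw [hz']; simp [S']
    rw [this]; exact hz

/-- The quadratic map `b ↦ w₁ ∧ w₂`, where `(w₁, w₂)` is the combination of rows of `B`. -/
noncomputable def quadB {k : Type*} [Field k] (B : Matrix (Fin 3) (Fin 2) (Fin 5 → k))
    (b : Fin 3 → k) : ExteriorAlgebra k (Fin 5 → k) :=
  ι k (∑ i, b i • B i 0) * ι k (∑ i, b i • B i 1)

/-- The quadratic map `c ↦ v₁ ∧ v₂`, where `(v₁, v₂)` is the combination of columns of `A`. -/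
noncomputable def quadA {k : Type*} [Field k] (A : Matrix (Fin 2) (Fin 4) (Fin 5 → k))
    (c : Fin 4 → k) : ExteriorAlgebra k (Fin 5 → k) :=
  ι k (∑ j, c j • A 0 j) * ι k (∑ j, c j • A 1 j)

lemma quadB_key {k : Type*} [Field k] [Infinite k] (B : Matrix (Fin 3) (Fin 2) (Fin 5 → k))
    (hB : IsCubicScroll B) (e : ExteriorAlgebra k (Fin 5 → k))
    (he : ∀ φ ψ : Module.Dual k (Fin 5 → k), ∃ η ∈ ⋀[k]^3 (Fin 5 → k),
        ∀ w₁ w₂ : Fin 5 → k, ι k w₁ * ι k w₂ * η = (φ w₂ * ψ w₁ - φ w₁ * ψ w₂) • e)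
    (c c' : Fin 3 → k) :
    ∃ η ∈ ⋀[k]^3 (Fin 5 → k), ∀ b, quadB B b * η = ((∑ i, c i * b i) * ∑ i, c' i * b i) • e := by
  obtain ⟨N, hN1, hN2⟩ := scroll_struct B hB
  -- the basic construction
  have base : ∀ (c c' : Fin 3 → k) (r r' : Fin 2 → k),
      (∑ i, ∑ m, N i m * (c i * r m) = 0) → (∑ i, ∑ m, N i m * (c' i * r' m) = 0) →
      r 1 * r' 0 - r 0 * r' 1 ≠ 0 →
      ∃ η ∈ ⋀[k]^3 (Fin 5 → k), ∀ b, quadB B b * η = ((∑ i, c i * b i) * ∑ i, c' i * b i) • e := by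
    intro c c' r r' h1 h2 hD
    obtain ⟨φ, hφ⟩ := hN1 _ h1
    obtain ⟨ψ, hψ⟩ := hN1 _ h2
    have hdual : ∀ φ : Fin 5 → k, ∃ f : Module.Dual k (Fin 5 → k), ∀ v, f v = ∑ l, φ l * v l := by
      intro φ
      exact ⟨∑ l, φ l • LinearMap.proj l, fun v => by simp⟩
    obtain ⟨f, hf⟩ := hdual φ
    obtain ⟨f', hf'⟩ := hdual ψ
    obtain ⟨η, hη, hη'⟩ := he f f'
    refine ⟨(r 1 * r' 0 - r 0 * r' 1)⁻¹ • η, Submodule.smul_mem _ _ hη, fun b => ?_⟩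
    have e1 : ∀ m, f (∑ i, b i • B i m) = (∑ i, c i * b i) * r m := by
      intro m
      rw [map_sum, Finset.sum_mul]
      refine Finset.sum_congr rfl fun i _ => ?_
      rw [map_smul, hf, hφ, smul_eq_mul]; ring
    have e2 : ∀ m, f' (∑ i, b i • B i m) = (∑ i, c' i * b i) * r' m := by
      intro m
      rw [map_sum, Finset.sum_mul]
      refine Finset.sum_congr rfl fun i _ => ?_
      rw [map_smul, hf', hψ, smul_eq_mul]; ring
    rw [quadB, mul_smul_comm, hη', e1, e1, e2, e2, smul_smul]
    congr 1
    field_simp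
  let n : (Fin 3 → k) → Fin 2 → k := fun c m => ∑ i, c i * N i m
  have hn : ∀ (c : Fin 3 → k) (r : Fin 2 → k),
      ∑ i, ∑ m, N i m * (c i * r m) = n c 0 * r 0 + n c 1 * r 1 := by
    intro c r
    simp [n, Fin.sum_univ_succ]; ring
  have base2 : ∀ c c' : Fin 3 → k, n c 1 * n c' 0 - n c 0 * n c' 1 ≠ 0 →
      ∃ η ∈ ⋀[k]^3 (Fin 5 → k), ∀ b, quadB B b * η = ((∑ i, c i * b i) * ∑ i, c' i * b i) • e := by
    intro c c' hD
    refine base c c' ![n c 1, - n c 0] ![n c' 1, - n c' 0] ?_ ?_ ?_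
    · rw [hn]; simp; ring
    · rw [hn]; simp; ring
    · intro h; apply hD; simp at h; linear_combination h
  have base3 : ∀ c c' : Fin 3 → k, n c ≠ 0 →
      ∃ η ∈ ⋀[k]^3 (Fin 5 → k), ∀ b, quadB B b * η = ((∑ i, c i * b i) * ∑ i, c' i * b i) • e := by
    intro c c' hc
    by_cases hD : n c 1 * n c' 0 - n c 0 * n c' 1 = 0
    swap
    · exact base2 c c' hD
    obtain ⟨d, hd⟩ : ∃ d, n c 1 * n d 0 - n c 0 * n d 1 ≠ 0 := by
      by_contra hcon
      push Not at hcon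
      have := hN2 ![n c 1, - n c 0] (by
        intro i
        have := hcon (Pi.single i 1)
        simp [n, Pi.single_apply] at this
        simp [n]
        linear_combination this)
      apply hc
      ext m
      fin_cases m
      · simpa using congrFun this 1
      · simpa using congrFun this 0
    have hadd : ∀ m, n (c' + d) m = n c' m + n d m := by
      intro m; simp [n, add_mul, Finset.sum_add_distrib]
    obtain ⟨η₁, m₁, h₁⟩ := base2 c d hd
    obtain ⟨η₂, m₂, h₂⟩ := base2 c (c' + d) (by
      rw [hadd, hadd]; intro h; apply hd; linear_combination h - hD)
    refine ⟨η₂ - η₁, Submodule.sub_mem _ m₂ m₁, fun b => ?_⟩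
    rw [mul_sub, h₁, h₂, ← sub_smul]
    congr 1
    simp only [Pi.add_apply, add_mul, Finset.sum_add_distrib]
    ring
  by_cases hc : n c = 0
  · by_cases hc' : n c' = 0
    · refine base c c' ![0, 1] ![1, 0] ?_ ?_ ?_
      · rw [hn]; simp [hc]
      · rw [hn]; simp [hc']
      · simp
    · obtain ⟨η, m, h⟩ := base3 c' c hc'
      exact ⟨η, m, fun b => by rw [h, mul_comm]⟩
  · exact base3 c c' hc

lemma quadB_key_dual {k : Type*} [Field k] [Infinite k] (B : Matrix (Fin 3) (Fin 2) (Fin 5 → k))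
    (hB : IsCubicScroll B) (e : ExteriorAlgebra k (Fin 5 → k))
    (he : ∀ φ ψ : Module.Dual k (Fin 5 → k), ∃ η ∈ ⋀[k]^3 (Fin 5 → k),
        ∀ w₁ w₂ : Fin 5 → k, ι k w₁ * ι k w₂ * η = (φ w₂ * ψ w₁ - φ w₁ * ψ w₂) • e)
    (f f' : Module.Dual k (Fin 3 → k)) :
    ∃ η ∈ ⋀[k]^3 (Fin 5 → k), ∀ b, quadB B b * η = (f b * f' b) • e := by
  have hf : ∀ (f : Module.Dual k (Fin 3 → k)) b, ∑ i, f (Pi.single i 1) * b i = f b := by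
    intro f b
    conv_rhs => rw [pi_eq_sum_univ' b]
    rw [map_sum]
    exact Finset.sum_congr rfl fun i _ => by rw [map_smul, smul_eq_mul, mul_comm]
  obtain ⟨η, h1, h2⟩ := quadB_key B hB e he (fun i => f (Pi.single i 1)) (fun i => f' (Pi.single i 1))
  exact ⟨η, h1, fun b => by rw [h2, hf, hf]⟩

lemma quadB_lin {k : Type*} [Field k] (B : Matrix (Fin 3) (Fin 2) (Fin 5 → k)) (b b' : Fin 3 → k) :
    ∃ M, ∀ x y : k, quadB B (x • b + y • b') =
      (x ^ 2) • quadB B b + (x * y) • M + (y ^ 2) • quadB B b' := by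
  refine ⟨ι k (∑ i, b i • B i 0) * ι k (∑ i, b' i • B i 1) +
    ι k (∑ i, b' i • B i 0) * ι k (∑ i, b i • B i 1), fun x y => ?_⟩
  have h : ∀ m, ∑ i, (x • b + y • b') i • B i m = x • ∑ i, b i • B i m + y • ∑ i, b' i • B i m := by
    intro m
    rw [Finset.smul_sum, Finset.smul_sum, ← Finset.sum_add_distrib]
    exact Finset.sum_congr rfl fun i _ => by simp [add_smul, mul_smul]
  rw [quadB, h, h, quadB, quadB]
  simp only [map_add, map_smul, add_mul, mul_add, smul_mul_assoc, mul_smul_comm, smul_add, smul_smul]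
  rw [mul_comm y x, pow_two, pow_two]
  abel

lemma quadA_lin {k : Type*} [Field k] (A : Matrix (Fin 2) (Fin 4) (Fin 5 → k)) (b b' : Fin 4 → k) :
    ∃ M, ∀ x y : k, quadA A (x • b + y • b') =
      (x ^ 2) • quadA A b + (x * y) • M + (y ^ 2) • quadA A b' := by
  refine ⟨ι k (∑ i, b i • A 0 i) * ι k (∑ i, b' i • A 1 i) +
    ι k (∑ i, b' i • A 0 i) * ι k (∑ i, b i • A 1 i), fun x y => ?_⟩
  have h : ∀ m, ∑ i, (x • b + y • b') i • A m i = x • ∑ i, b i • A m i + y • ∑ i, b' i • A m i := by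
    intro m
    rw [Finset.smul_sum, Finset.smul_sum, ← Finset.sum_add_distrib]
    exact Finset.sum_congr rfl fun i _ => by simp [add_smul, mul_smul]
  rw [quadA, h, h, quadA, quadA]
  simp only [map_add, map_smul, add_mul, mul_add, smul_mul_assoc, mul_smul_comm, smul_add, smul_smul]
  rw [mul_comm y x, pow_two, pow_two]
  abel

lemma quadB_mem {k : Type*} [Field k] (B : Matrix (Fin 3) (Fin 2) (Fin 5 → k)) (b : Fin 3 → k) :
    quadB B b ∈ coneZ (rowSpace B) := by
  refine ⟨(∑ i, b i • B i 0, ∑ i, b i • B i 1), ?_, rfl⟩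
  rw [rowSpace, Submodule.mem_span_range_iff_exists_fun]
  exact ⟨b, by ext <;> simp [Prod.fst_sum, Prod.snd_sum]⟩

lemma quadA_mem {k : Type*} [Field k] (A : Matrix (Fin 2) (Fin 4) (Fin 5 → k)) (b : Fin 4 → k) :
    quadA A b ∈ coneZ (colSpace A) := by
  refine ⟨(∑ i, b i • A 0 i, ∑ i, b i • A 1 i), ?_, rfl⟩
  rw [colSpace, Submodule.mem_span_range_iff_exists_fun]
  exact ⟨b, by ext <;> simp [Prod.fst_sum, Prod.snd_sum]⟩

lemma mem_quadB {k : Type*} [Field k] (B : Matrix (Fin 3) (Fin 2) (Fin 5 → k))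
    {ω : ExteriorAlgebra k (Fin 5 → k)} (h : ω ∈ coneZ (rowSpace B)) : ∃ b, quadB B b = ω := by
  obtain ⟨p, hp, rfl⟩ := h
  rw [rowSpace, Submodule.mem_span_range_iff_exists_fun] at hp
  obtain ⟨b, rfl⟩ := hp
  exact ⟨b, by simp [quadB, Prod.fst_sum, Prod.snd_sum]⟩

lemma mem_quadA {k : Type*} [Field k] (A : Matrix (Fin 2) (Fin 4) (Fin 5 → k))
    {ω : ExteriorAlgebra k (Fin 5 → k)} (h : ω ∈ coneZ (colSpace A)) : ∃ b, quadA A b = ω := by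
  obtain ⟨p, hp, rfl⟩ := h
  rw [colSpace, Submodule.mem_span_range_iff_exists_fun] at hp
  obtain ⟨b, rfl⟩ := hp
  exact ⟨b, by simp [quadA, Prod.fst_sum, Prod.snd_sum]⟩

/-- A linear form nonzero at `x s` and vanishing at `x t`, `t ∈ X`. -/
def SepForm {k I E : Type*} [Field k] [AddCommGroup E] [Module k E] (x : I → E) (s : I)
    (X : Finset I) : Prop :=
  ∃ f : Module.Dual k E, f (x s) ≠ 0 ∧ ∀ t ∈ X, f (x t) = 0

lemma sepForm_one {k I E : Type*} [Field k] [AddCommGroup E] [Module k E] (x : I → E)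
    (h : ∀ s t, s ≠ t → ∀ μ : k, x s ≠ μ • x t) (h0 : ∀ s, x s ≠ 0) (s : I) (X : Finset I)
    (hs : s ∉ X) (hX : X.card ≤ 1) : SepForm (k := k) x s X := by
  have hn : x s ∉ Submodule.span k (x '' X) := by
    haveI : Nonempty I := ⟨s⟩
    rcases Finset.card_le_one_iff_subset_singleton (s := X) |>.mp hX with ⟨t, ht⟩
    rcases Finset.subset_singleton_iff.mp ht with rfl | rfl
    · simpa using h0 s
    · intro hm
      simp only [Finset.coe_singleton, Set.image_singleton] at hm
      obtain ⟨μ, hμ⟩ := Submodule.mem_span_singleton.mp hm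
      exact h s t (by simpa using hs) μ hμ.symm
  obtain ⟨f, hf, hf'⟩ := Submodule.exists_le_ker_of_notMem hn
  exact ⟨f, hf, fun t ht => hf' (Submodule.subset_span ⟨t, ht, rfl⟩)⟩

lemma sepForm_two {k I E : Type*} [Field k] [DecidableEq I] [AddCommGroup E] [Module k E]
    (x : I → E) (h : ∀ s t, s ≠ t → ∀ μ : k, x s ≠ μ • x t)
    (s t u : I) (hst : s ≠ t) (hsu : s ≠ u) (hno : ¬ SepForm (k := k) x s {t, u}) :
    ∃ p q : k, p ≠ 0 ∧ q ≠ 0 ∧ x u = p • x s + q • x t := by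
  have hm : x s ∈ Submodule.span k {x t, x u} := by
    by_contra hn
    obtain ⟨f, hf, hf'⟩ := Submodule.exists_le_ker_of_notMem hn
    refine hno ⟨f, hf, fun v hv => ?_⟩
    simp only [Finset.mem_insert, Finset.mem_singleton] at hv
    rcases hv with rfl | rfl
    · exact hf' (Submodule.subset_span (by simp))
    · exact hf' (Submodule.subset_span (by simp))
  obtain ⟨a, b, hab⟩ := Submodule.mem_span_pair.mp hm
  have hb : b ≠ 0 := by
    rintro rfl
    exact h s t hst a (by rw [← hab]; simp)
  have ha : a ≠ 0 := by
    rintro rfl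
    exact h s u hsu b (by rw [← hab]; simp)
  refine ⟨b⁻¹, -(b⁻¹ * a), inv_ne_zero hb, neg_ne_zero.mpr (mul_ne_zero (inv_ne_zero hb) ha), ?_⟩
  rw [← hab, smul_add, smul_smul, smul_smul, inv_mul_cancel₀ hb, one_smul]
  module

lemma split_one {I : Type*} [DecidableEq I] (T : Finset I) (n : ℕ) (h : T.card ≤ n + 1) :
    ∃ X T' : Finset I, X.card ≤ 1 ∧ T'.card ≤ n ∧ X ⊆ T ∧ T' ⊆ T ∧ ∀ t ∈ T, t ∈ X ∨ t ∈ T' := by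
  rcases T.eq_empty_or_nonempty with rfl | ⟨a, ha⟩
  · exact ⟨∅, ∅, by simp⟩
  · refine ⟨{a}, T.erase a, by simp, ?_, by simpa using ha, Finset.erase_subset _ _, ?_⟩
    · rw [Finset.card_erase_of_mem ha]; omega
    · intro t ht; by_cases h : t = a <;> simp [h, ht]

lemma sep_comb {I : Type*} [Fintype I] [DecidableEq I] (s : I) (hI : Fintype.card I ≤ 6)
    (P Q : Finset I → Prop) (hP : ∀ X, s ∉ X → X.card ≤ 1 → P X)
    (hQ : ∀ X, s ∉ X → X.card ≤ 1 → Q X)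
    (h : Fintype.card I ≤ 5 ∨ ∃ t u, t ≠ s ∧ u ≠ s ∧ t ≠ u ∧ (P {t, u} ∨ Q {t, u})) :
    ∃ X₁ X₂ X₃ Y, P X₁ ∧ P X₂ ∧ P X₃ ∧ Q Y ∧
      ∀ t, t ≠ s → t ∈ X₁ ∨ t ∈ X₂ ∨ t ∈ X₃ ∨ t ∈ Y := by
  have hT : (Finset.univ.erase s).card = Fintype.card I - 1 := by
    rw [Finset.card_erase_of_mem (Finset.mem_univ s), Finset.card_univ]
  rcases h with h | ⟨t, u, ht, hu, htu, h⟩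
  · obtain ⟨X₁, T₁, a1, a2, a3, a4, a5⟩ := split_one (Finset.univ.erase s) 3 (by omega)
    obtain ⟨X₂, T₂, b1, b2, b3, b4, b5⟩ := split_one T₁ 2 (by omega)
    obtain ⟨X₃, T₃, c1, c2, c3, c4, c5⟩ := split_one T₂ 1 (by omega)
    have hs : s ∉ Finset.univ.erase s := by simp
    have hs1 : s ∉ T₁ := fun h => hs (a4 h)
    have hs2 : s ∉ T₂ := fun h => hs1 (b4 h)
    have hs3 : s ∉ T₃ := fun h => hs2 (c4 h)
    refine ⟨X₁, X₂, X₃, T₃, hP _ (fun h => hs (a3 h)) a1, hP _ (fun h => hs1 (b3 h)) b1,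
      hP _ (fun h => hs2 (c3 h)) c1, hQ _ hs3 c2, fun t ht => ?_⟩
    rcases a5 t (by simpa using ht) with h | h
    · exact Or.inl h
    rcases b5 t h with h | h
    · exact Or.inr (Or.inl h)
    rcases c5 t h with h | h
    · exact Or.inr (Or.inr (Or.inl h))
    · exact Or.inr (Or.inr (Or.inr h))
  · have hT' : (((Finset.univ.erase s).erase t).erase u).card ≤ 2 + 1 := by
      rw [Finset.card_erase_of_mem (by simp [hu, htu.symm]),
        Finset.card_erase_of_mem (by simp [ht]), hT]; omega
    obtain ⟨X₁, T₁, a1, a2, a3, a4, a5⟩ := split_one _ 2 hT'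
    obtain ⟨X₂, T₂, b1, b2, b3, b4, b5⟩ := split_one T₁ 1 (by omega)
    have hs : s ∉ ((Finset.univ.erase s).erase t).erase u := by simp
    have hs1 : s ∉ T₁ := fun h => hs (a4 h)
    have hs2 : s ∉ T₂ := fun h => hs1 (b4 h)
    have cov : ∀ v, v ≠ s → v ∈ X₁ ∨ v ∈ X₂ ∨ v ∈ T₂ ∨ v ∈ ({t, u} : Finset I) := by
      intro v hv
      by_cases h1 : v ∈ ({t, u} : Finset I)
      · simp only [h1, or_true]
      · simp only [Finset.mem_insert, Finset.mem_singleton, not_or] at h1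
        rcases a5 v (by simp [hv, h1]) with h | h
        · exact Or.inl h
        rcases b5 v h with h | h
        · exact Or.inr (Or.inl h)
        · exact Or.inr (Or.inr (Or.inl h))
    have p1 := fun (h : s ∈ X₁) => hs (a3 h)
    have p2 := fun (h : s ∈ X₂) => hs1 (b3 h)
    rcases h with h | h
    · refine ⟨X₁, X₂, {t, u}, T₂, hP _ p1 a1, hP _ p2 b1, h, hQ _ hs2 b2, fun v hv => ?_⟩
      have := cov v hv
      tauto
    · exact ⟨X₁, X₂, T₂, {t, u}, hP _ p1 a1, hP _ p2 b1, hP _ hs2 b2, h, cov⟩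

lemma three_roots {k : Type*} [Field k] (p q r : k) (x y : Fin 3 → k) (hy : ∀ i, y i ≠ 0)
    (hne : ∀ i j, i ≠ j → x i * y j ≠ x j * y i)
    (h : ∀ i, p * x i ^ 2 + q * (x i * y i) + r * y i ^ 2 = 0) : p = 0 ∧ q = 0 ∧ r = 0 := by
  have h' : ∀ i, p * (x i / y i) ^ 2 + q * (x i / y i) + r = 0 := by
    intro i
    have := hy i
    field_simp
    linear_combination h i
  have hd : ∀ i j, i ≠ j → x i / y i - x j / y j ≠ 0 := by
    intro i j hij
    rw [sub_ne_zero, Ne, div_eq_div_iff (hy i) (hy j)]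
    exact hne i j hij
  have h0 := h' 0
  have h1 := h' 1
  have h2 := h' 2
  have d01 := hd 0 1 (by decide)
  have d02 := hd 0 2 (by decide)
  have d12 := hd 1 2 (by decide)
  have e1 : p * (x 0 / y 0 + x 1 / y 1) + q = 0 := by
    apply mul_left_cancel₀ d01
    linear_combination h0 - h1
  have e2 : p * (x 0 / y 0 + x 2 / y 2) + q = 0 := by
    apply mul_left_cancel₀ d02
    linear_combination h0 - h2
  have hp : p = 0 := by
    apply mul_left_cancel₀ d12
    linear_combination e1 - e2
  subst hp
  have hq : q = 0 := by linear_combination e1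
  subst hq
  refine ⟨rfl, rfl, by linear_combination h0⟩

/-- If both configurations are collinear, then `Γ` is infinite. -/
lemma collinear_absurd {k : Type*} [Field k] [Infinite k]
    (A : Matrix (Fin 2) (Fin 4) (Fin 5 → k)) (B : Matrix (Fin 3) (Fin 2) (Fin 5 → k))
    (hB : IsCubicScroll B) (hfin : (gammaSet A B).Finite)
    (bs bt : Fin 3 → k) (cs ct : Fin 4 → k)
    (hst : ∀ μ : k, bs ≠ μ • bt) (hts : ∀ μ : k, bt ≠ μ • bs)
    (hs : quadA A cs = quadB B bs) (ht : quadA A ct = quadB B bt)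
    (x y x' y' : Fin 3 → k) (hx' : ∀ i, x' i ≠ 0) (hy' : ∀ i, y' i ≠ 0)
    (hu : ∀ i, quadB B (x i • bs + y i • bt) = quadA A (x' i • cs + y' i • ct))
    (hne : ∀ i j, i ≠ j → x' i * y' j ≠ x' j * y' i) : False := by
  obtain ⟨e, θ, hθ, he⟩ := ext_top (k := k)
  have hform : ∀ f f' : Module.Dual k (Fin 3 → k), ∃ h : Module.Dual k (ExteriorAlgebra k (Fin 5 → k)),
      ∀ b, h (quadB B b) = f b * f' b := by
    intro f f'
    obtain ⟨η, -, hη⟩ := quadB_key_dual B hB e he f f'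
    exact ⟨θ ∘ₗ LinearMap.mulRight k η, fun b => by simp [hη, hθ]⟩
  have hdual : ∀ b b' : Fin 3 → k, (∀ μ : k, b ≠ μ • b') →
      ∃ f : Module.Dual k (Fin 3 → k), f b = 1 ∧ f b' = 0 := by
    intro b b' h
    have hn : b ∉ Submodule.span k {b'} := by
      intro hm
      obtain ⟨μ, hμ⟩ := Submodule.mem_span_singleton.mp hm
      exact h μ hμ.symm
    obtain ⟨f, hf, hf'⟩ := Submodule.exists_le_ker_of_notMem hn
    have h0 : f b' = 0 := hf' (Submodule.mem_span_singleton_self b')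
    exact ⟨(f b)⁻¹ • f, by simp [hf], by simp [h0]⟩
  obtain ⟨fs, fss, fst⟩ := hdual bs bt hst
  obtain ⟨ft, ftt, fts⟩ := hdual bt bs hts
  obtain ⟨h₁, H₁⟩ := hform fs fs
  obtain ⟨h₂, H₂⟩ := hform fs ft
  obtain ⟨h₃, H₃⟩ := hform ft ft
  obtain ⟨MA, hMA⟩ := quadA_lin A cs ct
  obtain ⟨MB, hMB⟩ := quadB_lin B bs bt
  rw [hs, ht] at hMA
  have E₁ : ∀ i, x i ^ 2 = x' i ^ 2 + x' i * y' i * h₁ MA := by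
    intro i
    have := congrArg h₁ (hu i)
    rw [hMA, H₁] at this
    simp only [map_add, map_smul, smul_eq_mul, H₁, fss, fst] at this
    linear_combination this
  have E₂ : ∀ i, x i * y i = x' i * y' i * h₂ MA := by
    intro i
    have := congrArg h₂ (hu i)
    rw [hMA, H₂] at this
    simp only [map_add, map_smul, smul_eq_mul, H₂, fss, fst, ftt, fts] at this
    linear_combination this
  have E₃ : ∀ i, y i ^ 2 = y' i ^ 2 + x' i * y' i * h₃ MA := by
    intro i
    have := congrArg h₃ (hu i)
    rw [hMA, H₃] at this
    simp only [map_add, map_smul, smul_eq_mul, H₃, ftt, fts] at this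
    linear_combination this
  obtain ⟨hc, hb, ha⟩ := three_roots (h₃ MA) (1 + h₁ MA * h₃ MA - h₂ MA ^ 2) (h₁ MA) x' y' hy' hne (by
    intro i
    apply mul_left_cancel₀ (mul_ne_zero (hx' i) (hy' i))
    linear_combination (-(y i ^ 2)) * E₁ i - (x' i ^ 2 + x' i * y' i * h₁ MA) * E₃ i
      + (x i * y i + x' i * y' i * h₂ MA) * E₂ i)
  rw [hc, mul_zero, add_zero] at hb
  have hβ : h₂ MA ^ 2 = 1 := by linear_combination -hb
  have hβ0 : h₂ MA ≠ 0 := by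
    intro h; rw [h] at hβ; simp at hβ
  have hMAB : MA = h₂ MA • MB := by
    have h0 := hu 0
    rw [hMA, hMB, E₁, E₂, E₃, ha, hc] at h0
    simp only [mul_zero, add_zero] at h0
    have h1 := add_left_cancel (add_right_cancel h0)
    rw [mul_smul] at h1
    exact (smul_right_injective _ (mul_ne_zero (hx' 0) (hy' 0)) h1).symm
  set β := h₂ MA
  have hq : ∀ z : k, quadA A ((1 : k) • cs + z • ct) = quadB B ((1 : k) • bs + (z * β) • bt) := by
    intro z
    rw [hMA, hMB, hMAB, smul_smul]
    congr 2
    · congr 1; ring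
    · rw [mul_pow, hβ, mul_one]
  have hq1 : ∀ z : k, h₁ (quadA A ((1 : k) • cs + z • ct)) = 1 := by
    intro z
    rw [hq, H₁]; simp [fss, fst]
  have hq2 : ∀ z : k, h₂ (quadA A ((1 : k) • cs + z • ct)) = z * β := by
    intro z
    rw [hq, H₂]; simp [fss, fst, ftt, fts]
  have hq0 : ∀ z : k, quadA A ((1 : k) • cs + z • ct) ≠ 0 := by
    intro z h
    have := hq1 z
    rw [h] at this; simp at this
  refine Set.infinite_of_injective_forall_mem (s := gammaSet A B)
    (f := fun z : k => Projectivization.mk k _ (hq0 z)) ?_ ?_ hfin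
  · intro z z' hz
    rw [Projectivization.mk_eq_mk_iff'] at hz
    obtain ⟨a, ha⟩ := hz
    have h1 := congrArg h₁ ha
    rw [map_smul, hq1, hq1] at h1
    have ha1 : a = 1 := by simpa using h1
    have h2 := congrArg h₂ ha
    rw [map_smul, hq2, hq2, ha1, one_smul] at h2
    exact (mul_right_cancel₀ hβ0 h2).symm
  · intro z
    refine ⟨_, hq0 z, rfl, quadA_mem A _, ?_⟩
    rw [hq]
    exact quadB_mem B _

lemma separation {k : Type*} [Field k] [Infinite k] {I : Type*} [Fintype I]
    (A : Matrix (Fin 2) (Fin 4) (Fin 5 → k)) (B : Matrix (Fin 3) (Fin 2) (Fin 5 → k))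
    (hB : IsCubicScroll B) (hfin : (gammaSet A B).Finite) (hI : Fintype.card I ≤ 6)
    (b : I → Fin 3 → k) (c : I → Fin 4 → k) (hbc : ∀ t, quadA A (c t) = quadB B (b t))
    (h0 : ∀ t, quadB B (b t) ≠ 0)
    (hne : ∀ s t, s ≠ t → ∀ μ : k, quadB B (b s) ≠ μ • quadB B (b t)) (s : I) :
    ∃ (f f₁ f₂ : Module.Dual k (Fin 3 → k)) (g : Module.Dual k (Fin 4 → k)),
      f (b s) * (f₁ (b s) * f₂ (b s)) * g (c s) ≠ 0 ∧
      ∀ t, t ≠ s → f (b t) * (f₁ (b t) * f₂ (b t)) * g (c t) = 0 := by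
  classical
  have hbh : ∀ (μ : k) v, quadB B (μ • v) = μ ^ 2 • quadB B v := by
    intro μ v
    obtain ⟨M, hM⟩ := quadB_lin B v v
    simpa using hM μ 0
  have hch : ∀ (μ : k) v, quadA A (μ • v) = μ ^ 2 • quadA A v := by
    intro μ v
    obtain ⟨M, hM⟩ := quadA_lin A v v
    simpa using hM μ 0
  have hb : ∀ s t, s ≠ t → ∀ μ : k, b s ≠ μ • b t := by
    intro s t hst μ h
    apply hne s t hst (μ ^ 2)
    rw [h, hbh]
  have hc : ∀ s t, s ≠ t → ∀ μ : k, c s ≠ μ • c t := by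
    intro s t hst μ h
    apply hne s t hst (μ ^ 2)
    rw [← hbc, ← hbc, h, hch]
  have hb0 : ∀ s, b s ≠ 0 := by
    intro s h
    apply h0 s
    rw [h]; simp [quadB]
  have hc0 : ∀ s, c s ≠ 0 := by
    intro s h
    apply h0 s
    rw [← hbc, h]; simp [quadA]
  obtain ⟨X₁, X₂, X₃, Y, ⟨f, F, F'⟩, ⟨f₁, F₁, F₁'⟩, ⟨f₂, F₂, F₂'⟩, ⟨g, G, G'⟩, hcov⟩ :=
    sep_comb s hI (SepForm (k := k) b s) (SepForm (k := k) c s)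
      (sepForm_one b hb hb0 s) (sepForm_one c hc hc0 s) (by
    by_contra hcon
    push Not at hcon
    obtain ⟨h5, hcon⟩ := hcon
    obtain ⟨t, ht⟩ : ∃ t, t ≠ s := by
      haveI : Nontrivial I := Fintype.one_lt_card_iff_nontrivial.mp (by omega)
      exact exists_ne s
    have hcard : 3 ≤ ((Finset.univ.erase s).erase t).card := by
      rw [Finset.card_erase_of_mem (by simp [ht]),
        Finset.card_erase_of_mem (by simp), Finset.card_univ]; omega
    obtain ⟨T, hT, hT3⟩ := Finset.exists_subset_card_eq hcard
    let u : Fin 3 → I := fun i => (T.equivFinOfCardEq hT3).symm i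
    have huinj : Function.Injective u := Subtype.val_injective.comp (T.equivFinOfCardEq hT3).symm.injective
    have humem : ∀ i, u i ≠ s ∧ u i ≠ t := by
      intro i
      have := hT ((T.equivFinOfCardEq hT3).symm i).2
      simp only [Finset.mem_erase] at this
      exact ⟨this.2.1, this.1⟩
    have hbu : ∀ i, ∃ p q : k, p ≠ 0 ∧ q ≠ 0 ∧ b (u i) = p • b s + q • b t := fun i =>
      sepForm_two b hb s t (u i) ht.symm (humem i).1.symm
        (hcon t (u i) ht (humem i).1 (humem i).2.symm).1
    have hcu : ∀ i, ∃ p q : k, p ≠ 0 ∧ q ≠ 0 ∧ c (u i) = p • c s + q • c t := fun i =>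
      sepForm_two c hc s t (u i) ht.symm (humem i).1.symm
        (hcon t (u i) ht (humem i).1 (humem i).2.symm).2
    choose x y hx hy hxy using hbu
    choose x' y' hx' hy' hxy' using hcu
    refine collinear_absurd A B hB hfin (b s) (b t) (c s) (c t) (hb s t ht.symm) (hb t s ht)
      (hbc s) (hbc t) x y x' y' hx' hy' (fun i => by rw [← hxy, ← hxy', hbc]) ?_
    intro i j hij he
    apply hc (u i) (u j) (fun h => hij (huinj h)) (y' i / y' j)
    rw [hxy', hxy', smul_add, smul_smul, smul_smul, div_mul_cancel₀ _ (hy' j)]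
    congr 2
    have := hy' j
    field_simp
    linear_combination he)
  refine ⟨f, f₁, f₂, g, mul_ne_zero (mul_ne_zero F (mul_ne_zero F₁ F₂)) G, fun t ht => ?_⟩
  rcases hcov t ht with h | h | h | h
  · rw [F' t h]; ring
  · rw [F₁' t h]; ring
  · rw [F₂' t h]; ring
  · rw [G' t h]; ring

lemma wedge_vanish {k : Type*} [Field k] (A₁ : Matrix (Fin 2) (Fin 4) (Fin 5 → k))
    (B₁ : Matrix (Fin 3) (Fin 2) (Fin 5 → k)) (b : Fin 3 → k) (c : Fin 4 → k)
    (hbc : quadA A₁ c = quadB B₁ b)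
    (A₂ : Matrix (Fin 2) (Fin 4) ↥(⋀[k]^2 (Fin 5 → k)))
    (B₂ : Matrix (Fin 3) (Fin 2) ↥(⋀[k]^2 (Fin 5 → k))) :
    quadB B₁ b * ∑ i, ∑ j, (b i * c j) •
      ((∑ m : Fin 2, ι k (B₁ i m) * (A₂ m j : ExteriorAlgebra k (Fin 5 → k)))
            + ∑ n : Fin 2, (B₂ i n : ExteriorAlgebra k (Fin 5 → k)) * ι k (A₁ n j)) = 0 := by
  have hsw : ∀ x y : Fin 5 → k, ι k x * ι k y = - (ι k y * ι k x) := fun x y =>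
    eq_neg_of_add_eq_zero_left (ι_add_mul_swap x y)
  have kill0 : ∀ x y : Fin 5 → k, ι k x * ι k y * ι k x = 0 := by
    intro x y
    rw [hsw x y, neg_mul, mul_assoc, ι_sq_zero, mul_zero, neg_zero]
  have kill1 : ∀ x y : Fin 5 → k, ι k x * ι k y * ι k y = 0 := by
    intro x y
    rw [mul_assoc, ι_sq_zero, mul_zero]
  have kB : ∀ m, quadB B₁ b * ι k (∑ i, b i • B₁ i m) = 0 := by
    intro m; fin_cases m
    · exact kill0 _ _
    · exact kill1 _ _
  have kA : ∀ n, quadA A₁ c * ι k (∑ j, c j • A₁ n j) = 0 := by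
    intro m; fin_cases m
    · exact kill0 _ _
    · exact kill1 _ _
  have e1 : ∑ i, ∑ j, (b i * c j) •
      ((∑ m : Fin 2, ι k (B₁ i m) * (A₂ m j : ExteriorAlgebra k (Fin 5 → k)))
            + ∑ n : Fin 2, (B₂ i n : ExteriorAlgebra k (Fin 5 → k)) * ι k (A₁ n j)) =
      (∑ m : Fin 2, ι k (∑ i, b i • B₁ i m) * ∑ j, c j • (A₂ m j : ExteriorAlgebra k (Fin 5 → k)))
      + ∑ n : Fin 2, ι k (∑ j, c j • A₁ n j) *
          ∑ i, b i • (B₂ i n : ExteriorAlgebra k (Fin 5 → k)) := by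
    simp only [smul_add, Finset.sum_add_distrib, Finset.smul_sum]
    congr 1
    · rw [Finset.sum_congr rfl fun i _ => Finset.sum_comm, Finset.sum_comm]
      refine Finset.sum_congr rfl fun m _ => ?_
      rw [map_sum, Finset.sum_mul_sum]
      refine Finset.sum_congr rfl fun i _ => Finset.sum_congr rfl fun j _ => ?_
      rw [map_smul, smul_mul_smul_comm]
    · rw [Finset.sum_congr rfl fun i _ => Finset.sum_comm, Finset.sum_comm]
      refine Finset.sum_congr rfl fun m _ => ?_
      rw [map_sum, Finset.sum_mul_sum, Finset.sum_comm]
      refine Finset.sum_congr rfl fun j _ => Finset.sum_congr rfl fun i _ => ?_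
      rw [map_smul, smul_mul_smul_comm, ext_two_comm _ (B₂ i m).2, mul_comm]
  rw [e1, mul_add, Finset.mul_sum, Finset.mul_sum]
  rw [Finset.sum_eq_zero, Finset.sum_eq_zero, add_zero]
  · intro n _
    rw [← mul_assoc, ← hbc, kA, zero_mul]
  · intro m _
    rw [← mul_assoc, kB, zero_mul]


/-!
STATEMENT 5: Assume the generality assumption (`C_A` a smooth rational normal quartic,
`S_B` a smooth rational cubic scroll, `C_A ∩ S_B = ∅`, with `V_A` of dimension 4 and `V_B`
of dimension 3), and suppose `Z_A` and `Z_B` have exactly `r ≤ 6` common points.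
Then `N_{A,B} ≤ 120 − r`.

Here `N_{A,B}` is the rank of the linear map `Φ : (A₂,B₂) ↦ B₁∘A₂ + B₂∘A₁` (entrywise
exterior products) from pairs of a 2×4 matrix `A₂` and a 3×2 matrix `B₂` with entries in
`⋀²V` to 3×4 matrices with entries in `⋀³V`;  `Φ` is given as a linear map characterized
by the entrywise formula, and its rank is `Module.finrank` of its range.
-/
theorem stmt5 (k : Type*) [Field k] [IsAlgClosed k]
    (A₁ : Matrix (Fin 2) (Fin 4) (Fin 5 → k)) (B₁ : Matrix (Fin 3) (Fin 2) (Fin 5 → k))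
    (hCA : IsRNQuartic A₁) (hSB : IsCubicScroll B₁)
    (hdisj : rankOneLocus A₁ ∩ rankOneLocus B₁ = ∅)
    (hVA : Module.finrank k (colSpace A₁) = 4)
    (hVB : Module.finrank k (rowSpace B₁) = 3)
    (Φ : (Matrix (Fin 2) (Fin 4) ↥(⋀[k]^2 (Fin 5 → k))
            × Matrix (Fin 3) (Fin 2) ↥(⋀[k]^2 (Fin 5 → k)))
          →ₗ[k] Matrix (Fin 3) (Fin 4) (ExteriorAlgebra k (Fin 5 → k)))
    (hΦ : ∀ (A₂ : Matrix (Fin 2) (Fin 4) ↥(⋀[k]^2 (Fin 5 → k)))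
          (B₂ : Matrix (Fin 3) (Fin 2) ↥(⋀[k]^2 (Fin 5 → k))) (i : Fin 3) (j : Fin 4),
        Φ (A₂, B₂) i j
          = (∑ m : Fin 2, ι k (B₁ i m) * (A₂ m j : ExteriorAlgebra k (Fin 5 → k)))
            + ∑ n : Fin 2, (B₂ i n : ExteriorAlgebra k (Fin 5 → k)) * ι k (A₁ n j))
    (r : ℕ) (hr : r ≤ 6)
    (hfin : (gammaSet A₁ B₁).Finite) (hcard : (gammaSet A₁ B₁).ncard = r) :
    Module.finrank k (LinearMap.range Φ) ≤ 120 - r := by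
  classical
  haveI : Infinite k := IsAlgClosed.instInfinite
  obtain ⟨e, θ, hθ, he⟩ := ext_top (k := k)
  haveI : Fintype ↥(gammaSet A₁ B₁) := hfin.fintype
  have hcardI : Fintype.card ↥(gammaSet A₁ B₁) = r := by
    rw [← hcard, ← Nat.card_coe_set_eq, Nat.card_eq_fintype_card]
  have hdata : ∀ t : ↥(gammaSet A₁ B₁), ∃ (b : Fin 3 → k) (c : Fin 4 → k),
      quadA A₁ c = quadB B₁ b ∧ ∃ h : quadB B₁ b ≠ 0, t.1 = Projectivization.mk k _ h := by
    rintro ⟨t, ω, hω, rfl, hA, hB⟩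
    obtain ⟨b, rfl⟩ := mem_quadB B₁ hB
    obtain ⟨c, hc⟩ := mem_quadA A₁ hA
    exact ⟨b, c, hc, hω, rfl⟩
  choose b c hbc h0 hmk using hdata
  have hne : ∀ s t, s ≠ t → ∀ μ : k, quadB B₁ (b s) ≠ μ • quadB B₁ (b t) := by
    intro s t hst μ h
    apply hst
    apply Subtype.ext
    rw [hmk s, hmk t, Projectivization.mk_eq_mk_iff']
    exact ⟨μ, h.symm⟩
  have hsep := separation A₁ B₁ hSB hfin (by omega) b c hbc h0 hne
  let L : Matrix (Fin 3) (Fin 4) ↥(⋀[k]^3 (Fin 5 → k)) →ₗ[k] (↥(gammaSet A₁ B₁) → k) :=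
    LinearMap.pi fun t => θ ∘ₗ LinearMap.mulLeft k (quadB B₁ (b t)) ∘ₗ
      ∑ i, ∑ j, (b t i * c t j) •
        ((⋀[k]^3 (Fin 5 → k)).subtype ∘ₗ Matrix.entryLinearMap k ↥(⋀[k]^3 (Fin 5 → k)) i j)
  have hL : ∀ P t, L P t = θ (quadB B₁ (b t) * ∑ i, ∑ j, (b t i * c t j) •
      (P i j : ExteriorAlgebra k (Fin 5 → k))) := by
    intro P t
    simp [L, LinearMap.sum_apply, Finset.mul_sum]
  have hform : ∀ {n : ℕ} (f : Module.Dual k (Fin n → k)) (v : Fin n → k),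
      ∑ i, v i * f (Pi.single i 1) = f v := by
    intro n f v
    conv_rhs => rw [pi_eq_sum_univ' v]
    rw [map_sum]
    exact Finset.sum_congr rfl fun i _ => by rw [map_smul, smul_eq_mul]
  have hone : ∀ s, ∃ P, L P = Pi.single s 1 := by
    intro s
    obtain ⟨f, f₁, f₂, g, hs, ht⟩ := hsep s
    obtain ⟨η, hη, hη'⟩ := quadB_key_dual B₁ hSB e he f₁ f₂
    let P : Matrix (Fin 3) (Fin 4) ↥(⋀[k]^3 (Fin 5 → k)) :=
      Matrix.of fun i j => (f (Pi.single i 1) * g (Pi.single j 1)) • ⟨η, hη⟩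
    have hP : ∀ t, L P t = f (b t) * (f₁ (b t) * f₂ (b t)) * g (c t) := by
      intro t
      have : ∑ i, ∑ j, (b t i * c t j) • (P i j : ExteriorAlgebra k (Fin 5 → k))
          = (f (b t) * g (c t)) • η := by
        rw [← hform f, ← hform g, Finset.sum_mul_sum, Finset.sum_smul]
        refine Finset.sum_congr rfl fun i _ => ?_
        rw [Finset.sum_smul]
        refine Finset.sum_congr rfl fun j _ => ?_
        simp only [P, Matrix.of_apply, Submodule.coe_smul, smul_smul]
        congr 1; ring
      rw [hL, this, mul_smul_comm, hη', map_smul, map_smul, hθ]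
      simp only [smul_eq_mul]; ring
    refine ⟨(f (b s) * (f₁ (b s) * f₂ (b s)) * g (c s))⁻¹ • P, ?_⟩
    ext t
    rw [map_smul, Pi.smul_apply, hP]
    by_cases hst : t = s
    · subst hst
      simp only [Pi.single_eq_same, smul_eq_mul]
      exact inv_mul_cancel₀ hs
    · rw [ht t hst, Pi.single_eq_of_ne hst, smul_zero]
  have hsurj : LinearMap.range L = ⊤ := by
    rw [LinearMap.range_eq_top]
    intro v
    choose P hP using hone
    refine ⟨∑ s, v s • P s, ?_⟩
    rw [map_sum]
    conv_rhs => rw [pi_eq_sum_univ' v]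
    exact Finset.sum_congr rfl fun s _ => by rw [map_smul, hP]
  have hdim : Module.finrank k (Matrix (Fin 3) (Fin 4) ↥(⋀[k]^3 (Fin 5 → k))) = 120 := by
    rw [Module.finrank_matrix, exteriorPower.finrank_eq]
    simp [Nat.choose]
  have hker : Module.finrank k (LinearMap.ker L) = 120 - r := by
    have h1 := LinearMap.finrank_range_add_finrank_ker L
    rw [hsurj, finrank_top, hdim, Module.finrank_fintype_fun_eq_card, hcardI] at h1
    omega
  let J : Matrix (Fin 3) (Fin 4) ↥(⋀[k]^3 (Fin 5 → k)) →ₗ[k]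
      Matrix (Fin 3) (Fin 4) (ExteriorAlgebra k (Fin 5 → k)) :=
    (⋀[k]^3 (Fin 5 → k)).subtype.mapMatrix
  have hrange : LinearMap.range Φ ≤ (LinearMap.ker L).map J := by
    rintro _ ⟨⟨A₂, B₂⟩, rfl⟩
    have hmem : ∀ i j, Φ (A₂, B₂) i j ∈ ⋀[k]^3 (Fin 5 → k) := by
      intro i j
      rw [hΦ]
      refine Submodule.add_mem _ (Submodule.sum_mem _ fun m _ => ?_)
        (Submodule.sum_mem _ fun n _ => ?_)
      · rw [exteriorPower, pow_succ']
        exact Submodule.mul_mem_mul ⟨_, rfl⟩ (A₂ m j).2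
      · rw [exteriorPower, pow_succ]
        exact Submodule.mul_mem_mul (B₂ i n).2 ⟨_, rfl⟩
    refine ⟨Matrix.of fun i j => ⟨Φ (A₂, B₂) i j, hmem i j⟩, ?_, ?_⟩
    · rw [SetLike.mem_coe, LinearMap.mem_ker]
      ext t
      rw [hL]
      simp only [Matrix.of_apply, hΦ]
      rw [wedge_vanish A₁ B₁ (b t) (c t) (hbc t)]
      simp
    · ext i j
      rfl
  calc Module.finrank k (LinearMap.range Φ) ≤ Module.finrank k ((LinearMap.ker L).map J) :=
        Submodule.finrank_mono hrange
    _ ≤ Module.finrank k (LinearMap.ker L) := Submodule.finrank_map_le J _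
    _ = 120 - r := hker
end

section
/- Assume the generality assumption. If the intersection Γ = Z_A ∩ Z_B is finite, then Γ consists of at most 6 distinct points. -/
/-!
Common setup (k algebraically closed, `V = k⁵`, matrices `A₁` (2×4) and `B₁` (3×2) with
entries in `V`):

* A dual vector is represented by `φ : Fin 5 → k`, acting on `v : V` by `Σ l, φ l * v l`;
  `rankOneLocus A` is the (affine cone, minus 0, over the) locus in `P(V*)` where the
  matrix `A` has rank 1.
* `C_A` is a smooth rational normal quartic curve iff its cone is the image of the cone over
  the standard quartic `(s:t) ↦ (s⁴, s³t, s²t², st³, t⁴)` under a linear automorphism;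
  similarly `S_B` is a (smooth) rational cubic surface scroll iff its cone is the image of
  the cone over the standard scroll `S(1,2)`, `(a,b;s:t) ↦ (as, at, bs², bst, bt²)`.
  (Over an algebraically closed field the parametrized sets are the full affine cones.)
* `V_A` is the span of the 4 columns of `A₁` in `V ⊕ V`, `V_B` the span of the 3 rows of
  `B₁`; the double (Veronese) embeddings into `P(⋀²V)` have as affine cones the sets
  `coneZ V_A`, `coneZ V_B` of wedges `v₁ ∧ v₂` with `(v₁,v₂)` in `V_A` resp. `V_B`
  (computed in the exterior algebra).  `gammaSet` is the set `Z_A ∩ Z_B` of common points,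
  a subset of the projectivization of the exterior algebra.
-/

open ExteriorAlgebra

namespace St6

/-- Rank one for a matrix with two rows. -/
lemma rank_one_iff {k : Type*} [Field k] {n : ℕ} (M : Matrix (Fin 2) (Fin n) k) :
    M.rank = 1 ↔ (∃ a b : k, ¬ (a = 0 ∧ b = 0) ∧ ∀ j, a * M 0 j + b * M 1 j = 0) ∧
      ∃ j, M 0 j ≠ 0 ∨ M 1 j ≠ 0 := by
  constructor
  · intro h
    constructor
    · have hLI : ¬ LinearIndependent k M.row := by
        intro hl
        have := hl.rank_matrix
        simp [h] at this
      rw [Fintype.not_linearIndependent_iff] at hLI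
      obtain ⟨g, hg, i, hi⟩ := hLI
      refine ⟨g 0, g 1, ?_, ?_⟩
      · rintro ⟨h0, h1⟩
        fin_cases i
        · exact hi h0
        · exact hi h1
      · intro j
        have := congrFun hg j
        simpa [Fin.sum_univ_two] using this
    · by_contra hne
      push Not at hne
      have : M = 0 := by
        ext i j
        fin_cases i
        · exact (hne j).1
        · exact (hne j).2
      rw [this, Matrix.rank_zero] at h
      omega
  · rintro ⟨⟨a, b, hab, h⟩, j, hj⟩
    have hle : M.rank ≤ 1 := by
      by_cases ha : a = 0
      · have hb : b ≠ 0 := fun hb => hab ⟨ha, hb⟩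
        have : M = Matrix.vecMulVec ![1, 0] (M 0) := by
          ext i l
          fin_cases i
          · simp [Matrix.vecMulVec]
          · have := h l
            simp [ha, hb] at this
            simp [Matrix.vecMulVec, this]
        rw [this]
        exact Matrix.rank_vecMulVec_le _ _
      · have : M = Matrix.vecMulVec ![-(b/a), 1] (M 1) := by
          ext i l
          fin_cases i
          · have := h l
            simp [Matrix.vecMulVec]
            field_simp
            linear_combination this
          · simp [Matrix.vecMulVec]
        rw [this]
        exact Matrix.rank_vecMulVec_le _ _
    have hge : M.rank ≠ 0 := by
      intro h0
      rw [Matrix.rank, Submodule.finrank_eq_zero, LinearMap.range_eq_bot] at h0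
      have h1 := congrFun (LinearMap.congr_fun h0 (Pi.single j 1))
      have h2 := h1 0
      have h3 := h1 1
      simp at h2 h3
      rcases hj with hj | hj
      · exact hj h2
      · exact hj h3
    omega

abbrev V5 (k : Type*) := Fin 5 → k

/-- The functional given by a vector. -/
abbrev ev {k : Type*} [Field k] : (Fin 5 → k) ≃ₗ[k] Module.Dual k (Fin 5 → k) :=
  dotProductEquiv k (Fin 5)

lemma ev_apply {k : Type*} [Field k] (φ v : Fin 5 → k) : ev φ v = ∑ l, φ l * v l := rfl

/-- Rank one locus in terms of the subspace of `V ⊕ V`. -/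
def loc {k : Type*} [Field k] (W : Submodule k ((Fin 5 → k) × (Fin 5 → k))) :
    Set (Fin 5 → k) :=
  {φ | (∃ a b : k, ¬ (a = 0 ∧ b = 0) ∧ ∀ p ∈ W, a * ev φ p.1 + b * ev φ p.2 = 0) ∧
    ∃ p ∈ W, ev φ p.1 ≠ 0 ∨ ev φ p.2 ≠ 0}

lemma loc_aux {k : Type*} [Field k] {n : ℕ} (f : Fin n → (Fin 5 → k) × (Fin 5 → k))
    (φ : Fin 5 → k) :
    ((∃ a b : k, ¬ (a = 0 ∧ b = 0) ∧ ∀ j, a * ev φ (f j).1 + b * ev φ (f j).2 = 0) ∧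
      ∃ j, ev φ (f j).1 ≠ 0 ∨ ev φ (f j).2 ≠ 0) ↔
    φ ∈ loc (Submodule.span k (Set.range f)) := by
  constructor
  · rintro ⟨⟨a, b, hab, h⟩, j, hj⟩
    refine ⟨⟨a, b, hab, ?_⟩, f j, Submodule.subset_span ⟨j, rfl⟩, hj⟩
    intro p hp
    induction hp using Submodule.span_induction with
    | mem x hx => obtain ⟨i, rfl⟩ := hx; exact h i
    | zero => simp
    | add x y _ _ hx hy =>
      simp only [Prod.fst_add, Prod.snd_add, map_add]
      linear_combination hx + hy
    | smul c x _ hx =>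
      simp only [Prod.smul_fst, Prod.smul_snd, map_smul, smul_eq_mul]
      linear_combination c * hx
  · rintro ⟨⟨a, b, hab, h⟩, p, hp, hp2⟩
    refine ⟨⟨a, b, hab, fun j => h _ (Submodule.subset_span ⟨j, rfl⟩)⟩, ?_⟩
    by_contra hne
    push Not at hne
    have : ev φ p.1 = 0 ∧ ev φ p.2 = 0 := by
      clear hp2
      induction hp using Submodule.span_induction with
      | mem x hx => obtain ⟨i, rfl⟩ := hx; exact hne i
      | zero => simp
      | add x y _ _ hx hy => simp only [Prod.fst_add, Prod.snd_add, map_add, hx, hy]; simp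
      | smul c x _ hx => simp only [Prod.smul_fst, Prod.smul_snd, map_smul, hx]; simp
    tauto

lemma locA {k : Type*} [Field k] (A : Matrix (Fin 2) (Fin 4) (Fin 5 → k)) :
    rankOneLocus A = loc (colSpace A) := by
  ext φ
  rw [colSpace, ← loc_aux, rankOneLocus, Set.mem_ofPred_eq, rank_one_iff]
  rfl

lemma locB {k : Type*} [Field k] (B : Matrix (Fin 3) (Fin 2) (Fin 5 → k)) :
    rankOneLocus B = loc (rowSpace B) := by
  ext φ
  rw [rowSpace, ← loc_aux, rankOneLocus, Set.mem_ofPred_eq, ← Matrix.rank_transpose, rank_one_iff]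
  rfl

/-- 1-genericity. -/
def Gen {k : Type*} [Field k] (W : Submodule k ((Fin 5 → k) × (Fin 5 → k))) : Prop :=
  ∀ p ∈ W, ∀ a b : k, ¬ (a = 0 ∧ b = 0) → a • p.1 + b • p.2 = 0 → p = 0

/-- The entries span. -/
def Spn {k : Type*} [Field k] (W : Submodule k ((Fin 5 → k) × (Fin 5 → k))) : Prop :=
  ∀ φ : Fin 5 → k, (∀ p ∈ W, ev φ p.1 = 0 ∧ ev φ p.2 = 0) → φ = 0

lemma gen_of {k : Type*} [Field k] (W : Submodule k ((Fin 5 → k) × (Fin 5 → k)))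
    (hS : Spn W)
    (h : ∀ M : Submodule k (Fin 5 → k), 6 ≤ Module.finrank k M + Module.finrank k W →
      ∃ φ ∈ M, φ ∉ loc W ∪ {0}) : Gen W := by
  intro p hp a b hab hz
  by_contra hp0
  let f : ((Fin 5 → k) × (Fin 5 → k)) →ₗ[k] (Fin 5 → k) :=
    a • LinearMap.fst k _ _ + b • LinearMap.snd k _ _
  let R := LinearMap.range (f.comp W.subtype)
  have hker : 1 ≤ Module.finrank k (LinearMap.ker (f.comp W.subtype)) := by
    rw [Submodule.one_le_finrank_iff]
    intro hb
    have : (⟨p, hp⟩ : W) ∈ LinearMap.ker (f.comp W.subtype) := by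
      simpa [f] using hz
    rw [hb] at this
    simp at this
    exact hp0 (by simpa using this)
  have h1 := (f.comp W.subtype).finrank_range_add_finrank_ker
  have h2 := Subspace.finrank_add_finrank_dualAnnihilator_eq R
  let M : Submodule k (Fin 5 → k) := R.dualAnnihilator.comap (ev (k := k)).toLinearMap
  have h3 : Module.finrank k M = Module.finrank k R.dualAnnihilator := by
    have : M = R.dualAnnihilator.map (ev (k := k)).symm.toLinearMap := by
      exact (Submodule.map_equiv_eq_comap_symm (ev (k := k)).symm _).symm
    rw [this]
    exact LinearEquiv.finrank_map_eq _ _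
  have h4 : Module.finrank k (Fin 5 → k) = 5 := by simp
  obtain ⟨φ, hφM, hφ⟩ := h M (by simp only [R] at *; omega)
  apply hφ
  by_cases hφ0 : φ = 0
  · exact Or.inr hφ0
  · left
    refine ⟨⟨a, b, hab, ?_⟩, ?_⟩
    · intro q hq
      have h5 : ev φ ∈ R.dualAnnihilator := hφM
      rw [Submodule.mem_dualAnnihilator] at h5
      have := h5 (f q) ⟨⟨q, hq⟩, rfl⟩
      simpa only [f, LinearMap.add_apply, LinearMap.smul_apply, LinearMap.fst_apply,
        LinearMap.snd_apply, map_add, map_smul, smul_eq_mul] using this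
    · by_contra hne
      push Not at hne
      exact hφ0 (hS φ hne)


lemma lin_zero {k : Type*} [Field k] [Infinite k] (x y : k) (h : ∀ c : k, c * x + c ^ 2 * y = 0) :
    x = 0 := by
  classical
  obtain ⟨c, hc⟩ := Infinite.exists_notMem_finset ({0, 1} : Finset k)
  simp only [Finset.mem_insert, Finset.mem_singleton, not_or] at hc
  have h1 := h 1
  have h2 := h c
  have h3 : (c * (c - 1)) * x = 0 := by linear_combination c ^ 2 * h1 - h2
  rcases mul_eq_zero.1 h3 with h4 | h4
  · rcases mul_eq_zero.1 h4 with h5 | h5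
    · exact absurd h5 hc.1
    · exact absurd (sub_eq_zero.1 h5) hc.2
  · exact h4

lemma transl {k : Type*} [Field k] {W : Submodule k ((Fin 5 → k) × (Fin 5 → k))}
    {C : Set (Fin 5 → k)} {g : (Fin 5 → k) ≃ₗ[k] (Fin 5 → k)} (h : loc W ∪ {0} = g '' C)
    {φ₀ : Fin 5 → k} (hφ : ∀ p ∈ W, ev φ₀ p.1 = 0 ∧ ev φ₀ p.2 = 0)
    {e : Fin 5 → k} (he : e ∈ C) (he0 : e ≠ 0) (c : k) : e + c • g.symm φ₀ ∈ C := by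
  have h1 : g e ∈ loc W ∪ {0} := by rw [h]; exact ⟨e, he, rfl⟩
  have h2 : g e ∈ loc W := by
    rcases h1 with h1 | h1
    · exact h1
    · exact absurd (by simpa using h1) he0
  have h3 : g e + c • φ₀ ∈ loc W := by
    obtain ⟨⟨a, b, hab, h4⟩, p, hp, h5⟩ := h2
    refine ⟨⟨a, b, hab, fun q hq => ?_⟩, p, hp, ?_⟩
    · have := h4 q hq
      simp only [map_add, map_smul, LinearMap.add_apply, LinearMap.smul_apply, (hφ q hq).1,
        (hφ q hq).2, smul_zero, add_zero]
      exact this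
    · simp only [map_add, map_smul, LinearMap.add_apply, LinearMap.smul_apply, (hφ p hp).1,
        (hφ p hp).2, smul_zero, add_zero]
      exact h5
  have h4 : g e + c • φ₀ ∈ g '' C := by rw [← h]; exact Or.inl h3
  obtain ⟨y, hy, hy2⟩ := h4
  have : e + c • g.symm φ₀ = y := by
    apply g.injective
    rw [hy2]
    simp
  rw [this]
  exact hy

lemma quartic_eqs {k : Type*} [Field k] {w : Fin 5 → k} (h : w ∈ coneQuartic k) :
    w 0 * w 2 = w 1 ^ 2 ∧ w 0 * w 3 = w 1 * w 2 ∧ w 0 * w 4 = w 2 ^ 2 ∧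
      w 1 * w 4 = w 2 * w 3 := by
  obtain ⟨s, t, rfl⟩ := h
  refine ⟨?_, ?_, ?_, ?_⟩ <;> simp <;> ring

lemma scroll_eqs {k : Type*} [Field k] {w : Fin 5 → k} (h : w ∈ coneScroll k) :
    w 0 * w 3 = w 1 * w 2 ∧ w 0 * w 4 = w 1 * w 3 ∧ w 2 * w 4 = w 3 ^ 2 := by
  obtain ⟨a, b, s, t, rfl⟩ := h
  refine ⟨?_, ?_, ?_⟩ <;> simp <;> ring

lemma spnA {k : Type*} [Field k] [Infinite k] {W : Submodule k ((Fin 5 → k) × (Fin 5 → k))}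
    {g : (Fin 5 → k) ≃ₗ[k] (Fin 5 → k)} (h : loc W ∪ {0} = g '' coneQuartic k) : Spn W := by
  intro φ hφ
  have e0 : (![1, 0, 0, 0, 0] : Fin 5 → k) ∈ coneQuartic k := ⟨1, 0, by simp⟩
  have e4 : (![0, 0, 0, 0, 1] : Fin 5 → k) ∈ coneQuartic k := ⟨0, 1, by simp⟩
  have t0 := fun c => quartic_eqs (transl h hφ e0 (fun h => by simpa using congrFun h 0) c)
  have t4 := fun c => quartic_eqs (transl h hφ e4 (fun h => by simpa using congrFun h 4) c)
  generalize hz : g.symm φ = z at t0 t4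
  simp at t0 t4
  have z2 : z 2 = 0 := lin_zero _ (z 0 * z 2 - z 1 ^ 2) fun c => by
    linear_combination (t0 c).1
  have z3 : z 3 = 0 := lin_zero _ (z 0 * z 3 - z 1 * z 2) fun c => by
    linear_combination (t0 c).2.1
  have z4 : z 4 = 0 := lin_zero _ (z 0 * z 4 - z 2 ^ 2) fun c => by
    linear_combination (t0 c).2.2.1
  have z0 : z 0 = 0 := lin_zero _ (z 0 * z 4 - z 2 ^ 2) fun c => by
    linear_combination (t4 c).2.2.1
  have z1 : z 1 = 0 := lin_zero _ (z 1 * z 4 - z 2 * z 3) fun c => by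
    linear_combination (t4 c).2.2.2
  have : z = 0 := by
    ext i; fin_cases i <;> assumption
  rw [this] at hz
  simpa using hz

lemma spnB {k : Type*} [Field k] [Infinite k] {W : Submodule k ((Fin 5 → k) × (Fin 5 → k))}
    {g : (Fin 5 → k) ≃ₗ[k] (Fin 5 → k)} (h : loc W ∪ {0} = g '' coneScroll k) : Spn W := by
  intro φ hφ
  have e0 : (![1, 0, 0, 0, 0] : Fin 5 → k) ∈ coneScroll k := ⟨1, 0, 1, 0, by simp⟩
  have e1 : (![0, 1, 0, 0, 0] : Fin 5 → k) ∈ coneScroll k := ⟨1, 0, 0, 1, by simp⟩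
  have e2 : (![0, 0, 1, 0, 0] : Fin 5 → k) ∈ coneScroll k := ⟨0, 1, 1, 0, by simp⟩
  have e4 : (![0, 0, 0, 0, 1] : Fin 5 → k) ∈ coneScroll k := ⟨0, 1, 0, 1, by simp⟩
  have t0 := fun c => scroll_eqs (transl h hφ e0 (fun h => by simpa using congrFun h 0) c)
  have t1 := fun c => scroll_eqs (transl h hφ e1 (fun h => by simpa using congrFun h 1) c)
  have t2 := fun c => scroll_eqs (transl h hφ e2 (fun h => by simpa using congrFun h 2) c)
  have t4 := fun c => scroll_eqs (transl h hφ e4 (fun h => by simpa using congrFun h 4) c)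
  generalize hz : g.symm φ = z at t0 t1 t2 t4
  simp at t0 t1 t2 t4
  have z3 : z 3 = 0 := lin_zero _ (z 0 * z 3 - z 1 * z 2) fun c => by
    linear_combination (t0 c).1
  have z4 : z 4 = 0 := lin_zero _ (z 0 * z 4 - z 1 * z 3) fun c => by
    linear_combination (t0 c).2.1
  have z2 : z 2 = 0 := lin_zero _ (z 1 * z 2 - z 0 * z 3) fun c => by
    linear_combination -(t1 c).1
  have z1 : z 1 = 0 := lin_zero _ (z 1 * z 2 - z 0 * z 3) fun c => by
    linear_combination -(t2 c).1
  have z0 : z 0 = 0 := lin_zero _ (z 0 * z 4 - z 1 * z 3) fun c => by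
    linear_combination (t4 c).2.1
  have : z = 0 := by
    ext i; fin_cases i <;> assumption
  rw [this] at hz
  simpa using hz

/-- A subspace of dimension `> n` has a nonzero element killed by `n` functionals. -/
lemma exists_kill {k U : Type*} [Field k] [AddCommGroup U] [Module k U] [FiniteDimensional k U]
    {ι : Type*} [Fintype ι] (f : ι → U →ₗ[k] k) (h : Fintype.card ι < Module.finrank k U) :
    ∃ u : U, u ≠ 0 ∧ ∀ i, f i u = 0 := by
  have : LinearMap.ker (LinearMap.pi f) ≠ ⊥ :=
    LinearMap.ker_ne_bot_of_finrank_lt (by simpa using h)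
  obtain ⟨u, hu, hu0⟩ := Submodule.exists_mem_ne_zero_of_ne_bot this
  exact ⟨u, hu0, fun i => congrFun (LinearMap.mem_ker.1 hu) i⟩

lemma exists_kill' {k U : Type*} [Field k] [AddCommGroup U] [Module k U]
    {ι : Type*} [Fintype ι] (W : Submodule k U) [FiniteDimensional k W] (f : ι → U →ₗ[k] k)
    (h : Fintype.card ι < Module.finrank k W) :
    ∃ u ∈ W, u ≠ 0 ∧ ∀ i, f i u = 0 := by
  obtain ⟨u, hu, h2⟩ := exists_kill (fun i => (f i).comp W.subtype) h
  exact ⟨u, u.2, by simpa using hu, h2⟩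

lemma no_sub_quartic {k : Type*} [Field k] (M : Submodule k (Fin 5 → k))
    (hM : 2 ≤ Module.finrank k M) (h : ∀ w ∈ M, w ∈ coneQuartic k) : False := by
  obtain ⟨w, hw, hw0, hw1⟩ := exists_kill' M ![(LinearMap.proj 0 : (Fin 5 → k) →ₗ[k] k)] (by simp; omega)
  obtain ⟨z, hz, hz0, hz1⟩ := exists_kill' M ![(LinearMap.proj 4 : (Fin 5 → k) →ₗ[k] k)] (by simp; omega)
  replace hw1 : w 0 = 0 := hw1 0
  replace hz1 : z 4 = 0 := hz1 0
  have hsum := quartic_eqs (h _ (M.add_mem hw hz))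
  obtain ⟨s, t, rfl⟩ := h w hw
  obtain ⟨s', t', rfl⟩ := h z hz
  simp at hw1 hz1
  subst hw1 hz1
  simp at hsum hw0 hz0
  rcases hsum with h1 | h1
  · exact hz0 h1
  · exact hw0 h1

lemma no_sub_scroll {k : Type*} [Field k] (M : Submodule k (Fin 5 → k))
    (hM : 3 ≤ Module.finrank k M) (h : ∀ w ∈ M, w ∈ coneScroll k) : False := by
  obtain ⟨w, hw, hw0, hw1⟩ := exists_kill' M
    ![(LinearMap.proj 0 : (Fin 5 → k) →ₗ[k] k), LinearMap.proj 2] (by simp; omega)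
  have w0 : w 0 = 0 := hw1 0
  have w2 : w 2 = 0 := hw1 1
  have w3 : w 3 = 0 := by
    have := (scroll_eqs (h w hw)).2.2
    rw [w2] at this
    simpa using this.symm
  have key : ∀ z ∈ M, z 2 = 0 ∧ z 3 = 0 := by
    intro z hz
    have h1 := scroll_eqs (h z hz)
    have h2 := scroll_eqs (h _ (M.add_mem hw hz))
    simp only [Pi.add_apply, w0, w2, w3, zero_add] at h2
    have z2 : z 2 = 0 := by
      by_contra hz2
      have a1 : w 1 = 0 := by
        have : w 1 * z 2 = 0 := by linear_combination h1.1 - h2.1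
        exact (mul_eq_zero.1 this).resolve_right hz2
      have a4 : w 4 = 0 := by
        have : w 4 * z 2 = 0 := by linear_combination h2.2.2 - h1.2.2
        exact (mul_eq_zero.1 this).resolve_right hz2
      apply hw0
      ext i; fin_cases i <;> assumption
    refine ⟨z2, ?_⟩
    have := h1.2.2
    rw [z2] at this
    simpa using this.symm
  obtain ⟨z, hz, hz0, hz1⟩ := exists_kill' M
    ![(LinearMap.proj 0 : (Fin 5 → k) →ₗ[k] k) - (LinearMap.proj 4 : (Fin 5 → k) →ₗ[k] k),
      LinearMap.proj 1] (by simp; omega)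
  have z1 : z 1 = 0 := hz1 1
  have z04 : z 0 - z 4 = 0 := hz1 0
  have h1 := (scroll_eqs (h z hz)).2.1
  have z4 : z 4 = 0 := by
    have : z 4 ^ 2 = 0 := by linear_combination h1 + z1 * z 3 - z 4 * z04
    simpa using this
  have z0 : z 0 = 0 := by linear_combination z04 + z4
  have z2 := (key z hz).1
  have z3 := (key z hz).2
  apply hz0
  ext i; fin_cases i <;> assumption

lemma gen_cone {k : Type*} [Field k] {W : Submodule k ((Fin 5 → k) × (Fin 5 → k))}
    {C : Set (Fin 5 → k)} {g : (Fin 5 → k) ≃ₗ[k] (Fin 5 → k)} (h : loc W ∪ {0} = g '' C)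
    (hS : Spn W)
    (hC : ∀ M : Submodule k (Fin 5 → k), 6 ≤ Module.finrank k M + Module.finrank k W →
      (∀ w ∈ M, w ∈ C) → False) : Gen W := by
  apply gen_of W hS
  intro M hM
  by_contra hne
  push Not at hne
  apply hC (M.map g.symm.toLinearMap)
  · rw [LinearEquiv.finrank_map_eq]
    exact hM
  · rintro w ⟨φ, hφ, rfl⟩
    have := hne φ hφ
    rw [h] at this
    obtain ⟨c, hc, rfl⟩ := this
    simpa using hc


lemma exists_theta {k : Type*} [Field k] (φ ψ : Module.Dual k (Fin 5 → k)) :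
    ∃ θ : ExteriorAlgebra k (Fin 5 → k) →ₗ[k] k,
      ∀ v w, θ (ι k v * ι k w) = φ v * ψ w - φ w * ψ v := by
  refine ⟨(ExteriorAlgebra.algebraMapInv).toLinearMap ∘ₗ
    (CliffordAlgebra.contractLeft ψ) ∘ₗ (CliffordAlgebra.contractLeft φ), fun v w => ?_⟩
  have h1 : CliffordAlgebra.contractLeft φ (ι k v * ι k w) =
      φ v • ι k w - φ w • ι k v := by
    rw [ExteriorAlgebra.ι, CliffordAlgebra.contractLeft_ι_mul, CliffordAlgebra.contractLeft_ι,
      ← Algebra.commutes, Algebra.smul_def (φ w)]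
  rw [LinearMap.comp_apply, LinearMap.comp_apply, h1, map_sub, map_smul, map_smul]
  rw [ExteriorAlgebra.ι, CliffordAlgebra.contractLeft_ι, CliffordAlgebra.contractLeft_ι]
  rw [map_sub, map_smul, map_smul]
  have h2 : ∀ c : k, (ExteriorAlgebra.algebraMapInv (R := k) (M := Fin 5 → k)).toLinearMap
      (algebraMap k (CliffordAlgebra (0 : QuadraticForm k (Fin 5 → k))) c) = c :=
    fun c => ExteriorAlgebra.algebraMap_leftInverse (Fin 5 → k) c
  rw [h2, h2]
  simp

/-- The wedge of a pair. -/
noncomputable def om {k : Type*} [Field k] (p : (Fin 5 → k) × (Fin 5 → k)) :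
    ExteriorAlgebra k (Fin 5 → k) := ι k p.1 * ι k p.2

def Star {k : Type*} [Field k] (W : Submodule k ((Fin 5 → k) × (Fin 5 → k))) : Prop :=
  ∀ l l' : W →ₗ[k] k, ∃ θ : ExteriorAlgebra k (Fin 5 → k) →ₗ[k] k,
    ∀ p : W, θ (om p.1) = l p * l' p

lemma loc_factor {k : Type*} [Field k] {W : Submodule k ((Fin 5 → k) × (Fin 5 → k))}
    {φ : Fin 5 → k} (h : φ ∈ loc W) :
    ∃ (u v : k) (x : W →ₗ[k] k), ¬ (u = 0 ∧ v = 0) ∧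
      ∀ p : W, ev φ p.1.1 = x p * u ∧ ev φ p.1.2 = x p * v := by
  obtain ⟨⟨a, b, hab, h⟩, -⟩ := h
  by_cases ha : a = 0
  · have hb : b ≠ 0 := fun hb => hab ⟨ha, hb⟩
    refine ⟨b, 0, b⁻¹ • ((ev φ).comp ((LinearMap.fst k _ _).comp W.subtype)),
      by simp [hb], fun p => ?_⟩
    have := h p p.2
    rw [ha, zero_mul, zero_add] at this
    have h2 : ev φ p.1.2 = 0 := (mul_eq_zero.1 this).resolve_left hb
    rw [h2]
    refine ⟨?_, by simp⟩
    change _ = (b⁻¹ * ev φ p.1.1) * b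
    field_simp
  · refine ⟨b, -a, (-a⁻¹) • ((ev φ).comp ((LinearMap.snd k _ _).comp W.subtype)),
      by simp [ha], fun p => ?_⟩
    have := h p p.2
    change _ = (-a⁻¹ * ev φ p.1.2) * b ∧ _ = (-a⁻¹ * ev φ p.1.2) * -a
    constructor
    · field_simp
      linear_combination this
    · field_simp

lemma exists_five {k : Type*} [Field k] [Infinite k]
    {W : Submodule k ((Fin 5 → k) × (Fin 5 → k))}
    {g : (Fin 5 → k) ≃ₗ[k] (Fin 5 → k)} (h : loc W ∪ {0} = g '' coneQuartic k) :
    ∃ φ : Fin 5 → (Fin 5 → k), (∀ i, φ i ∈ loc W) ∧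
      ∀ v, (∀ i, ev (φ i) v = 0) → v = 0 := by
  let t : Fin 5 → k := fun i => Infinite.natEmbedding k i
  have ht : Function.Injective t := by
    intro i j hij
    exact Fin.ext ((Infinite.natEmbedding k).injective hij)
  have hdet := Matrix.det_vandermonde_ne_zero_iff.2 ht
  have hLI : LinearIndependent k (fun i => Matrix.vandermonde t i) :=
    Matrix.linearIndependent_rows_of_det_ne_zero hdet
  have hLI2 : LinearIndependent k (fun i => g (Matrix.vandermonde t i)) :=
    hLI.map' g.toLinearMap g.ker
  refine ⟨fun i => g (Matrix.vandermonde t i), fun i => ?_, fun v hv => ?_⟩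
  · have h1 : g (Matrix.vandermonde t i) ∈ loc W ∪ {0} := by
      rw [h]
      refine ⟨_, ⟨1, t i, ?_⟩, rfl⟩
      ext j
      fin_cases j <;> simp [Matrix.vandermonde]
    rcases h1 with h1 | h1
    · exact h1
    · exact absurd h1 (hLI2.ne_zero i)
  · have htop := hLI2.span_eq_top_of_card_eq_finrank (by simp)
    have hall : ∀ ψ : Fin 5 → k, ev ψ v = 0 := by
      intro ψ
      have : ψ ∈ Submodule.span k (Set.range fun i => g (Matrix.vandermonde t i)) := by
        rw [htop]; trivial
      induction this using Submodule.span_induction with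
      | mem x hx => obtain ⟨i, rfl⟩ := hx; exact hv i
      | zero => simp
      | add x y _ _ hx hy => simp only [map_add, LinearMap.add_apply, hx, hy, add_zero]
      | smul c x _ hx => simp only [map_smul, LinearMap.smul_apply, hx, smul_zero]
    ext i
    have := hall (Pi.single i 1)
    simpa [ev_apply, Pi.single_apply] using this

lemma star_of {k : Type*} [Field k] {W : Submodule k ((Fin 5 → k) × (Fin 5 → k))}
    (hW : Module.finrank k W = 4) (hG : Gen W) (φ : Fin 5 → (Fin 5 → k))
    (hφ : ∀ i, φ i ∈ loc W) (hK : ∀ v, (∀ i, ev (φ i) v = 0) → v = 0) : Star W := by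
  choose u v x huv hx using fun i => loc_factor (hφ i)
  have hδ : ∀ i j, i ≠ j → u i * v j - u j * v i ≠ 0 := by
    intro i j hij h0
    obtain ⟨p, hp0, hp⟩ := exists_kill (fun l : {l : Fin 5 // l ≠ i ∧ l ≠ j} => x l) (by
      rw [hW]
      have : Fintype.card {l : Fin 5 // l ≠ i ∧ l ≠ j} = 3 := by
        clear h0; revert i j; decide
      omega)
    apply hp0
    apply Subtype.ext
    apply hG p.1 p.2 (v i) (-(u i))
    · rintro ⟨h1, h2⟩
      exact huv i ⟨by simpa using h2, h1⟩
    · apply hK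
      intro l
      rw [map_add, map_smul, map_smul, (hx l p).1, (hx l p).2, smul_eq_mul, smul_eq_mul]
      by_cases hl : l = i
      · subst hl; ring
      by_cases hl2 : l = j
      · subst hl2; linear_combination - (x l p) * h0
      · have := hp ⟨l, hl, hl2⟩
        simp only at this
        rw [this]; ring
  have hker : ∀ i (p : W), (∀ j, j ≠ i → x j p = 0) → p = 0 := by
    intro i p hp
    have h1 : ev (φ i) p.1.2 • p.1.1 + (- ev (φ i) p.1.1) • p.1.2 = 0 := by
      apply hK
      intro l
      rw [map_add, map_smul, map_smul, smul_eq_mul, smul_eq_mul]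
      by_cases hl : l = i
      · subst hl; ring
      · rw [(hx l p).1, (hx l p).2, hp l hl]; ring
    by_cases h2 : ev (φ i) p.1.2 = 0 ∧ - ev (φ i) p.1.1 = 0
    · have h3 : p.1.1 = 0 := by
        apply hK
        intro l
        by_cases hl : l = i
        · subst hl; simpa using h2.2
        · rw [(hx l p).1, hp l hl]; ring
      have h4 : p.1.2 = 0 := by
        apply hK
        intro l
        by_cases hl : l = i
        · subst hl; exact h2.1
        · rw [(hx l p).2, hp l hl]; ring
      apply Subtype.ext
      exact Prod.ext h3 h4
    · exact Subtype.ext (hG p.1 p.2 _ _ h2 h1)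
  have hspan : ∀ i (l : W →ₗ[k] k),
      l ∈ Submodule.span k (Set.range fun j : {j : Fin 5 // j ≠ i} => x j) := by
    intro i l
    apply mem_span_of_iInf_ker_le_ker
    intro p hp
    have : p = 0 := by
      apply hker i p
      intro j hj
      simp only [Submodule.mem_iInf, LinearMap.mem_ker] at hp
      exact hp ⟨j, hj⟩
    rw [this]; simp
  have h1 : ∀ i (l : W →ₗ[k] k), ∃ θ : ExteriorAlgebra k (Fin 5 → k) →ₗ[k] k,
      ∀ p : W, θ (om p.1) = x i p * l p := by
    intro i l
    induction hspan i l using Submodule.span_induction with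
    | mem y hy =>
      obtain ⟨⟨j, hj⟩, rfl⟩ := hy
      obtain ⟨θ, hθ⟩ := exists_theta (ev (φ i)) (ev (φ j))
      refine ⟨(u i * v j - u j * v i)⁻¹ • θ, fun p => ?_⟩
      have hne := hδ i j hj.symm
      rw [LinearMap.smul_apply, om, hθ, (hx i p).1, (hx i p).2, (hx j p).1, (hx j p).2,
        smul_eq_mul]
      field_simp
    | zero => exact ⟨0, by simp⟩
    | add y z _ _ hy hz =>
      obtain ⟨θ, hθ⟩ := hy
      obtain ⟨θ', hθ'⟩ := hz
      exact ⟨θ + θ', fun p => by simp [hθ, hθ', mul_add]⟩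
    | smul c y _ hy =>
      obtain ⟨θ, hθ⟩ := hy
      exact ⟨c • θ, fun p => by simp [hθ]; ring⟩
  intro l l'
  induction hspan 0 l using Submodule.span_induction with
  | mem y hy =>
    obtain ⟨⟨j, hj⟩, rfl⟩ := hy
    exact h1 j l'
  | zero => exact ⟨0, by simp⟩
  | add y z _ _ hy hz =>
    obtain ⟨θ, hθ⟩ := hy
    obtain ⟨θ', hθ'⟩ := hz
    exact ⟨θ + θ', fun p => by simp [hθ, hθ', add_mul]⟩
  | smul c y _ hy =>
    obtain ⟨θ, hθ⟩ := hy
    exact ⟨c • θ, fun p => by simp [hθ]; ring⟩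


/-- Two vectors are independent. -/
def I2 {k U : Type*} [Field k] [AddCommGroup U] [Module k U] (p q : U) : Prop :=
  ∀ a b : k, a • p + b • q = 0 → a = 0 ∧ b = 0

/-- There is an infinite family of pairwise independent vectors with square in `L`. -/
def InfFam {k U E : Type*} [Field k] [AddCommGroup U] [Module k U] [AddCommGroup E] [Module k E]
    (b : U →ₗ[k] U →ₗ[k] E) (L : Submodule k E) : Prop :=
  ∃ (I : Set k) (f : k → U), I.Infinite ∧ (∀ t ∈ I, b (f t) (f t) ∈ L) ∧
    ∀ t ∈ I, ∀ s ∈ I, t ≠ s → I2 (k := k) (f t) (f s)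

section cast
variable {k U E : Type*} [Field k] [AddCommGroup U] [Module k U] [AddCommGroup E]
  [Module k E] (b : U →ₗ[k] U →ₗ[k] E) (L : Submodule k E)

lemma collinear [Infinite k] {p q r : U} (hpq : I2 (k := k) p q) (hpr : I2 (k := k) p r)
    (hqr : I2 (k := k) q r) (hp : b p p ∈ L) (hq : b q q ∈ L) (hr : b r r ∈ L)
    {x y : k} (h : r = x • p + y • q) : InfFam b L := by
  have hx : x ≠ 0 := by
    rintro rfl
    have := (hqr y (-1) (by rw [h]; module)).2
    simp at this
  have hy : y ≠ 0 := by
    rintro rfl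
    have := (hpr x (-1) (by rw [h]; module)).2
    simp at this
  have hm : b p q + b q p ∈ L := by
    have h1 : b r r = (x * x) • b p p + (y * y) • b q q + (x * y) • (b p q + b q p) := by
      rw [h]
      simp only [map_add, map_smul, LinearMap.add_apply, LinearMap.smul_apply]
      module
    have h2 : (x * y) • (b p q + b q p) ∈ L := by
      have : (x * y) • (b p q + b q p) = b r r - (x * x) • b p p - (y * y) • b q q := by
        rw [h1]; module
      rw [this]
      exact L.sub_mem (L.sub_mem hr (L.smul_mem _ hp)) (L.smul_mem _ hq)
    exact (L.smul_mem_iff (mul_ne_zero hx hy)).1 h2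
  refine ⟨Set.univ, fun t => p + t • q, Set.infinite_univ, fun t _ => ?_, ?_⟩
  · have : b (p + t • q) (p + t • q) = b p p + (t * t) • b q q + t • (b p q + b q p) := by
      simp only [map_add, map_smul, LinearMap.add_apply, LinearMap.smul_apply]
      module
    rw [this]
    exact L.add_mem (L.add_mem hp (L.smul_mem _ hq)) (L.smul_mem _ hm)
  · intro t _ s _ hts c d hcd
    have h1 := hpq (c + d) (c * t + d * s) (by rw [← hcd]; module)
    have h2 : d * (s - t) = 0 := by linear_combination h1.2 - t * h1.1
    have h3 : d = 0 := (mul_eq_zero.1 h2).resolve_right (sub_ne_zero.2 hts.symm)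
    exact ⟨by linear_combination h1.1 - h3, h3⟩

lemma coplanar [Infinite k] {p q r : U}
    (hind : ∀ x y z : k, x • p + y • q + z • r = 0 → x = 0 ∧ y = 0 ∧ z = 0)
    (hp : b p p ∈ L) (hq : b q q ∈ L) (hr : b r r ∈ L)
    {x y z x' y' z' : k} (hx : x ≠ 0) (hy : y ≠ 0) (hz : z ≠ 0) (hx' : x' ≠ 0) (hy' : y' ≠ 0)
    (hz' : z' ≠ 0)
    (hnp : I2 (k := k) (x • p + y • q + z • r) (x' • p + y' • q + z' • r))
    (h : b (x • p + y • q + z • r) (x • p + y • q + z • r) ∈ L)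
    (h' : b (x' • p + y' • q + z' • r) (x' • p + y' • q + z' • r) ∈ L) : InfFam b L := by
  classical
  have key : ∀ a c d : k, b (a • p + c • q + d • r) (a • p + c • q + d • r) ∈ L ↔
      (a * c) • (b p q + b q p) + (a * d) • (b p r + b r p) + (c * d) • (b q r + b r q) ∈ L := by
    intro a c d
    have : b (a • p + c • q + d • r) (a • p + c • q + d • r) =
      ((a * a) • b p p + (c * c) • b q q + (d * d) • b r r) +
      ((a * c) • (b p q + b q p) + (a * d) • (b p r + b r p) + (c * d) • (b q r + b r q)) := by
      simp only [map_add, map_smul, LinearMap.add_apply, LinearMap.smul_apply]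
      module
    rw [this]
    exact L.add_mem_iff_right
      (L.add_mem (L.add_mem (L.smul_mem _ hp) (L.smul_mem _ hq)) (L.smul_mem _ hr))
  rw [key] at h h'
  let X : k → k := fun t => y * z + t * (y' * z')
  let Y : k → k := fun t => x * z + t * (x' * z')
  let Z : k → k := fun t => x * y + t * (x' * y')
  refine ⟨{t | X t ≠ 0 ∧ Y t ≠ 0 ∧ Z t ≠ 0},
    fun t => (Y t * Z t) • p + (X t * Z t) • q + (X t * Y t) • r, ?_, ?_, ?_⟩
  · have hsub : {t | X t ≠ 0 ∧ Y t ≠ 0 ∧ Z t ≠ 0}ᶜ ⊆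
        (({-(y * z) / (y' * z'), -(x * z) / (x' * z'), -(x * y) / (x' * y')} : Finset k) : Set k) := by
      intro t ht
      have ht' : X t = 0 ∨ Y t = 0 ∨ Z t = 0 := by
        by_contra hne
        push Not at hne
        exact ht hne
      simp only [X, Y, Z] at ht'
      simp only [Finset.coe_insert, Finset.coe_singleton, Set.mem_insert_iff,
        Set.mem_singleton_iff]
      rcases ht' with h1 | h1 | h1
      · left; field_simp; linear_combination h1
      · right; left; field_simp; linear_combination h1
      · right; right; field_simp; linear_combination h1
    have := (Finset.finite_toSet _).subset hsub
    have h2 := this.infinite_compl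
    rwa [compl_compl] at h2
  · intro t _
    rw [key]
    have : (Y t * Z t * (X t * Z t)) • (b p q + b q p) + (Y t * Z t * (X t * Y t)) • (b p r + b r p)
        + (X t * Z t * (X t * Y t)) • (b q r + b r q) =
        (X t * Y t * Z t) • (((x * y) • (b p q + b q p) + (x * z) • (b p r + b r p) +
          (y * z) • (b q r + b r q)) + t • ((x' * y') • (b p q + b q p) +
          (x' * z') • (b p r + b r p) + (y' * z') • (b q r + b r q))) := by
      simp only [X, Y, Z]
      module
    rw [this]
    exact L.smul_mem _ (L.add_mem h (L.smul_mem _ h'))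
  · rintro t ⟨hX, hY, hZ⟩ s ⟨hX', hY', hZ'⟩ hts c d hcd
    obtain ⟨e1, e2, e3⟩ := hind (c * (Y t * Z t) + d * (Y s * Z s))
      (c * (X t * Z t) + d * (X s * Z s)) (c * (X t * Y t) + d * (X s * Y s))
      (by rw [← hcd]; module)
    by_cases hd : d = 0
    · subst hd
      simp [hY, hZ] at e1
      exact ⟨e1, rfl⟩
    exfalso
    have f1 : X t * Y s - Y t * X s = 0 := by
      have : d * (Z t * Z s) * (X t * Y s - Y t * X s) = 0 := by
        linear_combination (X t * Z t) * e1 - (Y t * Z t) * e2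
      simpa [hd, hZ, hZ'] using this
    have f2 : X t * Z s - Z t * X s = 0 := by
      have : d * (Y t * Y s) * (X t * Z s - Z t * X s) = 0 := by
        linear_combination (X t * Y t) * e1 - (Y t * Z t) * e3
      simpa [hd, hY, hY'] using this
    have hst : s - t ≠ 0 := sub_ne_zero.2 hts.symm
    have g1 : x' * y - x * y' = 0 := by
      have : (s - t) * (z * z') * (x' * y - x * y') = 0 := by
        rw [← f1]; simp only [X, Y]; ring
      simpa [hst, hz, hz'] using this
    have g2 : x' * z - x * z' = 0 := by
      have : (s - t) * (y * y') * (x' * z - x * z') = 0 := by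
        rw [← f2]; simp only [X, Z]; ring
      simpa [hst, hy, hy'] using this
    have := (hnp x' (-x) (by
      have : x' • (x • p + y • q + z • r) + -x • (x' • p + y' • q + z' • r) =
        (x' * y - x * y') • q + (x' * z - x * z') • r := by module
      rw [this, g1, g2]; simp)).1
    exact hx' this

lemma combin (bad : Fin 7 → Fin 7 → Fin 7 → Prop)
    (hbad : ∀ i j l m, 0 ≠ i → 0 ≠ j → 0 ≠ l → 0 ≠ m → i ≠ j → i ≠ l → j ≠ l → i ≠ m →
      j ≠ m → l ≠ m → bad i j l → bad i j m → False)
    (swp1 : ∀ i j l, bad i j l → bad j l i) (swp2 : ∀ i j l, bad i j l → bad j i l)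
    (s1 : bad 1 2 3 ∨ bad 5 6 4) (s2 : bad 1 2 4 ∨ bad 5 6 3) (s3 : bad 1 2 5 ∨ bad 4 6 3) :
    False := by
  have H : ∀ i j l m, (0 ≠ i ∧ 0 ≠ j ∧ 0 ≠ l ∧ 0 ≠ m ∧ i ≠ j ∧ i ≠ l ∧ j ≠ l ∧ i ≠ m ∧
      j ≠ m ∧ l ≠ m) → bad i j l → bad i j m → False := by
    rintro i j l m ⟨h1, h2, h3, h4, h5, h6, h7, h8, h9, h10⟩
    exact hbad i j l m h1 h2 h3 h4 h5 h6 h7 h8 h9 h10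
  have c1 : bad 5 6 4 → bad 5 6 3 → False := H 5 6 4 3 (by decide)
  have c2 : bad 5 6 4 → bad 4 6 3 → False := fun h h' =>
    H 4 6 5 3 (by decide) (swp2 _ _ _ (swp1 _ _ _ h)) h'
  have c3 : bad 5 6 3 → bad 4 6 3 → False := fun h h' =>
    H 6 3 5 4 (by decide) (swp1 _ _ _ h) (swp1 _ _ _ h')
  rcases s1 with s1 | s1
  · rcases s2 with s2 | s2
    · exact H 1 2 3 4 (by decide) s1 s2
    · rcases s3 with s3 | s3
      · exact H 1 2 3 5 (by decide) s1 s3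
      · exact c3 s2 s3
  · rcases s2 with s2 | s2
    · rcases s3 with s3 | s3
      · exact H 1 2 4 5 (by decide) s2 s3
      · exact c2 s1 s3
    · exact c1 s1 s2

set_option maxHeartbeats 1000000 in
lemma castelnuovo [Infinite k]
    (hstar : ∀ l l' : U →ₗ[k] k, ∃ θ : E →ₗ[k] k, ∀ p, θ (b p p) = l p * l' p)
    [FiniteDimensional k L] (hL : Module.finrank k L ≤ 6) (p : Fin 7 → U)
    (hnp : ∀ i j, i ≠ j → I2 (k := k) (p i) (p j)) (hpL : ∀ i, b (p i) (p i) ∈ L) :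
    InfFam b L := by
  by_contra hinf
  -- dependency
  have hdep : ¬ LinearIndependent k (fun i => (⟨b (p i) (p i), hpL i⟩ : L)) := by
    intro h
    have := h.fintype_card_le_finrank
    simp at this
    omega
  rw [Fintype.not_linearIndependent_iff] at hdep
  obtain ⟨c, hc, j, hj⟩ := hdep
  let e : Equiv.Perm (Fin 7) := Equiv.swap 0 j
  let q : Fin 7 → U := fun i => p (e i)
  let c' : Fin 7 → k := fun i => c (e i)
  have hc' : ∑ i, c' i • b (q i) (q i) = 0 := by
    have h1 := congrArg (L.subtype) hc
    simp only [map_sum, map_smul, Submodule.subtype_apply, map_zero] at h1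
    rw [← Equiv.sum_comp e] at h1
    exact h1
  have hc0 : c' 0 ≠ 0 := by simpa [c', e] using hj
  have hq : ∀ i j, i ≠ j → I2 (k := k) (q i) (q j) :=
    fun i j hij => hnp _ _ (fun h => hij (e.injective h))
  have hqL : ∀ i, b (q i) (q i) ∈ L := fun i => hpL _
  have hcol : ∀ i j l, i ≠ j → i ≠ l → j ≠ l → ∀ x y : k, q l ≠ x • q i + y • q j :=
    fun i j l h1 h2 h3 x y h => hinf
      (collinear b L (hq i j h1) (hq i l h2) (hq j l h3) (hqL i) (hqL j) (hqL l) h)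
  have hind : ∀ i j l, i ≠ j → i ≠ l → j ≠ l →
      ∀ x y z : k, x • q i + y • q j + z • q l = 0 → x = 0 ∧ y = 0 ∧ z = 0 := by
    intro i j l h1 h2 h3 x y z h
    have hz : z = 0 := by
      by_contra hz
      apply hcol i j l h1 h2 h3 (-(z⁻¹ * x)) (-(z⁻¹ * y))
      have : q l = z⁻¹ • (z • q l) := by rw [smul_smul, inv_mul_cancel₀ hz, one_smul]
      rw [this]
      have h4 : z • q l = -(x • q i) - y • q j := by
        rw [eq_sub_iff_add_eq, eq_neg_iff_add_eq_zero, ← h]; abel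
      rw [h4]; module
    subst hz
    have := hq i j h1 x y (by simpa using h)
    exact ⟨this.1, this.2, rfl⟩
  have hcop : ∀ i j l m n, i ≠ j → i ≠ l → j ≠ l → i ≠ m → j ≠ m → l ≠ m → i ≠ n → j ≠ n →
      l ≠ n → m ≠ n → q m ∈ Submodule.span k {q i, q j, q l} →
      q n ∈ Submodule.span k {q i, q j, q l} → False := by
    intro i j l m n hij hil hjl him hjm hlm hin hjn hln hmn h1 h2
    rw [Submodule.mem_span_triple] at h1 h2
    obtain ⟨x, y, z, h1⟩ := h1
    obtain ⟨x', y', z', h2⟩ := h2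
    have nz : ∀ (m : Fin 7) (x y z : k), i ≠ m → j ≠ m → l ≠ m →
        x • q i + y • q j + z • q l = q m → x ≠ 0 ∧ y ≠ 0 ∧ z ≠ 0 := by
      intro m x y z him hjm hlm h
      refine ⟨?_, ?_, ?_⟩
      · rintro rfl
        exact hcol j l m hjl hjm hlm y z (by rw [← h]; module)
      · rintro rfl
        exact hcol i l m hil him hlm x z (by rw [← h]; module)
      · rintro rfl
        exact hcol i j m hij him hjm x y (by rw [← h]; module)
    obtain ⟨a1, a2, a3⟩ := nz m x y z him hjm hlm h1
    obtain ⟨b1, b2, b3⟩ := nz n x' y' z' hin hjn hln h2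
    apply hinf
    apply coplanar b L (hind i j l hij hil hjl) (hqL i) (hqL j) (hqL l) a1 a2 a3 b1 b2 b3
    · rw [h1, h2]; exact hq m n hmn
    · rw [h1]; exact hqL m
    · rw [h2]; exact hqL n
  -- bad triples
  let bad : Fin 7 → Fin 7 → Fin 7 → Prop := fun i j l => q 0 ∈ Submodule.span k {q i, q j, q l}
  have hex : ∀ i j l, 0 ≠ i → 0 ≠ j → 0 ≠ l → i ≠ j → i ≠ l → j ≠ l → bad i j l →
      q l ∈ Submodule.span k {q 0, q i, q j} := by
    intro i j l h0i h0j h0l hij hil hjl h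
    simp only [bad] at h
    rw [Submodule.mem_span_triple] at h ⊢
    obtain ⟨x, y, z, h⟩ := h
    have hz : z ≠ 0 := by
      rintro rfl
      exact hcol i j 0 hij h0i.symm h0j.symm x y (by rw [← h]; module)
    refine ⟨z⁻¹, -(z⁻¹ * x), -(z⁻¹ * y), ?_⟩
    have : q l = z⁻¹ • (z • q l) := by rw [smul_smul, inv_mul_cancel₀ hz, one_smul]
    rw [this, ← h]
    module
  have hbad : ∀ i j l m, 0 ≠ i → 0 ≠ j → 0 ≠ l → 0 ≠ m → i ≠ j → i ≠ l → j ≠ l → i ≠ m →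
      j ≠ m → l ≠ m → bad i j l → bad i j m → False := by
    intro i j l m h0i h0j h0l h0m hij hil hjl him hjm hlm h1 h2
    exact hcop 0 i j l m h0i h0j hij h0l hil hjl h0m him hjm hlm
      (hex i j l h0i h0j h0l hij hil hjl h1) (hex i j m h0i h0j h0m hij him hjm h2)
  have hsplit : ∀ i j l m n r : Fin 7,
      (∀ f : Fin 7 → k, f i = 0 → f j = 0 → f l = 0 → f m = 0 → f n = 0 → f r = 0 →
        ∑ s, f s = f 0) → bad i j l ∨ bad m n r := by
    intro i j l m n r hsum
    by_contra hne
    push Not at hne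
    obtain ⟨f, hf0, hf⟩ := Submodule.exists_le_ker_of_notMem hne.1
    obtain ⟨f', hf0', hf'⟩ := Submodule.exists_le_ker_of_notMem hne.2
    have v1 : ∀ x ∈ ({q i, q j, q l} : Set U), f x = 0 := fun x hx => hf (Submodule.subset_span hx)
    have v2 : ∀ x ∈ ({q m, q n, q r} : Set U), f' x = 0 :=
      fun x hx => hf' (Submodule.subset_span hx)
    obtain ⟨θ, hθ⟩ := hstar f f'
    have h1 := congrArg θ hc'
    simp only [map_sum, map_smul, hθ, map_zero, smul_eq_mul] at h1
    rw [hsum (fun s => c' s * (f (q s) * f' (q s))) (by simp [v1 (q i) (by simp)])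
      (by simp [v1 (q j) (by simp)]) (by simp [v1 (q l) (by simp)]) (by simp [v2 (q m) (by simp)])
      (by simp [v2 (q n) (by simp)]) (by simp [v2 (q r) (by simp)])] at h1
    simp [hc0, hf0, hf0'] at h1
  have s1 := hsplit 1 2 3 5 6 4 (by
    intro f h1 h2 h3 h4 h5 h6; simp only [Fin.sum_univ_seven, h1, h2, h3, h4, h5, h6]; simp)
  have s2 := hsplit 1 2 4 5 6 3 (by
    intro f h1 h2 h3 h4 h5 h6; simp only [Fin.sum_univ_seven, h1, h2, h3, h4, h5, h6]; simp)
  have s3 := hsplit 1 2 5 4 6 3 (by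
    intro f h1 h2 h3 h4 h5 h6; simp only [Fin.sum_univ_seven, h1, h2, h3, h4, h5, h6]; simp)
  have swp1 : ∀ i j l, bad i j l → bad j l i := by
    intro i j l h
    simp only [bad] at h ⊢
    rwa [Set.insert_comm, Set.pair_comm (q i) (q l)] at h
  have swp2 : ∀ i j l, bad i j l → bad j i l := by
    intro i j l h
    simp only [bad] at h ⊢
    rwa [Set.insert_comm] at h
  exact combin bad hbad swp1 swp2 s1 s2 s3

end cast


section geom
variable {k : Type*} [Field k]

lemma ext_one {U : Type*} [AddCommGroup U] [Module k U] [FiniteDimensional k U]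
    (S W : Submodule k U) (h : S ≤ W)
    (hlt : Module.finrank k S < Module.finrank k W) :
    ∃ r ∈ W, S ⊔ Submodule.span k {r} ≤ W ∧
      Module.finrank k S + 1 ≤ Module.finrank k ↥(S ⊔ Submodule.span k {r}) := by
  have : ¬ W ≤ S := fun h' => by
    have := Submodule.finrank_mono h'
    omega
  obtain ⟨r, hr, hrS⟩ := SetLike.not_le_iff_exists.1 this
  refine ⟨r, hr, sup_le h (by simpa using hr), ?_⟩
  apply Submodule.finrank_lt_finrank_of_lt
  refine lt_of_le_of_ne le_sup_left fun he => hrS ?_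
  rw [he]
  exact Submodule.mem_sup_right (Submodule.mem_span_singleton_self r)

lemma finrank_pair {U : Type*} [AddCommGroup U] [Module k U] [FiniteDimensional k U]
    {p q : U} (h : I2 (k := k) p q) : Module.finrank k (Submodule.span k {p, q}) = 2 := by
  have hli : LinearIndependent k ![p, q] := LinearIndependent.pair_iff.2 h
  have := finrank_span_eq_card hli
  rwa [Matrix.range_cons_cons_empty, Fintype.card_fin] at this

lemma normalB {W : Submodule k ((Fin 5 → k) × (Fin 5 → k))} (hW : Module.finrank k W = 3)
    (hG : Gen W) (hS : Spn W) : ∃ x : Module.Basis (Fin 5) k (Fin 5 → k),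
      (x 0, x 1) ∈ W ∧ (x 2, x 3) ∈ W ∧ (x 3, x 4) ∈ W ∧
      ∀ q ∈ W, ∃ a b c : k, q = a • (x 0, x 1) + b • (x 2, x 3) + c • (x 3, x 4) := by
  let T : (W × W) →ₗ[k] (Fin 5 → k) :=
    (LinearMap.snd k _ _ ∘ₗ W.subtype) ∘ₗ LinearMap.fst k W W -
      (LinearMap.fst k _ _ ∘ₗ W.subtype) ∘ₗ LinearMap.snd k W W
  have hT : LinearMap.ker T ≠ ⊥ := LinearMap.ker_ne_bot_of_finrank_lt (by
    rw [Module.finrank_prod, hW]; simp)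
  obtain ⟨⟨⟨p, hp⟩, ⟨p', hp'⟩⟩, hk, hne⟩ := Submodule.exists_mem_ne_zero_of_ne_bot hT
  have hpp : p.2 = p'.1 := by
    have : p.2 - p'.1 = 0 := hk
    exact sub_eq_zero.1 this
  have hpn : p ≠ 0 := by
    rintro rfl
    have : p' = 0 := hG p' hp' 1 0 (by simp) (by rw [← hpp]; simp)
    subst this
    exact hne rfl
  have hi : I2 (k := k) p p' := by
    intro a b hab
    by_contra hc
    have h1 := congrArg Prod.fst hab
    simp only [Prod.fst_add, Prod.smul_fst, Prod.fst_zero, ← hpp] at h1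
    exact hpn (hG p hp a b hc h1)
  have hSle : Submodule.span k {p, p'} ≤ W := by
    rw [Submodule.span_le]
    rintro y (rfl | rfl)
    · exact hp
    · exact hp'
  obtain ⟨r, hr, hle, hfr⟩ := ext_one _ W hSle (by rw [finrank_pair hi, hW]; norm_num)
  rw [finrank_pair hi] at hfr
  have hWeq := Submodule.eq_of_le_of_finrank_le hle (by omega)
  have hall : ∀ q ∈ W, ∃ a b c : k, q = a • r + b • p + c • p' := by
    intro q hq
    rw [← hWeq, Submodule.mem_sup] at hq
    obtain ⟨y, hy, z, hz, rfl⟩ := hq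
    obtain ⟨b, c, rfl⟩ := Submodule.mem_span_pair.1 hy
    obtain ⟨a, rfl⟩ := Submodule.mem_span_singleton.1 hz
    exact ⟨a, b, c, by module⟩
  let x : Fin 5 → (Fin 5 → k) := ![r.1, r.2, p.1, p.2, p'.2]
  have htop : ⊤ ≤ Submodule.span k (Set.range x) := by
    intro v _
    by_contra hv
    obtain ⟨f, hf0, hf⟩ := Submodule.exists_le_ker_of_notMem hv
    have hx : ∀ i, f (x i) = 0 := fun i => hf (Submodule.subset_span ⟨i, rfl⟩)
    have h0 : f r.1 = 0 := hx 0
    have h1 : f r.2 = 0 := hx 1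
    have h2 : f p.1 = 0 := hx 2
    have h3 : f p.2 = 0 := hx 3
    have h4 : f p'.2 = 0 := hx 4
    have h5 : f p'.1 = 0 := by rw [← hpp]; exact h3
    have : ev.symm f = 0 := by
      apply hS
      intro q hq
      rw [LinearEquiv.apply_symm_apply]
      obtain ⟨a, b, c, rfl⟩ := hall q hq
      simp [h0, h1, h2, h3, h4, h5]
    have : f = 0 := by simpa using this
    exact hf0 (by rw [this]; rfl)
  let X := basisOfTopLeSpanOfCardEqFinrank x htop (by simp)
  have hX : ∀ i, X i = x i := fun i => by simp [X]
  have e0 : (X 0, X 1) = r := by rw [hX, hX]; rfl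
  have e1 : (X 2, X 3) = p := by rw [hX, hX]; rfl
  have e2 : (X 3, X 4) = p' := by
    rw [hX, hX]
    exact Prod.ext hpp rfl
  refine ⟨X, ?_, ?_, ?_, ?_⟩
  · rw [e0]; exact hr
  · rw [e1]; exact hp
  · rw [e2]; exact hp'
  · rw [e0, e1, e2]; exact hall

/-- The bilinear map whose diagonal is `om`. -/
noncomputable def bil (k : Type*) [Field k] : ((Fin 5 → k) × (Fin 5 → k)) →ₗ[k]
    ((Fin 5 → k) × (Fin 5 → k)) →ₗ[k] ExteriorAlgebra k (Fin 5 → k) :=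
  (LinearMap.mul k (ExteriorAlgebra k (Fin 5 → k))).compl₁₂
    (ι k ∘ₗ LinearMap.fst k _ _) (ι k ∘ₗ LinearMap.snd k _ _)

lemma bil_apply (p q : (Fin 5 → k) × (Fin 5 → k)) : bil k p q = ι k p.1 * ι k q.2 := rfl

lemma om_eq (p : (Fin 5 → k) × (Fin 5 → k)) : om p = bil k p p := rfl

lemma om_smul (a : k) (p : (Fin 5 → k) × (Fin 5 → k)) : om (a • p) = (a * a) • om p := by
  rw [om_eq, om_eq]
  simp [smul_smul]

lemma om_comb (p q : (Fin 5 → k) × (Fin 5 → k)) (a b c d : k)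
    (h1 : p.1 = a • q.1 + b • q.2) (h2 : p.2 = c • q.1 + d • q.2) :
    om p = (a * d - b * c) • om q := by
  have h3 : ι k q.2 * ι k q.1 = - (ι k q.1 * ι k q.2) := by
    rw [eq_neg_iff_add_eq_zero]
    exact ExteriorAlgebra.ι_add_mul_swap _ _
  rw [om, om, h1, h2]
  simp only [map_add, map_smul, add_mul, mul_add, smul_mul_smul_comm, ExteriorAlgebra.ι_sq_zero,
    h3]
  module

lemma om_dep (p : (Fin 5 → k) × (Fin 5 → k)) (a b : k) (hab : ¬ (a = 0 ∧ b = 0))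
    (h : a • p.1 + b • p.2 = 0) : om p = 0 := by
  have h3 : ι k p.1 * ι k p.1 = 0 := ExteriorAlgebra.ι_sq_zero _
  have h4 : ι k p.2 * ι k p.2 = 0 := ExteriorAlgebra.ι_sq_zero _
  have h1 := congrArg (fun v => ι k v * ι k p.2) h
  have h2 := congrArg (fun v => ι k p.1 * ι k v) h
  simp [add_mul, mul_add, h3, h4] at h1 h2
  rw [om]
  by_contra hne
  exact hab ⟨h1.resolve_right hne, h2.resolve_right hne⟩

/-- The six generators of the span of `Z_B`. -/
noncomputable def gens (x : Fin 5 → (Fin 5 → k)) : Fin 6 → ExteriorAlgebra k (Fin 5 → k) :=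
  ![ι k (x 0) * ι k (x 1), ι k (x 2) * ι k (x 3), ι k (x 3) * ι k (x 4),
    ι k (x 0) * ι k (x 3) + ι k (x 2) * ι k (x 1),
    ι k (x 0) * ι k (x 4) + ι k (x 3) * ι k (x 1),
    ι k (x 2) * ι k (x 4) + ι k (x 3) * ι k (x 3)]

lemma om_mem_span (x : Fin 5 → (Fin 5 → k)) (a b c : k) :
    om (a • (x 0, x 1) + b • (x 2, x 3) + c • (x 3, x 4)) ∈
      Submodule.span k (Set.range (gens x)) := by
  have h : ∀ i, gens x i ∈ Submodule.span k (Set.range (gens x)) :=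
    fun i => Submodule.subset_span ⟨i, rfl⟩
  have : om (a • (x 0, x 1) + b • (x 2, x 3) + c • (x 3, x 4)) =
      (a * a) • gens x 0 + (b * b) • gens x 1 + (c * c) • gens x 2 + (a * b) • gens x 3 +
      (a * c) • gens x 4 + (b * c) • gens x 5 := by
    rw [om_eq]
    simp only [map_add, map_smul, LinearMap.add_apply, LinearMap.smul_apply, bil_apply, gens]
    simp only [Matrix.cons_val]
    module
  rw [this]
  have h' : ∀ (c : k) i, c • gens x i ∈ Submodule.span k (Set.range (gens x)) :=
    fun c i => Submodule.smul_mem _ c (h i)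
  exact add_mem (add_mem (add_mem (add_mem (add_mem (h' _ _) (h' _ _)) (h' _ _)) (h' _ _))
    (h' _ _)) (h' _ _)

lemma span_eqs (x : Module.Basis (Fin 5) k (Fin 5 → k)) (p : (Fin 5 → k) × (Fin 5 → k))
    (hp : om p ∈ Submodule.span k (Set.range (gens x))) (v w : Fin 5 → k)
    (hv : v = fun i => x.coord i p.1) (hw : w = fun i => x.coord i p.2) :
    v 0 * w 2 - w 0 * v 2 = 0 ∧ v 1 * w 4 - w 1 * v 4 = 0 ∧
    (v 0 * w 3 - w 0 * v 3) + (v 1 * w 2 - w 1 * v 2) = 0 ∧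
    (v 0 * w 4 - w 0 * v 4) + (v 1 * w 3 - w 1 * v 3) = 0 := by
  choose θ hθ using fun i j => exists_theta (x.coord i) (x.coord j)
  have key : ∀ T : ExteriorAlgebra k (Fin 5 → k) →ₗ[k] k, (∀ i, T (gens x i) = 0) →
      T (om p) = 0 := by
    intro T hT
    have : Submodule.span k (Set.range (gens x)) ≤ LinearMap.ker T := by
      rw [Submodule.span_le]
      rintro _ ⟨i, rfl⟩
      exact hT i
    exact this hp
  subst hv hw
  refine ⟨?_, ?_, ?_, ?_⟩
  · have := key (θ 0 2) (by
      intro i; fin_cases i <;> simp [gens, hθ])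
    rw [om, hθ] at this
    exact this
  · have := key (θ 1 4) (by
      intro i; fin_cases i <;> simp [gens, hθ])
    rw [om, hθ] at this
    exact this
  · have := key (θ 0 3 + θ 1 2) (by
      intro i; fin_cases i <;> simp [gens, hθ])
    rw [om, LinearMap.add_apply, hθ, hθ] at this
    exact this
  · have := key (θ 0 4 + θ 1 3) (by
      intro i; fin_cases i <;> simp [gens, hθ])
    rw [om, LinearMap.add_apply, hθ, hθ] at this
    exact this

lemma om_cases [IsAlgClosed k] {W : Submodule k ((Fin 5 → k) × (Fin 5 → k))}
    (x : Module.Basis (Fin 5) k (Fin 5 → k))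
    (m0 : (x 0, x 1) ∈ W) (m1 : (x 2, x 3) ∈ W) (m2 : (x 3, x 4) ∈ W)
    (p : (Fin 5 → k) × (Fin 5 → k)) (hp : om p ∈ Submodule.span k (Set.range (gens x)))
    (hne : om p ≠ 0) : om p ∈ coneZ W ∨
      (x.coord 0 p.1 = 0 ∧ x.coord 1 p.1 = 0 ∧ x.coord 0 p.2 = 0 ∧ x.coord 1 p.2 = 0) := by
  obtain ⟨v, hv⟩ : ∃ v : Fin 5 → k, v = fun i => x.coord i p.1 := ⟨_, rfl⟩
  obtain ⟨w, hw⟩ : ∃ w : Fin 5 → k, w = fun i => x.coord i p.2 := ⟨_, rfl⟩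
  obtain ⟨e1, e2, e3, e4⟩ := span_eqs x p hp v w hv hw
  have hv' : ∀ i, x.coord i p.1 = v i := fun i => by rw [hv]
  have hw' : ∀ i, x.coord i p.2 = w i := fun i => by rw [hw]
  have hpv : p.1 = ∑ i, v i • x i := by
    rw [hv]; exact (x.sum_repr p.1).symm
  have hpw : p.2 = ∑ i, w i • x i := by
    rw [hw]; exact (x.sum_repr p.2).symm
  rw [hv', hv', hw', hw']
  obtain ⟨a, ha⟩ : ∃ a, a = v 0 * w 1 - w 0 * v 1 := ⟨_, rfl⟩
  obtain ⟨b, hb⟩ : ∃ b, b = v 0 * w 3 - w 0 * v 3 := ⟨_, rfl⟩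
  obtain ⟨c, hc⟩ : ∃ c, c = v 0 * w 4 - w 0 * v 4 := ⟨_, rfl⟩
  by_cases ha0 : a = 0
  · right
    have hb0 : b = 0 := by
      have : b * b = 0 := by
        have h1 : b * b = a * (v 2 * w 3 - w 2 * v 3) := by
          rw [hb, ha]
          linear_combination -(v 1 * w 3 - w 1 * v 3) * e1 + (v 0 * w 3 - w 0 * v 3) * e3
        rw [h1, ha0, zero_mul]
      simpa using this
    have hc0 : c = 0 := by
      have : c * c = 0 := by
        have h1 : c * c = a * (v 3 * w 4 - w 3 * v 4) := by
          rw [hc, ha]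
          linear_combination (v 0 * w 4 - w 0 * v 4) * e4 - (v 0 * w 3 - w 0 * v 3) * e2
        rw [h1, ha0, zero_mul]
      simpa using this
    have z01 : v 0 * w 1 - w 0 * v 1 = 0 := by rw [← ha, ha0]
    have z03 : v 0 * w 3 - w 0 * v 3 = 0 := by rw [← hb, hb0]
    have z04 : v 0 * w 4 - w 0 * v 4 = 0 := by rw [← hc, hc0]
    have z12 : v 1 * w 2 - w 1 * v 2 = 0 := by linear_combination e3 - z03
    have z13 : v 1 * w 3 - w 1 * v 3 = 0 := by linear_combination e4 - z04
    have f0 : w 0 = 0 ∧ - v 0 = 0 := by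
      by_contra hc
      apply hne
      apply om_dep p _ _ hc
      rw [hpv, hpw]
      simp only [Fin.sum_univ_five]
      linear_combination (norm := module) (-z01) • x 1 - e1 • x 2 - z03 • x 3 - z04 • x 4
    have f1 : w 1 = 0 ∧ - v 1 = 0 := by
      by_contra hc
      apply hne
      apply om_dep p _ _ hc
      rw [hpv, hpw]
      simp only [Fin.sum_univ_five]
      linear_combination (norm := module) z01 • x 0 - z12 • x 2 - z13 • x 3 - e2 • x 4
    exact ⟨by simpa using f0.2, by simpa using f1.2, f0.1, f1.1⟩
  · left
    let q : (Fin 5 → k) × (Fin 5 → k) := (x 0, x 1) + (b / a) • (x 2, x 3) + (c / a) • (x 3, x 4)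
    have hq : q ∈ W := add_mem (add_mem m0 (W.smul_mem _ m1)) (W.smul_mem _ m2)
    have h1 : p.1 = v 0 • q.1 + v 1 • q.2 := by
      have g2 : v 2 = v 0 * (b / a) := by
        field_simp
        simp only [ha, hb, hc]
        linear_combination -v 0 * e3 + v 1 * e1
      have g3 : v 3 = v 0 * (c / a) + v 1 * (b / a) := by
        field_simp
        simp only [ha, hb, hc]
        linear_combination -v 0 * e4
      have g4 : v 4 = v 1 * (c / a) := by
        field_simp
        simp only [ha, hb, hc]
        linear_combination -v 0 * e2
      rw [hpv]
      simp only [Fin.sum_univ_five, q, g2, g3, g4, Prod.fst_add, Prod.snd_add, Prod.smul_fst,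
        Prod.smul_snd]
      module
    have h2 : p.2 = w 0 • q.1 + w 1 • q.2 := by
      have g2 : w 2 = w 0 * (b / a) := by
        field_simp
        simp only [ha, hb, hc]
        linear_combination -w 0 * e3 + w 1 * e1
      have g3 : w 3 = w 0 * (c / a) + w 1 * (b / a) := by
        field_simp
        simp only [ha, hb, hc]
        linear_combination -w 0 * e4
      have g4 : w 4 = w 1 * (c / a) := by
        field_simp
        simp only [ha, hb, hc]
        linear_combination -w 0 * e2
      rw [hpw]
      simp only [Fin.sum_univ_five, q, g2, g3, g4, Prod.fst_add, Prod.snd_add, Prod.smul_fst,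
        Prod.smul_snd]
      module
    have h3 : om p = a • om q := by
      rw [om_comb p q _ _ _ _ h1 h2, ha]
      congr 1; ring
    obtain ⟨s, hs⟩ := IsAlgClosed.exists_pow_nat_eq a (n := 2) (by norm_num)
    refine ⟨s • q, W.smul_mem _ hq, ?_⟩
    change om p = om (s • q)
    rw [om_smul, h3, ← hs, sq]


lemma quad_zero [IsAlgClosed k] (A B C : k) :
    ∃ α β : k, ¬ (α = 0 ∧ β = 0) ∧ A * α ^ 2 + B * α * β + C * β ^ 2 = 0 := by
  by_cases hA : A = 0
  · exact ⟨1, 0, by simp, by simp [hA]⟩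
  · obtain ⟨z, hz⟩ := IsAlgClosed.exists_root
      (Polynomial.C A * Polynomial.X ^ 2 + Polynomial.C B * Polynomial.X + Polynomial.C C)
      (by rw [Polynomial.degree_quadratic hA]; norm_num)
    refine ⟨z, 1, by simp, ?_⟩
    simp [Polynomial.IsRoot] at hz
    linear_combination hz

lemma ker_two (a b c d : k) (h : a * d - b * c = 0) :
    ∃ s t : k, ¬ (s = 0 ∧ t = 0) ∧ s * a + t * b = 0 ∧ s * c + t * d = 0 := by
  by_cases h1 : b = 0 ∧ -a = 0
  · by_cases h2 : d = 0 ∧ -c = 0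
    · refine ⟨1, 0, by simp, ?_, ?_⟩
      · linear_combination -h1.2
      · linear_combination -h2.2
    · refine ⟨d, -c, h2, ?_, ?_⟩
      · linear_combination h
      · ring
  · refine ⟨b, -a, h1, ?_, ?_⟩
    · ring
    · linear_combination -h

lemma pi_point [IsAlgClosed k] {W W' : Submodule k ((Fin 5 → k) × (Fin 5 → k))}
    (hW : Module.finrank k W = 4) (hS : Spn W) (hS' : Spn W')
    (hdisj : loc W ∩ loc W' = ∅)
    (x : Module.Basis (Fin 5) k (Fin 5 → k))
    (hall : ∀ q ∈ W', ∃ a b c : k, q = a • (x 0, x 1) + b • (x 2, x 3) + c • (x 3, x 4))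
    (p p' : (Fin 5 → k) × (Fin 5 → k)) (hp : p ∈ W) (hp' : p' ∈ W) (hI : I2 (k := k) p p')
    (h1 : x.coord 0 p.1 = 0 ∧ x.coord 1 p.1 = 0 ∧ x.coord 0 p.2 = 0 ∧ x.coord 1 p.2 = 0)
    (h2 : x.coord 0 p'.1 = 0 ∧ x.coord 1 p'.1 = 0 ∧ x.coord 0 p'.2 = 0 ∧ x.coord 1 p'.2 = 0) :
    False := by
  have hSle : Submodule.span k {p, p'} ≤ W := by
    rw [Submodule.span_le]
    rintro y (rfl | rfl)
    · exact hp
    · exact hp'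
  obtain ⟨r, hr, hle, hfr⟩ := ext_one _ W hSle (by rw [finrank_pair hI, hW]; norm_num)
  rw [finrank_pair hI] at hfr
  have hW' : ∃ r' ∈ W, ∀ q ∈ W, ∃ a b c d : k, q = a • p + b • p' + c • r + d • r' := by
    by_cases hlt : Module.finrank k ↥(Submodule.span k {p, p'} ⊔ Submodule.span k {r}) <
        Module.finrank k W
    · obtain ⟨r', hr', hle', hfr'⟩ := ext_one _ W hle hlt
      have hWeq := Submodule.eq_of_le_of_finrank_le hle' (by omega)
      refine ⟨r', hr', fun q hq => ?_⟩
      rw [← hWeq, Submodule.mem_sup] at hq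
      obtain ⟨y, hy, z, hz, rfl⟩ := hq
      rw [Submodule.mem_sup] at hy
      obtain ⟨y, hy, z', hz', rfl⟩ := hy
      obtain ⟨a, b, rfl⟩ := Submodule.mem_span_pair.1 hy
      obtain ⟨c, rfl⟩ := Submodule.mem_span_singleton.1 hz'
      obtain ⟨d, rfl⟩ := Submodule.mem_span_singleton.1 hz
      exact ⟨a, b, c, d, rfl⟩
    · have hWeq := Submodule.eq_of_le_of_finrank_le hle (by omega)
      refine ⟨0, W.zero_mem, fun q hq => ?_⟩
      rw [← hWeq, Submodule.mem_sup] at hq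
      obtain ⟨y, hy, z', hz', rfl⟩ := hq
      obtain ⟨a, b, rfl⟩ := Submodule.mem_span_pair.1 hy
      obtain ⟨c, rfl⟩ := Submodule.mem_span_singleton.1 hz'
      exact ⟨a, b, c, 0, by simp⟩
  obtain ⟨r', hr', hspan⟩ := hW'
  obtain ⟨F, hF⟩ : ∃ F, F = x.coord 0 := ⟨_, rfl⟩
  obtain ⟨G, hG⟩ : ∃ G, G = x.coord 1 := ⟨_, rfl⟩
  rw [← hF, ← hG] at h1 h2
  obtain ⟨α, β, hαβ, hQ⟩ := quad_zero (F r.1 * F r'.2 - F r.2 * F r'.1)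
    (F r.1 * G r'.2 + G r.1 * F r'.2 - F r.2 * G r'.1 - G r.2 * F r'.1)
    (G r.1 * G r'.2 - G r.2 * G r'.1)
  obtain ⟨f, hf⟩ : ∃ f : Module.Dual k (Fin 5 → k), f = α • F + β • G := ⟨_, rfl⟩
  have hfa : ∀ v, f v = α * F v + β * G v := fun v => by rw [hf]; rfl
  have hF0 : ∀ i, F (x i) = if i = 0 then 1 else 0 := by
    intro i
    rw [hF]
    fin_cases i <;> simp
  have hG0 : ∀ i, G (x i) = if i = 1 then 1 else 0 := by
    intro i
    rw [hG]
    fin_cases i <;> simp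
  have hne : ev.symm f ≠ 0 := by
    intro h0
    have h0' : f = 0 := by simpa using h0
    apply hαβ
    have i0 : f (x 0) = α := by rw [hfa, hF0, hG0]; simp
    have i1 : f (x 1) = β := by rw [hfa, hF0, hG0]; simp
    rw [h0'] at i0 i1
    exact ⟨i0.symm, i1.symm⟩
  have hnz : ∀ W : Submodule k ((Fin 5 → k) × (Fin 5 → k)), Spn W →
      ∃ q ∈ W, ev (ev.symm f) q.1 ≠ 0 ∨ ev (ev.symm f) q.2 ≠ 0 := by
    intro W hS
    by_contra hc
    push Not at hc
    exact hne (hS _ hc)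
  have m1 : ev.symm f ∈ loc W := by
    refine ⟨?_, hnz W hS⟩
    obtain ⟨s, t, hst, k1, k2⟩ := ker_two (f r.1) (f r.2) (f r'.1) (f r'.2) (by
      simp only [hfa]
      linear_combination hQ)
    refine ⟨s, t, hst, fun q hq => ?_⟩
    rw [LinearEquiv.apply_symm_apply]
    obtain ⟨a, b, c, d, rfl⟩ := hspan q hq
    have l1 : f p.1 = 0 := by rw [hfa, h1.1, h1.2.1]; ring
    have l2 : f p.2 = 0 := by rw [hfa, h1.2.2.1, h1.2.2.2]; ring
    have l3 : f p'.1 = 0 := by rw [hfa, h2.1, h2.2.1]; ring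
    have l4 : f p'.2 = 0 := by rw [hfa, h2.2.2.1, h2.2.2.2]; ring
    simp only [Prod.fst_add, Prod.snd_add, Prod.smul_fst, Prod.smul_snd, map_add, map_smul,
      l1, l2, l3, l4, smul_eq_mul]
    linear_combination c * k1 + d * k2
  have m2 : ev.symm f ∈ loc W' := by
    refine ⟨⟨β, -α, ?_, fun q hq => ?_⟩, hnz W' hS'⟩
    · rintro ⟨j1, j2⟩
      exact hαβ ⟨by simpa using j2, j1⟩
    · rw [LinearEquiv.apply_symm_apply]
      obtain ⟨a, b, c, rfl⟩ := hall q hq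
      simp only [Prod.fst_add, Prod.snd_add, Prod.smul_fst, Prod.smul_snd, map_add, map_smul,
        smul_eq_mul, hfa, hF0, hG0]
      simp
      ring
  have : ev.symm f ∈ loc W ∩ loc W' := ⟨m1, m2⟩
  rw [hdisj] at this
  exact this

/-- Proportional squares come from proportional vectors. -/
lemma star_inj {W : Submodule k ((Fin 5 → k) × (Fin 5 → k))} (hs : Star W) (p q : W)
    (c : k) (hI : I2 (k := k) p q) (h : om p.1 = c • om q.1) : False := by
  have hq : p ∉ Submodule.span k {q} := by
    intro hm
    obtain ⟨a, ha⟩ := Submodule.mem_span_singleton.1 hm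
    have := (hI (-1) a (by rw [ha]; simp)).1
    simp at this
  obtain ⟨l, hl0, hl⟩ := Submodule.exists_le_ker_of_notMem hq
  have hlq : l q = 0 := hl (Submodule.mem_span_singleton_self q)
  obtain ⟨θ, hθ⟩ := hs l l
  have h1 := congrArg θ h
  rw [map_smul, hθ, hθ, hlq] at h1
  simp at h1
  exact hl0 h1

lemma star_ne {W : Submodule k ((Fin 5 → k) × (Fin 5 → k))} (hs : Star W) (p : W)
    (hp : p ≠ 0) : om p.1 ≠ 0 := by
  intro h
  obtain ⟨l, hl⟩ : ∃ l : W →ₗ[k] k, l p ≠ 0 := by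
    by_contra hc
    push Not at hc
    exact hp ((Module.forall_dual_apply_eq_zero_iff k p).1 hc)
  obtain ⟨θ, hθ⟩ := hs l l
  have := hθ p
  rw [h, map_zero] at this
  exact hl (by simpa using this.symm)

lemma dep_om {W : Submodule k ((Fin 5 → k) × (Fin 5 → k))} (p q : W)
    (hp : om p.1 ≠ 0) (hq : om q.1 ≠ 0) (hI : ¬ I2 (k := k) p q) :
    Projectivization.mk k (om p.1) hp = Projectivization.mk k (om q.1) hq := by
  have hp0 : p ≠ 0 := by
    rintro rfl
    exact hp (by simp [om])
  have hq0 : q ≠ 0 := by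
    rintro rfl
    exact hq (by simp [om])
  unfold I2 at hI
  push Not at hI
  obtain ⟨a, b, hab, h⟩ := hI
  have ha : a ≠ 0 := by
    rintro rfl
    simp [hq0] at hab
    exact h rfl hab
  rw [Projectivization.mk_eq_mk_iff']
  refine ⟨(-(a⁻¹ * b)) * (-(a⁻¹ * b)), ?_⟩
  rw [← om_smul]
  congr 1
  have h1 : a • p = - (b • q) := eq_neg_of_add_eq_zero_left hab
  have h2 : p = a⁻¹ • (a • p) := by rw [smul_smul, inv_mul_cancel₀ ha, one_smul]
  rw [h2, h1]
  simp [smul_smul]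

end geom

end St6

/-!
STATEMENT 6: Assume the generality assumption (`C_A` a smooth rational normal quartic,
`S_B` a smooth rational cubic scroll, `C_A ∩ S_B = ∅`, with `V_A` of dimension 4 and `V_B`
of dimension 3).  If the intersection `Γ = Z_A ∩ Z_B` is finite, then `Γ` consists of at
most 6 distinct points.
-/
theorem stmt6 (k : Type*) [Field k] [IsAlgClosed k]
    (A₁ : Matrix (Fin 2) (Fin 4) (Fin 5 → k)) (B₁ : Matrix (Fin 3) (Fin 2) (Fin 5 → k))
    (hCA : IsRNQuartic A₁) (hSB : IsCubicScroll B₁)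
    (hdisj : rankOneLocus A₁ ∩ rankOneLocus B₁ = ∅)
    (hVA : Module.finrank k (colSpace A₁) = 4)
    (hVB : Module.finrank k (rowSpace B₁) = 3)
    (hfin : (gammaSet A₁ B₁).Finite) :
    (gammaSet A₁ B₁).ncard ≤ 6 := by
  haveI : Infinite k := IsAlgClosed.instInfinite
  obtain ⟨g, hg⟩ := hCA
  obtain ⟨g', hg'⟩ := hSB
  rw [St6.locA, St6.locB] at hdisj
  rw [St6.locA] at hg
  rw [St6.locB] at hg'
  have hSA := St6.spnA hg
  have hSB := St6.spnB hg'
  have hGA : St6.Gen (colSpace A₁) := St6.gen_cone hg hSA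
    (fun M hM h => St6.no_sub_quartic M (by omega) h)
  have hGB : St6.Gen (rowSpace B₁) := St6.gen_cone hg' hSB
    (fun M hM h => St6.no_sub_scroll M (by omega) h)
  obtain ⟨φ, hφ, hK⟩ := St6.exists_five hg
  have hstar : St6.Star (colSpace A₁) := St6.star_of hVA hGA φ hφ hK
  obtain ⟨x, m0, m1, m2, hall⟩ := St6.normalB hVB hGB hSB
  by_contra hcard
  -- seven points
  have h7 : Fintype.card (Fin 7) ≤ hfin.toFinset.card := by
    rw [← Set.ncard_eq_toFinset_card _ hfin, Fintype.card_fin]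
    omega
  obtain ⟨z, hz⟩ : ∃ z : Fin 7 → gammaSet A₁ B₁, Function.Injective z := by
    have : Fintype.card (Fin 7) ≤ Fintype.card hfin.toFinset := by
      rw [Fintype.card_coe]; exact h7
    obtain ⟨e⟩ := Function.Embedding.nonempty_of_card_le this
    exact ⟨fun i => ⟨(e i).1, hfin.mem_toFinset.1 (e i).2⟩, fun i j hij => e.injective
      (Subtype.ext (congrArg (fun y : gammaSet A₁ B₁ => y.1) hij))⟩
  have hL : ∀ ω ∈ coneZ (rowSpace B₁), ω ∈ Submodule.span k (Set.range (St6.gens x)) := by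
    rintro ω ⟨q, hq, rfl⟩
    obtain ⟨a, b, c, rfl⟩ := hall q hq
    exact St6.om_mem_span x a b c
  have hpt : ∀ i, ∃ p : colSpace A₁, ∃ h : St6.om p.1 ≠ 0,
      (z i).1 = Projectivization.mk k (St6.om p.1) h ∧
      St6.om p.1 ∈ Submodule.span k (Set.range (St6.gens x)) := by
    intro i
    obtain ⟨ω, hω, h1, ⟨p, hp, rfl⟩, h3⟩ := (z i).2
    exact ⟨⟨p, hp⟩, hω, h1, hL _ h3⟩
  choose p hp0 hpz hpL using hpt
  let b : colSpace A₁ →ₗ[k] colSpace A₁ →ₗ[k] ExteriorAlgebra k (Fin 5 → k) :=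
    (St6.bil k).compl₁₂ (colSpace A₁).subtype (colSpace A₁).subtype
  have hb : ∀ q, b q q = St6.om q.1 := fun q => rfl
  haveI : FiniteDimensional k (Submodule.span k (Set.range (St6.gens x))) :=
    FiniteDimensional.span_of_finite k (Set.finite_range _)
  have hfr : Module.finrank k (Submodule.span k (Set.range (St6.gens x))) ≤ 6 := by
    have := finrank_range_le_card (R := k) (b := St6.gens x)
    simpa [Set.finrank] using this
  obtain ⟨I, f, hI, hfL, hfI⟩ := St6.castelnuovo b (Submodule.span k (Set.range (St6.gens x)))
    hstar hfr p
    (by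
      intro i j hij
      by_contra hc
      apply hij
      apply hz
      apply Subtype.ext
      rw [hpz, hpz]
      exact St6.dep_om _ _ _ _ hc)
    hpL
  -- the members of the family are nonzero
  have hf0 : ∀ t ∈ I, f t ≠ 0 := by
    intro t ht h0
    obtain ⟨s, hs, hst⟩ := (hI.diff (Set.finite_singleton t)).nonempty
    have := (hfI t ht s hs (fun h => hst h.symm) 1 0 (by simp [h0])).1
    simp at this
  have hom : ∀ t ∈ I, St6.om (f t).1 ≠ 0 := fun t ht => St6.star_ne hstar _ (hf0 t ht)
  have hI2 : ∀ t ∈ I, ∀ s ∈ I, t ≠ s → St6.I2 (k := k) (f t).1 (f s).1 := by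
    intro t ht s hs hts c d hcd
    exact hfI t ht s hs hts c d (Subtype.ext hcd)
  let P : Set k := {t ∈ I | St6.om (f t).1 ∉ coneZ (rowSpace B₁)}
  have hP : P.Subsingleton := by
    rintro t ⟨ht, ht'⟩ s ⟨hs, hs'⟩
    by_contra hts
    have c1 := (St6.om_cases x m0 m1 m2 _ (hfL t ht) (hom t ht)).resolve_left ht'
    have c2 := (St6.om_cases x m0 m1 m2 _ (hfL s hs) (hom s hs)).resolve_left hs'
    exact St6.pi_point hVA hSA hSB hdisj x hall _ _ (f t).2 (f s).2 (hI2 t ht s hs hts) c1 c2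
  have hJ : (I \ P).Infinite := hI.diff hP.finite
  let F : ↥(I \ P) → Projectivization k (ExteriorAlgebra k (Fin 5 → k)) := fun t =>
    Projectivization.mk k (St6.om (f t.1).1) (hom t.1 t.2.1)
  have hF : Function.Injective F := by
    rintro ⟨t, ht⟩ ⟨s, hs⟩ hts
    by_contra hne
    have hne' : t ≠ s := fun h => hne (Subtype.ext h)
    obtain ⟨c, hc⟩ := (Projectivization.mk_eq_mk_iff' k _ _ _ _).1 hts
    exact St6.star_inj hstar _ _ c (hfI t ht.1 s hs.1 hne') hc.symm
  haveI := hJ.to_subtype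
  refine (Set.infinite_range_of_injective hF) (hfin.subset ?_)
  rintro _ ⟨⟨t, ht⟩, rfl⟩
  refine ⟨St6.om (f t).1, hom t ht.1, rfl, ⟨(f t).1, (f t).2, rfl⟩, ?_⟩
  by_contra hc
  exact ht.2 ⟨ht.1, hc⟩
end

section
/- Let k be a field, V = k⁵, A₁ a 2×4 matrix and B₁ a 3×2 matrix with entries in V, and let Φ be the linear map Φ(A₂,B₂) = B₁∘A₂ + B₂∘A₁ from pairs of a 2×4 matrix A₂ and a 3×2 matrix B₂ with entries in ⋀²V to 3×4 matrices with entries in ⋀³V (products via exterior multiplication). Suppose x ∈ k⁴ and y ∈ k³ are such that the two vectors a_m = Σ_j A₁(m,j)x_j (m = 1,2) and the two vectors b_n = Σ_i y_i B₁(i,n) (n = 1,2) span the same 2-dimensional subspace of V. Then the linear functional on 3×4 matrices P with entries in ⋀³V defined by P ↦ Σ_{i,j} y_i x_j (P(i,j) ∧ a₁ ∧ a₂) ∈ ⋀⁵V vanishes identically on the image of Φ. -/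
/-!
STATEMENT 12: Let `k` be a field, `V = k⁵`, `A₁` a 2×4 matrix and `B₁` a 3×2 matrix with
entries in `V`, and let `Φ` be the linear map `Φ(A₂,B₂) = B₁∘A₂ + B₂∘A₁` (entrywise
exterior products).  Suppose `x ∈ k⁴`, `y ∈ k³` are such that the two vectors
`aₘ = Σⱼ A₁(m,j) xⱼ` and the two vectors `bₙ = Σᵢ yᵢ B₁(i,n)` span the same 2-dimensional
subspace of `V`.  Then the linear functional `P ↦ Σᵢⱼ yᵢ xⱼ (P(i,j) ∧ a₁ ∧ a₂) ∈ ⋀⁵V`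
vanishes identically on the image of `Φ`.

We work inside the exterior algebra `ExteriorAlgebra k V`; the wedge product is the algebra
multiplication, and `⋀[k]^i V` is the `i`-th exterior power, a submodule of the exterior
algebra.  Since the functional is linear and `Φ` is linear, vanishing on the image of `Φ`
is expressed by the vanishing of the functional on `Φ(A₂,B₂)` for every input `(A₂,B₂)`
(matrices with entries in `⋀²V`).
-/

open ExteriorAlgebra

theorem aux_comm {k V : Type*} [Field k] [AddCommGroup V] [Module k V] (v : V)
    (z : ExteriorAlgebra k V) (hz : z ∈ ⋀[k]^2 V) : ι k v * z = z * ι k v := by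
  have anti : ∀ p q : V, ι k p * ι k q = - (ι k q * ι k p) := fun p q =>
    eq_neg_of_add_eq_zero_left (ExteriorAlgebra.ι_add_mul_swap p q)
  have hz' : z ∈ LinearMap.range (ι k (M := V)) * LinearMap.range (ι k (M := V)) := by
    rw [← pow_two]; exact hz
  induction hz' using Submodule.mul_induction_on' with
  | mem_mul_mem p hp q hq =>
    obtain ⟨p, rfl⟩ := hp
    obtain ⟨q, rfl⟩ := hq
    rw [← mul_assoc, anti v p, neg_mul, mul_assoc, anti v q, mul_neg, neg_neg, mul_assoc]
  | add p hp q hq h1 h2 =>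
    rw [mul_add, add_mul, h1 (by simpa [pow_two] using hp), h2 (by simpa [pow_two] using hq)]

theorem aux_zero {k V : Type*} [Field k] [AddCommGroup V] [Module k V] (a : Fin 2 → V) (v : V)
    (hv : v ∈ Submodule.span k (Set.range a)) : ι k v * (ι k (a 0) * ι k (a 1)) = 0 := by
  induction hv using Submodule.span_induction with
  | mem u hu =>
    obtain ⟨i, rfl⟩ := hu
    fin_cases i
    · simp [← mul_assoc]
    · have h := ExteriorAlgebra.ι_add_mul_swap (R := k) (a 1) (a 0)
      simp only [Fin.mk_one]
      rw [← mul_assoc, eq_neg_of_add_eq_zero_left h, neg_mul, mul_assoc]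
      simp
  | zero => simp
  | add p q _ _ h1 h2 => rw [map_add, add_mul, h1, h2, add_zero]
  | smul c p _ h => rw [map_smul, smul_mul_assoc, h, smul_zero]

theorem stmt12 (k : Type*) [Field k]
    (V : Type*) [AddCommGroup V] [Module k V] (hV : Module.finrank k V = 5)
    (A₁ : Matrix (Fin 2) (Fin 4) V) (B₁ : Matrix (Fin 3) (Fin 2) V)
    (x : Fin 4 → k) (y : Fin 3 → k)
    (a : Fin 2 → V) (b : Fin 2 → V)
    (ha : ∀ m, a m = ∑ j, x j • A₁ m j)
    (hb : ∀ n, b n = ∑ i, y i • B₁ i n)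
    (hspan : Submodule.span k (Set.range a) = Submodule.span k (Set.range b))
    (hdim : Module.finrank k (Submodule.span k (Set.range a)) = 2)
    (A₂ : Matrix (Fin 2) (Fin 4) (ExteriorAlgebra k V))
    (B₂ : Matrix (Fin 3) (Fin 2) (ExteriorAlgebra k V))
    (hA₂ : ∀ m j, A₂ m j ∈ ⋀[k]^2 V) (hB₂ : ∀ i n, B₂ i n ∈ ⋀[k]^2 V) :
    ∑ i : Fin 3, ∑ j : Fin 4, (y i * x j) •
      (((∑ m : Fin 2, ι k (B₁ i m) * A₂ m j) + ∑ n : Fin 2, B₂ i n * ι k (A₁ n j))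
        * ι k (a 0) * ι k (a 1)) = 0 := by
  have h0 : ∀ n, ι k (a n) * (ι k (a 0) * ι k (a 1)) = 0 := fun n =>
    aux_zero a _ (Submodule.subset_span ⟨n, rfl⟩)
  have h1 : ∀ n, ι k (b n) * (ι k (a 0) * ι k (a 1)) = 0 := fun n =>
    aux_zero a _ (by rw [hspan]; exact Submodule.subset_span ⟨n, rfl⟩)
  simp only [mul_assoc _ (ι k (a 0)) (ι k (a 1))]
  generalize ι k (a 0) * ι k (a 1) = w at h0 h1
  have key : ∑ i : Fin 3, ∑ j : Fin 4, (y i * x j) •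
      (((∑ m : Fin 2, ι k (B₁ i m) * A₂ m j) + ∑ n : Fin 2, B₂ i n * ι k (A₁ n j)) * w)
      = (∑ j, ∑ m, x j • (A₂ m j * (ι k (b m) * w)))
        + ∑ i, ∑ n, y i • (B₂ i n * (ι k (a n) * w)) := by
    have e : ∀ i m j, ι k (B₁ i m) * A₂ m j = A₂ m j * ι k (B₁ i m) := fun i m j =>
      aux_comm _ _ (hA₂ m j)
    simp only [e, ha, hb, map_sum, map_smul, Finset.sum_mul, Finset.mul_sum, smul_mul_assoc,
      mul_smul_comm, add_mul, smul_add, Finset.sum_add_distrib, Finset.smul_sum, smul_smul,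
      mul_assoc]
    congr 1
    · rw [Finset.sum_comm]
      refine Finset.sum_congr rfl fun j _ => ?_
      rw [Finset.sum_comm]
      simp only [mul_comm]
    · refine Finset.sum_congr rfl fun i _ => ?_
      rw [Finset.sum_comm]
  rw [key]
  simp [h0, h1]
end

section
/- Let k be a field, V = k⁵, A₁ a 2×4 matrix and B₁ a 3×2 matrix with entries in V, and let Φ be the linear map Φ(A₂,B₂) = B₁∘A₂ + B₂∘A₁ from pairs of a 2×4 matrix A₂ and a 3×2 matrix B₂ with entries in ⋀²V to 3×4 matrices with entries in ⋀³V. Suppose there exist x⁽¹⁾,…,x⁽ʳ⁾ ∈ k⁴ and y⁽¹⁾,…,y⁽ʳ⁾ ∈ k³ such that for each s the vectors a_m^{(s)} = Σ_j A₁(m,j)x_j^{(s)} and b_n^{(s)} = Σ_i y_i^{(s)} B₁(i,n) span the same 2-dimensional subspace of V, and such that the wedge products ω_s = a₁^{(s)} ∧ a₂^{(s)} are linearly independent in ⋀²V. Then the rank of Φ is at most 120 − r. -/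
open ExteriorAlgebra

theorem nondeg {k V : Type*} [Field k] [AddCommGroup V] [Module k V]
    (e : Module.Basis (Fin 5) k V) (w : ExteriorAlgebra k V) (hw : w ∈ ⋀[k]^2 V)
    (h : ∀ c ∈ ⋀[k]^3 V, e.ExteriorAlgebra.coord Finset.univ (w * c) = 0) : w = 0 := by
  classical
  have key : ∀ s, (e.exteriorPower 2).repr ⟨w, hw⟩ s = 0 := by
    intro s
    let t : Set.powersetCard (Fin 5) 3 := ⟨(s.val)ᶜ, by
      have := s.2
      simp only [Set.powersetCard, Set.mem_ofPred_eq] at this ⊢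
      rw [Finset.card_compl, Fintype.card_fin]
      omega⟩
    have h1 := h (exteriorPower.ιMulti_family k 3 e t) (exteriorPower.ιMulti_family k 3 e t).2
    have h2 : w = ∑ s', (e.exteriorPower 2).repr ⟨w, hw⟩ s' • ExteriorAlgebra.ιMulti_family k 2 e s' := by
      have := congrArg (Subtype.val) ((e.exteriorPower 2).sum_repr ⟨w, hw⟩)
      simpa using this.symm
    rw [h2, Finset.sum_mul, Finset.sum_eq_single s] at h1
    · have hd : Disjoint s.val t.val := disjoint_compl_right
      rw [exteriorPower.ιMulti_family_apply_coe, smul_mul_assoc,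
        ιMulti_family_mul_of_disjoint k e s t hd, ← basis_apply_powersetCard] at h1
      have hu : (Set.powersetCard.disjUnion hd).val = Finset.univ := by
        simp [t]
      rw [hu] at h1
      rcases Int.units_eq_one_or (Set.powersetCard.permOfDisjoint hd).sign with hs | hs <;>
        simpa [hs] using h1
    · intro s' _ hne
      rw [exteriorPower.ιMulti_family_apply_coe, smul_mul_assoc,
        ιMulti_family_mul_of_not_disjoint, smul_zero]
      intro hd
      apply hne
      have : s'.val ≤ s.val := disjoint_compl_right_iff.mp hd
      apply Subtype.ext
      exact Finset.eq_of_subset_of_card_le this (le_of_eq (s.2.trans s'.2.symm))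
    · simp
  have h0 : (⟨w, hw⟩ : ⋀[k]^2 V) = 0 := (e.exteriorPower 2).ext_elem (by simpa using key)
  exact congrArg Subtype.val h0

/-- The product of three vectors in the span of two vectors vanishes. -/
theorem mul3 {k V : Type*} [Field k] [AddCommGroup V] [Module k V] (a : Fin 2 → V) (v : V)
    (hv : v ∈ Submodule.span k (Set.range a)) : ι k (a 0) * ι k (a 1) * ι k v = 0 := by
  induction hv using Submodule.span_induction with
  | mem x hx =>
    obtain ⟨i, rfl⟩ := hx
    fin_cases i
    · have := ι_add_mul_swap (R := k) (a 1) (a 0)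
      simp only [Fin.zero_eta]
      rw [mul_assoc, eq_neg_of_add_eq_zero_left this, mul_neg, ← mul_assoc, ι_sq_zero]; simp
    · simp only [Fin.mk_one]
      rw [mul_assoc, ι_sq_zero, mul_zero]
  | zero => simp
  | add x y _ _ hx hy => rw [map_add, mul_add, hx, hy, add_zero]
  | smul c x _ hx => rw [map_smul, mul_smul_comm, hx, smul_zero]

/-- Vectors commute with bivectors. -/
theorem comm2 {k V : Type*} [Field k] [AddCommGroup V] [Module k V] (v : V)
    (w : ExteriorAlgebra k V) (hw : w ∈ ⋀[k]^2 V) : w * ι k v = ι k v * w := by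
  rw [← ιMulti_span_fixedDegree] at hw
  induction hw using Submodule.span_induction with
  | mem x hx =>
    obtain ⟨u, rfl⟩ := hx
    simp only [ιMulti_succ_apply, ιMulti_zero_apply, mul_one]
    rw [mul_assoc, eq_neg_of_add_eq_zero_left (ι_add_mul_swap _ v), mul_neg, ← mul_assoc,
      eq_neg_of_add_eq_zero_left (ι_add_mul_swap _ v), neg_mul, neg_neg, mul_assoc]
  | zero => simp
  | add x y _ _ hx hy => rw [add_mul, mul_add, hx, hy]
  | smul c x _ hx => rw [mul_smul_comm, smul_mul_assoc, hx]

theorem stmt13 (k : Type*) [Field k]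
    (V : Type*) [AddCommGroup V] [Module k V] (hV : Module.finrank k V = 5)
    (A₁ : Matrix (Fin 2) (Fin 4) V) (B₁ : Matrix (Fin 3) (Fin 2) V)
    (Φ : (Matrix (Fin 2) (Fin 4) ↥(⋀[k]^2 V) × Matrix (Fin 3) (Fin 2) ↥(⋀[k]^2 V))
          →ₗ[k] Matrix (Fin 3) (Fin 4) (ExteriorAlgebra k V))
    (hΦ : ∀ (A₂ : Matrix (Fin 2) (Fin 4) ↥(⋀[k]^2 V))
          (B₂ : Matrix (Fin 3) (Fin 2) ↥(⋀[k]^2 V)) (i : Fin 3) (j : Fin 4),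
        Φ (A₂, B₂) i j = (∑ m : Fin 2, ι k (B₁ i m) * (A₂ m j : ExteriorAlgebra k V))
          + ∑ n : Fin 2, (B₂ i n : ExteriorAlgebra k V) * ι k (A₁ n j))
    (r : ℕ) (x : Fin r → Fin 4 → k) (y : Fin r → Fin 3 → k)
    (a : Fin r → Fin 2 → V) (b : Fin r → Fin 2 → V)
    (ha : ∀ s m, a s m = ∑ j, x s j • A₁ m j)
    (hb : ∀ s n, b s n = ∑ i, y s i • B₁ i n)
    (hspan : ∀ s, Submodule.span k (Set.range (a s)) = Submodule.span k (Set.range (b s)))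
    (hdim : ∀ s, Module.finrank k (Submodule.span k (Set.range (a s))) = 2)
    (hindep : LinearIndependent k (fun s : Fin r => ι k (a s 0) * ι k (a s 1))) :
    Module.finrank k (LinearMap.range Φ) ≤ 120 - r := by
  classical
  have : Module.Finite k V := Module.finite_of_finrank_pos (by omega)
  let e : Module.Basis (Fin 5) k V := Module.finBasisOfFinrankEq k V hV
  set φ := e.ExteriorAlgebra.coord Finset.univ with hφ
  set ω : Fin r → ExteriorAlgebra k V := fun s => ι k (a s 0) * ι k (a s 1) with hω
  have hωmem : ∀ s, ω s ∈ ⋀[k]^2 V := by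
    intro s
    rw [← ιMulti_span_fixedDegree]
    refine Submodule.subset_span ⟨a s, ?_⟩
    simp only [ιMulti_succ_apply, ιMulti_zero_apply, mul_one, hω]
    rfl
  -- vanishing
  have hωa : ∀ s v, v ∈ Submodule.span k (Set.range (a s)) → ω s * ι k v = 0 :=
    fun s v hv => mul3 (a s) v hv
  have hBsum : ∀ s m, ∑ i, y s i • (ω s * ι k (B₁ i m)) = 0 := by
    intro s m
    have h1 := hωa s (b s m) (by rw [hspan s]; exact Submodule.subset_span ⟨m, rfl⟩)
    rw [hb, map_sum, Finset.mul_sum] at h1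
    simpa only [map_smul, mul_smul_comm] using h1
  have hAsum : ∀ s m, ∑ j, x s j • (ω s * ι k (A₁ m j)) = 0 := by
    intro s m
    have h1 := hωa s (a s m) (Submodule.subset_span ⟨m, rfl⟩)
    rw [ha s m, map_sum, Finset.mul_sum] at h1
    simpa only [map_smul, mul_smul_comm] using h1
  have hvan : ∀ s A₂ B₂, ∑ i, ∑ j, (y s i * x s j) • (ω s * Φ (A₂, B₂) i j) = 0 := by
    intro s A₂ B₂
    simp only [hΦ, mul_add, smul_add, Finset.sum_add_distrib]
    have h1 : ∑ i, ∑ j, (y s i * x s j) •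
        (ω s * ∑ m, ι k (B₁ i m) * (A₂ m j : ExteriorAlgebra k V)) = 0 := by
      rw [Finset.sum_comm]
      refine Finset.sum_eq_zero fun j _ => ?_
      simp only [Finset.mul_sum, Finset.smul_sum]
      rw [Finset.sum_comm]
      refine Finset.sum_eq_zero fun m _ => ?_
      have h2 := congrArg (fun z => x s j • (z * (A₂ m j : ExteriorAlgebra k V))) (hBsum s m)
      simp only [Finset.sum_mul, Finset.smul_sum, zero_mul, smul_zero] at h2
      rw [← h2]
      refine Finset.sum_congr rfl fun i _ => ?_
      rw [smul_mul_assoc, smul_smul, mul_comm (y s i), mul_assoc (ω s)]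
    have h2 : ∑ i, ∑ j, (y s i * x s j) •
        (ω s * ∑ n, (B₂ i n : ExteriorAlgebra k V) * ι k (A₁ n j)) = 0 := by
      refine Finset.sum_eq_zero fun i _ => ?_
      simp only [Finset.mul_sum, Finset.smul_sum]
      rw [Finset.sum_comm]
      refine Finset.sum_eq_zero fun n _ => ?_
      have h2 := congrArg (fun z => y s i • (z * (B₂ i n : ExteriorAlgebra k V))) (hAsum s n)
      simp only [Finset.sum_mul, Finset.smul_sum, zero_mul, smul_zero] at h2
      rw [← h2]
      refine Finset.sum_congr rfl fun j _ => ?_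
      rw [smul_mul_assoc, smul_smul, mul_assoc (ω s), comm2 _ _ (B₂ i n).2]
    rw [h1, h2, add_zero]
  -- the functionals
  let L : Fin r → Module.Dual k (Fin 3 → Fin 4 → ↥(⋀[k]^3 V)) := fun s =>
    ∑ i, ∑ j, (y s i * x s j) • (φ ∘ₗ LinearMap.mulLeft k (ω s) ∘ₗ (⋀[k]^3 V).subtype ∘ₗ
      LinearMap.proj j ∘ₗ LinearMap.proj i)
  have hL : ∀ s C, L s C = ∑ i, ∑ j, (y s i * x s j) * φ (ω s * (C i j : ExteriorAlgebra k V)) := by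
    intro s C
    simp [L, LinearMap.sum_apply]
  have hω0 : ∀ s, ω s ≠ 0 := fun s => hindep.ne_zero s
  have hx : ∀ s, ∃ j, x s j ≠ 0 := by
    intro s
    by_contra! hc
    apply hω0 s
    have : a s 0 = 0 := by rw [ha]; simp [hc]
    simp [hω, this]
  have hy : ∀ s, ∃ i, y s i ≠ 0 := by
    intro s
    by_contra! hc
    have h0 : ∀ n, b s n = 0 := by intro n; rw [hb]; simp [hc]
    have h1 := hdim s
    have h2 : b s = fun _ => 0 := funext h0
    rw [hspan s, h2, Set.range_const, Submodule.span_zero_singleton, finrank_bot] at h1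
    omega
  have hLind : LinearIndependent k L := by
    rw [Fintype.linearIndependent_iff]
    intro c hc s
    have hij : ∀ i j, ∑ s, (c s * (y s i * x s j)) • ω s = 0 := by
      intro i j
      apply nondeg e
      · exact Submodule.sum_mem _ fun s _ => Submodule.smul_mem _ _ (hωmem s)
      · intro η hη
        have h1 := LinearMap.congr_fun hc (Pi.single i (Pi.single j ⟨η, hη⟩))
        rw [LinearMap.sum_apply] at h1
        simp only [LinearMap.smul_apply, hL, LinearMap.zero_apply] at h1
        rw [← hφ, Finset.sum_mul, map_sum, ← h1]
        refine Finset.sum_congr rfl fun s _ => ?_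
        rw [Finset.sum_eq_single i, Finset.sum_eq_single j]
        · simp [mul_assoc]
        · intro j' _ hj'
          simp [Pi.single_eq_of_ne hj']
        · simp
        · intro i' _ hi'
          simp [Pi.single_eq_of_ne hi']
        · simp
    obtain ⟨i, hi⟩ := hy s
    obtain ⟨j, hj⟩ := hx s
    have h1 := Fintype.linearIndependent_iff.mp hindep _ (hij i j) s
    simpa [hi, hj] using h1
  set S := Submodule.span k (Set.range L) with hS
  have hSr : Module.finrank k S = r := by
    rw [finrank_span_eq_card hLind, Fintype.card_fin]
  have hdimW : Module.finrank k (Fin 3 → Fin 4 → ↥(⋀[k]^3 V)) = 120 := by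
    rw [Module.finrank_pi_fintype, Fin.sum_const, Module.finrank_pi_fintype, Fin.sum_const,
      exteriorPower.finrank_eq, hV]
    rfl
  have hco := Subspace.finrank_add_finrank_dualCoannihilator_eq S
  rw [hSr, hdimW] at hco
  let J : (Fin 3 → Fin 4 → ↥(⋀[k]^3 V)) →ₗ[k] Matrix (Fin 3) (Fin 4) (ExteriorAlgebra k V) :=
    { toFun := fun C i j => (C i j : ExteriorAlgebra k V)
      map_add' := fun _ _ => rfl
      map_smul' := fun _ _ => rfl }
  have hmem : ∀ A₂ B₂ i j, Φ (A₂, B₂) i j ∈ ⋀[k]^3 V := by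
    intro A₂ B₂ i j
    have hv1 : ∀ v : V, ι k v ∈ ⋀[k]^1 V := by
      intro v
      rw [exteriorPower, pow_one]
      exact ⟨v, rfl⟩
    rw [hΦ]
    refine Submodule.add_mem _ (Submodule.sum_mem _ fun m _ => ?_)
      (Submodule.sum_mem _ fun n _ => ?_)
    · exact SetLike.mul_mem_graded (A := fun i : ℕ => ⋀[k]^i V) (hv1 _) (A₂ m j).2
    · exact SetLike.mul_mem_graded (A := fun i : ℕ => ⋀[k]^i V) (B₂ i n).2 (hv1 _)
  have hle : LinearMap.range Φ ≤ S.dualCoannihilator.map J := by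
    rintro _ ⟨⟨A₂, B₂⟩, rfl⟩
    refine ⟨fun i j => ⟨Φ (A₂, B₂) i j, hmem A₂ B₂ i j⟩, ?_, rfl⟩
    rw [SetLike.mem_coe, Submodule.mem_dualCoannihilator]
    intro f hf
    induction hf using Submodule.span_induction with
    | mem f hf =>
      obtain ⟨s, rfl⟩ := hf
      rw [hL]
      have h1 := congrArg φ (hvan s A₂ B₂)
      simpa only [map_sum, map_smul, smul_eq_mul, map_zero] using h1
    | zero => rfl
    | add f g _ _ hf hg => rw [LinearMap.add_apply, hf, hg, add_zero]
    | smul c f _ hf => rw [LinearMap.smul_apply, hf, smul_zero]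
  have h1 := Submodule.finrank_mono hle
  have h2 := Submodule.finrank_map_le J S.dualCoannihilator
  omega
end

section
/- Let k be algebraically closed, V ≅ k⁵, and let A₁ (2×4) and B₁ (3×2) be matrices with entries in V such that the rank-1 locus C_A of A₁ in P(V*) is a smooth rational normal quartic curve and the rank-1 locus S_B of B₁ is a rational cubic surface scroll. If Z_A ∩ Z_B is finite and contains four points that lie on a common line both in P(V_A) and in P(V_B), then C_A and S_B intersect. -/
/-!
Common setup (k algebraically closed, `V = k⁵`, matrices `A₁` (2×4) and `B₁` (3×2) with
entries in `V`):

* A dual vector is represented by `φ : Fin 5 → k`, acting on `v : V` by `Σ l, φ l * v l`;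
  `rankOneLocus A` is the (affine cone, minus 0, over the) locus in `P(V*)` where the
  matrix `A` has rank 1.
* `C_A` is a smooth rational normal quartic curve iff its cone is the image of the cone over
  the standard quartic `(s:t) ↦ (s⁴, s³t, s²t², st³, t⁴)` under a linear automorphism;
  similarly `S_B` is a (smooth) rational cubic surface scroll iff its cone is the image of
  the cone over the standard scroll `S(1,2)`, `(a,b;s:t) ↦ (as, at, bs², bst, bt²)`.
  (Over an algebraically closed field the parametrized sets are the full affine cones.)
* `V_A` is the span of the 4 columns of `A₁` in `V ⊕ V`, `V_B` the span of the 3 rows of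
  `B₁`; the double (Veronese) embeddings into `P(⋀²V)` have as affine cones the sets
  `coneZ V_A`, `coneZ V_B` of wedges `v₁ ∧ v₂` with `(v₁,v₂)` in `V_A` resp. `V_B`
  (computed in the exterior algebra).  `gammaSet` is the set `Z_A ∩ Z_B` of common points,
  a subset of the projectivization of the exterior algebra.
-/

open ExteriorAlgebra

lemma wedge_ne_zero {k : Type*} [Field k] {V : Type*} [AddCommGroup V] [Module k V] {n : ℕ}
    (v : Fin n → V) (hv : LinearIndependent k v) : ιMulti k n v ≠ 0 := by
  classical
  obtain ⟨f, hf⟩ := LinearMap.exists_extend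
    ((Module.Basis.span hv).constr k (fun i : Fin n => (Pi.single i (1 : k) : Fin n → k)))
  have hfv : ∀ i, f (v i) = Pi.single i (1 : k) := by
    intro i
    have := LinearMap.congr_fun hf ((Module.Basis.span hv) i)
    rw [Module.Basis.constr_basis] at this
    rw [← this]
    simp [Module.Basis.span_apply]
  intro h0
  let D : V [⋀^Fin n]→ₗ[k] k :=
    (Matrix.detRowAlternating (R := k) (n := Fin n)).compLinearMap f
  have h1 := liftAlternating_apply_ιMulti (R := k) (fun i => if h : i = n then h ▸ D else 0) v
  rw [h0, map_zero] at h1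
  simp only [dite_true] at h1
  have h2 : D v = 1 := by
    have : (fun i => f (v i)) = (1 : Matrix (Fin n) (Fin n) k) := by
      ext i j
      rw [hfv, Matrix.one_apply, Pi.single_apply]
      simp [eq_comm]
    change Matrix.det (fun i => f (v i)) = 1
    rw [this, Matrix.det_one]
  rw [h2] at h1
  exact zero_ne_one h1

lemma exists_compl_family {k : Type*} [Field k] {E : Type*} [AddCommGroup E] [Module k E]
    [FiniteDimensional k E] (L W : Submodule k E) (h : L ≤ W) (n : ℕ)
    (hn : Module.finrank k W = Module.finrank k L + n) :
    ∃ c : Fin n → E, W ≤ L ⊔ Submodule.span k (Set.range c) := by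
  obtain ⟨C, hC⟩ := Submodule.exists_isCompl (L.comap W.subtype)
  have h1 : Module.finrank k (L.comap W.subtype) = Module.finrank k L :=
    (Submodule.comapSubtypeEquivOfLe h).finrank_eq
  have h2 := Submodule.finrank_add_eq_of_isCompl hC
  have h3 : Module.finrank k C = n := by omega
  let b := Module.finBasisOfFinrankEq k C h3
  refine ⟨fun i => ((b i : W) : E), ?_⟩
  intro w hw
  have hw' : (⟨w, hw⟩ : W) ∈ L.comap W.subtype ⊔ C := by
    rw [hC.sup_eq_top]; trivial
  obtain ⟨l, hl, c, hc, hlc⟩ := Submodule.mem_sup.1 hw'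
  have : w = (l : E) + (c : E) := by
    have := congrArg Subtype.val hlc
    simpa using this.symm
  rw [this]
  refine Submodule.add_mem_sup hl ?_
  have e := congrArg (fun x : C => ((x : W) : E)) (b.sum_repr ⟨c, hc⟩)
  simp only [AddSubmonoidClass.coe_finsetSum, Submodule.coe_smul] at e
  rw [← e]
  exact Submodule.sum_mem _ fun i _ =>
    Submodule.smul_mem _ _ (Submodule.subset_span ⟨i, rfl⟩)

lemma exists_quadratic_zero {k : Type*} [Field k] [IsAlgClosed k] (a b c : k) :
    ∃ s t : k, (s ≠ 0 ∨ t ≠ 0) ∧ a * s ^ 2 + b * (s * t) + c * t ^ 2 = 0 := by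
  by_cases ha : a = 0
  · exact ⟨1, 0, by simp, by simp [ha]⟩
  · obtain ⟨x, hx⟩ := IsAlgClosed.exists_root
      (Polynomial.C a * Polynomial.X ^ 2 + Polynomial.C b * Polynomial.X + Polynomial.C c)
      (by rw [Polynomial.degree_quadratic ha]; decide)
    refine ⟨x, 1, by simp, ?_⟩
    simpa [Polynomial.IsRoot] using hx

lemma rank_one_of {k : Type*} [Field k] {n : ℕ} (M : Matrix (Fin 2) (Fin n) k) (hM : M ≠ 0)
    (σ τ : k) (hst : σ ≠ 0 ∨ τ ≠ 0) (h : ∀ j, σ * M 0 j + τ * M 1 j = 0) : M.rank = 1 := by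
  apply le_antisymm
  · rcases hst with h0 | h0
    · have : M = Matrix.vecMulVec ![-τ / σ, 1] (M 1) := by
        ext i j
        fin_cases i
        · have := h j
          simp [Matrix.vecMulVec_apply]
          field_simp
          linear_combination this
        · simp [Matrix.vecMulVec_apply]
      rw [this]; exact Matrix.rank_vecMulVec_le _ _
    · have : M = Matrix.vecMulVec ![1, -σ / τ] (M 0) := by
        ext i j
        fin_cases i
        · simp [Matrix.vecMulVec_apply]
        · have := h j
          simp [Matrix.vecMulVec_apply]
          field_simp
          linear_combination this
      rw [this]; exact Matrix.rank_vecMulVec_le _ _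
  · rw [Nat.one_le_iff_ne_zero]
    intro h0
    apply hM
    rw [Matrix.rank, Submodule.finrank_eq_zero, LinearMap.range_eq_bot] at h0
    ext i j
    have := congrFun (LinearMap.congr_fun h0 (Pi.single j 1)) i
    simpa using this

lemma cone_translate {k : Type*} [Field k] {m n : ℕ} (A : Matrix (Fin m) (Fin n) (Fin 5 → k))
    (φ : Fin 5 → k) (h : ∀ i j, ∑ l, φ l * A i j l = 0) (g : (Fin 5 → k) ≃ₗ[k] (Fin 5 → k))
    (S : Set (Fin 5 → k)) (hS : rankOneLocus A ∪ {0} = g '' S)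
    (w : Fin 5 → k) (hw : w ∈ S) (hw0 : w ≠ 0) : w + g.symm φ ∈ S := by
  have h1 : g w ∈ rankOneLocus A ∪ {0} := by rw [hS]; exact ⟨w, hw, rfl⟩
  have h2 : g w ∈ rankOneLocus A := by
    rcases h1 with h1 | h1
    · exact h1
    · exact absurd (by simpa using h1) hw0
  have h3 : g w + φ ∈ rankOneLocus A := by
    unfold rankOneLocus at h2 ⊢
    simp only [Set.mem_ofPred_eq] at h2 ⊢
    rw [← h2]
    congr 1
    ext i j
    simp [add_mul, Finset.sum_add_distrib, h i j]
  have h4 : g w + φ ∈ g '' S := by rw [← hS]; exact Or.inl h3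
  obtain ⟨u, hu, hgu⟩ := h4
  have : u = w + g.symm φ := by
    apply g.injective; rw [hgu]; simp
  rwa [← this]

lemma quartic_zero {k : Type*} [Field k] (A : Matrix (Fin 2) (Fin 4) (Fin 5 → k))
    (hA : IsRNQuartic A) (φ : Fin 5 → k) (h : ∀ i j, ∑ l, φ l * A i j l = 0) : φ = 0 := by
  obtain ⟨g, hg⟩ := hA
  set y := g.symm φ with hy
  have key : ∀ w ∈ coneQuartic k, w 0 * w 2 = w 1 ^ 2 ∧ w 2 * w 4 = w 3 ^ 2 ∧
      w 0 * w 3 = w 1 * w 2 ∧ w 0 * w 4 = w 2 ^ 2 ∧ w 0 * w 4 = w 1 * w 3 := by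
    rintro w ⟨s, t, rfl⟩
    simp
    refine ⟨?_, ?_, ?_, ?_, ?_⟩ <;> ring
  have tr := fun w hw hw0 => key _ (cone_translate A φ h g _ hg w hw hw0)
  have e0 := tr ![1, 0, 0, 0, 0] ⟨1, 0, by simp⟩ (fun h => by simpa using congrFun h 0)
  have e4 := tr ![0, 0, 0, 0, 1] ⟨0, 1, by simp⟩ (fun h => by simpa using congrFun h 4)
  have e1 := tr ![1, 1, 1, 1, 1] ⟨1, 1, by simp⟩ (fun h => by simpa using congrFun h 4)
  rw [← hy] at e0 e4 e1
  simp at e0 e4 e1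
  obtain ⟨a1, a2, a3, a4, a5⟩ := e0
  obtain ⟨b1, b2, b3, b4, b5⟩ := e4
  obtain ⟨c1, c2, c3, c4, c5⟩ := e1
  have y2 : y 2 = 0 := by linear_combination a1 - b1
  have y1 : y 1 = 0 := by
    rw [y2] at b1; simpa using b1.symm
  have y3 : y 3 = 0 := by linear_combination a3 - b3
  have y0 : y 0 = 0 := by rw [y1, y2] at c1; linear_combination c1
  have y4 : y 4 = 0 := by rw [y2, y3] at c2; linear_combination c2
  have : y = 0 := by
    ext i; fin_cases i <;> simp [y0, y1, y2, y3, y4]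
  simpa [hy] using this

lemma scroll_zero {k : Type*} [Field k] (A : Matrix (Fin 3) (Fin 2) (Fin 5 → k))
    (hA : IsCubicScroll A) (φ : Fin 5 → k) (h : ∀ i j, ∑ l, φ l * A i j l = 0) : φ = 0 := by
  obtain ⟨g, hg⟩ := hA
  set y := g.symm φ with hy
  have key : ∀ w ∈ coneScroll k, w 0 * w 3 = w 1 * w 2 ∧ w 0 * w 4 = w 1 * w 3 ∧
      w 2 * w 4 = w 3 ^ 2 := by
    rintro w ⟨a, b, s, t, rfl⟩
    simp
    refine ⟨?_, ?_, ?_⟩ <;> ring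
  have tr := fun w hw hw0 => key _ (cone_translate A φ h g _ hg w hw hw0)
  have e0 := tr ![1, 0, 0, 0, 0] ⟨1, 0, 1, 0, by simp⟩ (fun h => by simpa using congrFun h 0)
  have e1 := tr ![0, 1, 0, 0, 0] ⟨1, 0, 0, 1, by simp⟩ (fun h => by simpa using congrFun h 1)
  have e2 := tr ![0, 0, 1, 0, 0] ⟨0, 1, 1, 0, by simp⟩ (fun h => by simpa using congrFun h 2)
  have e4 := tr ![0, 0, 0, 0, 1] ⟨0, 1, 0, 1, by simp⟩ (fun h => by simpa using congrFun h 4)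
  rw [← hy] at e0 e1 e2 e4
  simp at e0 e1 e2 e4
  obtain ⟨a1, a2, a3⟩ := e0
  obtain ⟨b1, b2, b3⟩ := e1
  obtain ⟨c1, c2, c3⟩ := e2
  obtain ⟨d1, d2, d3⟩ := e4
  have y3 : y 3 = 0 := by linear_combination a1 - d1
  have y2 : y 2 = 0 := by linear_combination d1 - b1
  have y1 : y 1 = 0 := by linear_combination d1 - c1
  have y4 : y 4 = 0 := by rw [y3] at c3; rw [y2] at c3; linear_combination c3
  have y0 : y 0 = 0 := by rw [y3, y4] at d2; linear_combination d2
  have : y = 0 := by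
    ext i; fin_cases i <;> simp [y0, y1, y2, y3, y4]
  simpa [hy] using this

/-- The wedge of the two components. -/
noncomputable def wd {k : Type*} [Field k] (p : (Fin 5 → k) × (Fin 5 → k)) :
    ExteriorAlgebra k (Fin 5 → k) := ι k p.1 * ι k p.2

/-- The polarization of the wedge. -/
noncomputable def wm {k : Type*} [Field k] (p q : (Fin 5 → k) × (Fin 5 → k)) :
    ExteriorAlgebra k (Fin 5 → k) := ι k p.1 * ι k q.2 + ι k q.1 * ι k p.2

lemma ι_swap {k : Type*} [Field k] (u v : Fin 5 → k) : ι k v * ι k u = -(ι k u * ι k v) :=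
  eq_neg_of_add_eq_zero_left (ι_add_mul_swap v u)

lemma ι_swap' {k : Type*} [Field k] (u v : Fin 5 → k) (x : ExteriorAlgebra k (Fin 5 → k)) :
    ι k v * (ι k u * x) = -(ι k u * (ι k v * x)) := by
  rw [← mul_assoc, ι_swap u v, neg_mul, mul_assoc]

lemma ι_sq' {k : Type*} [Field k] (u : Fin 5 → k) (x : ExteriorAlgebra k (Fin 5 → k)) :
    ι k u * (ι k u * x) = 0 := by
  rw [← mul_assoc, ι_sq_zero, zero_mul]

lemma wd_comb {k : Type*} [Field k] (p q : (Fin 5 → k) × (Fin 5 → k)) (s t : k) :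
    wd (s • p + t • q) = s ^ 2 • wd p + (s * t) • wm p q + t ^ 2 • wd q := by
  simp only [wd, wm, Prod.fst_add, Prod.snd_add, Prod.smul_fst, Prod.smul_snd, map_add, map_smul,
    add_mul, mul_add, smul_mul_assoc, mul_smul_comm, smul_add]
  module

lemma wd_smul {k : Type*} [Field k] (p : (Fin 5 → k) × (Fin 5 → k)) (s : k) :
    wd (s • p) = s ^ 2 • wd p := by
  have := wd_comb p p s 0
  simpa using this

lemma wm_mul_left {k : Type*} [Field k] (p q : (Fin 5 → k) × (Fin 5 → k)) :
    wm p q * wd p = 0 := by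
  simp only [wd, wm, add_mul, mul_assoc]
  rw [ι_swap' p.1 q.2, mul_neg, ι_sq', ι_swap' p.1 p.2, ι_sq_zero]
  simp

lemma wm_mul_right {k : Type*} [Field k] (p q : (Fin 5 → k) × (Fin 5 → k)) :
    wm p q * wd q = 0 := by
  have : wm p q = wm q p := by simp [wm, add_comm]
  rw [this, wm_mul_left]

lemma wd_sq {k : Type*} [Field k] (p : (Fin 5 → k) × (Fin 5 → k)) :
    wd p * wd p = 0 := by
  simp only [wd, mul_assoc]
  rw [ι_swap' p.1 p.2, mul_neg, ι_sq', neg_zero]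

lemma wd_comm {k : Type*} [Field k] (p q : (Fin 5 → k) × (Fin 5 → k)) :
    wd q * wd p = wd p * wd q := by
  simp only [wd, mul_assoc]
  rw [ι_swap' p.1 q.2, mul_neg, ι_swap' p.1 q.1, ι_swap p.2 q.2, mul_neg, mul_neg,
    ι_swap' p.2 q.1, mul_neg]
  simp

lemma core {k : Type*} [Field k] (a b a' b' : (Fin 5 → k) × (Fin 5 → k)) (c0 c1 c2 : k)
    (h0 : wd a' = c0 • wd a) (h1 : wd b' = c1 • wd b) (hc0 : c0 ≠ 0) (hc1 : c1 ≠ 0)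
    (h2 : wd (a' + b') = c2 • wd (a + b)) (hθ : wd a * wd b ≠ 0) (t : k) :
    wd (a' + t • b') = c0 • wd (a + t • b) := by
  have e1 := wd_comb a b 1 1
  have e2 := wd_comb a' b' 1 1
  simp only [one_smul, one_pow, mul_one] at e1 e2
  rw [e1, e2] at h2
  have hm : wm a' b' = (c2 - c0) • wd a + c2 • wm a b + (c2 - c1) • wd b := by
    rw [h0, h1] at h2
    have h3 : wm a' b' = c2 • (wd a + wm a b + wd b) - c0 • wd a - c1 • wd b := by
      rw [← h2]; abel
    rw [h3]; module
  have ha : wm a' b' * wd a = 0 := by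
    have := wm_mul_left a' b'
    rw [h0, mul_smul_comm] at this
    exact (smul_eq_zero.1 this).resolve_left hc0
  have hb : wm a' b' * wd b = 0 := by
    have := wm_mul_right a' b'
    rw [h1, mul_smul_comm] at this
    exact (smul_eq_zero.1 this).resolve_left hc1
  rw [hm] at ha hb
  simp only [add_mul, smul_mul_assoc, wd_sq, wm_mul_left, wm_mul_right, smul_zero, zero_add,
    add_zero, wd_comm a b, smul_eq_zero, hθ, or_false] at ha hb
  have e3 := wd_comb a b 1 t
  have e4 := wd_comb a' b' 1 t
  simp only [one_smul, one_pow, one_mul] at e3 e4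
  have hc : c1 = c0 := by linear_combination hb - ha
  rw [e3, e4, hm, h0, h1, ha, hb, hc]
  have : c2 = c0 := by linear_combination hb
  rw [this]
  module

lemma wd_inj {k : Type*} [Field k] (a b : (Fin 5 → k) × (Fin 5 → k)) (hθ : wd a * wd b ≠ 0)
    (t u c : k) (h : wd (a + t • b) = c • wd (a + u • b)) : t = u := by
  have e : ∀ t : k, wd (a + t • b) = wd a + t • wm a b + t ^ 2 • wd b := by
    intro t
    have := wd_comb a b 1 t
    simpa using this
  have m1 : ∀ t : k, wd (a + t • b) * wd b = wd a * wd b := by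
    intro t
    rw [e]
    simp [add_mul, wm_mul_right, wd_sq]
  have hc : c = 1 := by
    have := congrArg (· * wd b) h
    simp only [smul_mul_assoc, m1] at this
    have h3 : (c - 1) • (wd a * wd b) = 0 := by
      rw [sub_smul, one_smul, ← this, sub_self]
    have := (smul_eq_zero.1 h3).resolve_right hθ
    linear_combination this
  have m2 : ∀ t : k, ι k a.1 * (wd (a + t • b) * ι k b.2) = -(t • (wd a * wd b)) := by
    intro t
    rw [e]
    simp only [wd, wm, add_mul, mul_add, smul_mul_assoc, mul_smul_comm, mul_assoc, ι_sq',
      ι_sq_zero, mul_zero, smul_zero, add_zero, zero_add, smul_add]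
    rw [ι_swap' a.2 b.1]
    simp
  rw [hc, one_smul] at h
  have := m2 t
  rw [h, m2 u, neg_inj] at this
  have h3 : (u - t) • (wd a * wd b) = 0 := by
    rw [sub_smul, this, sub_self]
  have := (smul_eq_zero.1 h3).resolve_right hθ
  linear_combination -this

lemma line_lemma {k : Type*} [Field k] (p : Fin 4 → (Fin 5 → k) × (Fin 5 → k))
    (hd : ∀ s t, s ≠ t → ∀ c : k, wd (p t) ≠ c • wd (p s))
    (hl : Module.finrank k (Submodule.span k (Set.range p)) ≤ 2) :
    LinearIndependent k ![p 0, p 1] ∧ ∃ α β : k, α ≠ 0 ∧ β ≠ 0 ∧ p 2 = α • p 0 + β • p 1 := by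
  have h0 : p 0 ≠ 0 := by
    intro h
    apply hd 1 0 (by decide) 0
    rw [h]; simp [wd]
  have hli : LinearIndependent k ![p 0, p 1] := by
    rw [LinearIndependent.pair_iff' h0]
    intro c hc
    apply hd 0 1 (by decide) (c ^ 2)
    rw [← hc, wd_smul]
  refine ⟨hli, ?_⟩
  have hle : Submodule.span k (Set.range ![p 0, p 1]) ≤ Submodule.span k (Set.range p) := by
    apply Submodule.span_mono
    rintro _ ⟨i, rfl⟩
    fin_cases i
    · exact ⟨0, rfl⟩
    · exact ⟨1, rfl⟩
  have heq := Submodule.eq_of_le_of_finrank_le hle (by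
    rw [finrank_span_eq_card hli]; simpa using hl)
  have h2 : p 2 ∈ Submodule.span k (Set.range ![p 0, p 1]) := by
    rw [heq]; exact Submodule.subset_span ⟨2, rfl⟩
  rw [Matrix.range_cons, Matrix.range_cons, Matrix.range_empty, Set.union_empty,
    Set.singleton_union, Submodule.mem_span_pair] at h2
  obtain ⟨α, β, h⟩ := h2
  refine ⟨α, β, ?_, ?_, h.symm⟩
  · rintro rfl
    apply hd 1 2 (by decide) (β ^ 2)
    rw [← h, ← wd_smul]; simp
  · rintro rfl
    apply hd 0 2 (by decide) (α ^ 2)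
    rw [← h, ← wd_smul]; simp

lemma mem_of_wd {k : Type*} [Field k] (a a' : (Fin 5 → k) × (Fin 5 → k)) (c : k)
    (ha : wd a ≠ 0) (h : wd a' = c • wd a) (hc : c ≠ 0) :
    a'.1 ∈ Submodule.span k (Set.range ![a.1, a.2]) ∧
    a'.2 ∈ Submodule.span k (Set.range ![a.1, a.2]) := by
  have hli : LinearIndependent k ![a.1, a.2] := by
    by_contra hn
    apply ha
    have := (ιMulti k 2 (M := Fin 5 → k)).map_linearDependent _ hn
    simpa [ιMulti_apply, wd] using this
  have gen : ∀ v : Fin 5 → k, ι k v * wd a' = 0 →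
      v ∈ Submodule.span k (Set.range ![a.1, a.2]) := by
    intro v hv
    by_contra hn
    have : LinearIndependent k (Fin.cons v ![a.1, a.2] : Fin 3 → Fin 5 → k) :=
      linearIndependent_finCons.2 ⟨hli, hn⟩
    apply wedge_ne_zero _ this
    rw [h, mul_smul_comm] at hv
    have := (smul_eq_zero.1 hv).resolve_left hc
    simpa [ιMulti_apply, wd, List.ofFn_succ] using this
  constructor
  · apply gen; simp [wd, ι_sq']
  · apply gen; simp only [wd]; rw [ι_swap' a'.1 a'.2, ι_sq_zero]; simp

/-- The pairing. -/
noncomputable def dt {k : Type*} [Field k] : (Fin 5 → k) →ₗ[k] (Fin 5 → k) →ₗ[k] k :=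
  LinearMap.mk₂ k (fun φ v => ∑ l, φ l * v l)
    (by intros; simp [add_mul, Finset.sum_add_distrib])
    (by intros; simp [Finset.mul_sum, mul_assoc])
    (by intros; simp [mul_add, Finset.sum_add_distrib])
    (by intros; simp [Finset.mul_sum, mul_left_comm])

lemma dt_apply {k : Type*} [Field k] (φ v : Fin 5 → k) : dt φ v = ∑ l, φ l * v l := rfl

lemma exists_perp {k : Type*} [Field k] (U : Submodule k (Fin 5 → k))
    (hU : Module.finrank k U ≤ 3) :
    ∃ f : Fin 2 → (Fin 5 → k), LinearIndependent k f ∧ ∀ i, ∀ u ∈ U, dt (f i) u = 0 := by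
  let T : (Fin 5 → k) →ₗ[k] Module.Dual k U := (U.subtype.dualMap) ∘ₗ dt
  have h1 := LinearMap.finrank_range_add_finrank_ker T
  have h2 : Module.finrank k (LinearMap.range T) ≤ Module.finrank k (Module.Dual k U) :=
    Submodule.finrank_le _
  rw [Subspace.dual_finrank_eq] at h2
  simp only [Module.finrank_fin_fun] at h1
  have h3 : 2 ≤ Module.finrank k (LinearMap.ker T) := by omega
  let b := Module.finBasis k (LinearMap.ker T)
  refine ⟨fun i => (b (Fin.castLE h3 i) : Fin 5 → k), ?_, ?_⟩
  · have := b.linearIndependent.comp (Fin.castLE h3) (Fin.castLE_injective h3)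
    exact this.map' (LinearMap.ker T).subtype (Submodule.ker_subtype _)
  · intro i u hu
    have := (b (Fin.castLE h3 i)).2
    rw [LinearMap.mem_ker] at this
    exact LinearMap.congr_fun this ⟨u, hu⟩

lemma left_kernel {k : Type*} [Field k] (x y : Fin 2 → k) (h : x 0 * y 1 = x 1 * y 0) :
    ∃ σ τ : k, (σ ≠ 0 ∨ τ ≠ 0) ∧ ∀ i, σ * x i + τ * y i = 0 := by
  by_cases h0 : y 0 ≠ 0 ∨ -x 0 ≠ 0
  · refine ⟨y 0, -x 0, h0, ?_⟩
    intro i; fin_cases i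
    · simp; ring
    · simp; linear_combination -h
  by_cases h1 : y 1 ≠ 0 ∨ -x 1 ≠ 0
  · refine ⟨y 1, -x 1, h1, ?_⟩
    intro i; fin_cases i
    · simp; linear_combination h
    · simp; ring
  push Not at h0 h1
  refine ⟨1, 0, by simp, ?_⟩
  intro i; fin_cases i
  · simpa using h0.2
  · simpa using h1.2

lemma kill_all {k : Type*} [Field k] {n : ℕ} (W : Submodule k ((Fin 5 → k) × (Fin 5 → k)))
    (a b : (Fin 5 → k) × (Fin 5 → k)) (c : Fin n → (Fin 5 → k) × (Fin 5 → k))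
    (hW : W ≤ Submodule.span k (Set.range ![a, b]) ⊔ Submodule.span k (Set.range c))
    (φ : Fin 5 → k) (ha1 : dt φ a.1 = 0) (ha2 : dt φ a.2 = 0) (hb1 : dt φ b.1 = 0)
    (hb2 : dt φ b.2 = 0) (σ τ : k) (hc : ∀ i, σ * dt φ (c i).1 + τ * dt φ (c i).2 = 0) :
    ∀ w ∈ W, σ * dt φ w.1 + τ * dt φ w.2 = 0 := by
  let F : ((Fin 5 → k) × (Fin 5 → k)) →ₗ[k] k :=
    σ • (dt φ ∘ₗ LinearMap.fst k _ _) + τ • (dt φ ∘ₗ LinearMap.snd k _ _)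
  have : W ≤ LinearMap.ker F := by
    refine hW.trans (sup_le ?_ ?_)
    · rw [Submodule.span_le]
      rintro _ ⟨i, rfl⟩
      fin_cases i
      · simp [F, ha1, ha2]
      · simp [F, hb1, hb2]
    · rw [Submodule.span_le]
      rintro _ ⟨i, rfl⟩
      simpa [F] using hc i
  intro w hw
  simpa [F] using this hw

lemma degenerate {k : Type*} [Field k] [IsAlgClosed k]
    (A₁ : Matrix (Fin 2) (Fin 4) (Fin 5 → k)) (B₁ : Matrix (Fin 3) (Fin 2) (Fin 5 → k))
    (hCA : IsRNQuartic A₁) (hSB : IsCubicScroll B₁)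
    (hVA : Module.finrank k (colSpace A₁) = 4)
    (hVB : Module.finrank k (rowSpace B₁) = 3)
    (a b a' b' : (Fin 5 → k) × (Fin 5 → k))
    (ha : a ∈ colSpace A₁) (hb : b ∈ colSpace A₁)
    (ha' : a' ∈ rowSpace B₁) (hb' : b' ∈ rowSpace B₁)
    (hli : LinearIndependent k ![a, b]) (hli' : LinearIndependent k ![a', b'])
    (U : Submodule k (Fin 5 → k)) (hU : Module.finrank k U ≤ 3)
    (h1 : a.1 ∈ U ∧ a.2 ∈ U) (h2 : b.1 ∈ U ∧ b.2 ∈ U)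
    (h1' : a'.1 ∈ U ∧ a'.2 ∈ U) (h2' : b'.1 ∈ U ∧ b'.2 ∈ U) :
    (rankOneLocus A₁ ∩ rankOneLocus B₁).Nonempty := by
  obtain ⟨f, hf, hfU⟩ := exists_perp U hU
  have hr : ∀ (W : Submodule k ((Fin 5 → k) × (Fin 5 → k))) (x y : (Fin 5 → k) × (Fin 5 → k)),
      x ∈ W → y ∈ W → Submodule.span k (Set.range ![x, y]) ≤ W := by
    intro W x y hx hy
    rw [Submodule.span_le]
    rintro _ ⟨i, rfl⟩
    fin_cases i
    · exact hx
    · exact hy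
  obtain ⟨c, hc⟩ := exists_compl_family _ _ (hr _ a b ha hb) 2 (by
    rw [finrank_span_eq_card hli, hVA]; rfl)
  obtain ⟨d, hd⟩ := exists_compl_family _ _ (hr _ a' b' ha' hb') 1 (by
    rw [finrank_span_eq_card hli', hVB]; rfl)
  obtain ⟨s, t, hst, hq⟩ := exists_quadratic_zero
    (dt (f 0) (c 0).1 * dt (f 0) (c 1).2 - dt (f 0) (c 1).1 * dt (f 0) (c 0).2)
    (dt (f 0) (c 0).1 * dt (f 1) (c 1).2 + dt (f 1) (c 0).1 * dt (f 0) (c 1).2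
      - dt (f 0) (c 1).1 * dt (f 1) (c 0).2 - dt (f 1) (c 1).1 * dt (f 0) (c 0).2)
    (dt (f 1) (c 0).1 * dt (f 1) (c 1).2 - dt (f 1) (c 1).1 * dt (f 1) (c 0).2)
  set φ := s • f 0 + t • f 1 with hφ
  have hφU : ∀ u ∈ U, dt φ u = 0 := by
    intro u hu
    simp [hφ, hfU 0 u hu, hfU 1 u hu]
  have hφ0 : φ ≠ 0 := by
    intro h0
    have hf' : LinearIndependent k ![f 0, f 1] := by
      convert hf using 1
      ext i; fin_cases i <;> rfl
    have := LinearIndependent.pair_iff.1 hf' s t h0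
    rcases hst with h | h
    · exact h this.1
    · exact h this.2
  obtain ⟨σ, τ, hστ, hker⟩ := left_kernel (fun i => dt φ (c i).1) (fun i => dt φ (c i).2) (by
    simp only [hφ, map_add, map_smul, LinearMap.add_apply, LinearMap.smul_apply, smul_eq_mul]
    linear_combination hq)
  obtain ⟨σ', τ', hστ', hker'⟩ := left_kernel (fun _ => dt φ (d 0).1) (fun _ => dt φ (d 0).2) rfl
  have kA := kill_all _ a b c hc φ (hφU _ h1.1) (hφU _ h1.2) (hφU _ h2.1) (hφU _ h2.2) σ τ hker
  have kB := kill_all _ a' b' d hd φ (hφU _ h1'.1) (hφU _ h1'.2) (hφU _ h2'.1) (hφU _ h2'.2)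
    σ' τ' (by intro i; fin_cases i; exact hker' 0)
  refine ⟨φ, ?_, ?_⟩
  · refine rank_one_of _ ?_ σ τ hστ ?_
    · intro h0
      apply hφ0
      apply quartic_zero A₁ hCA
      intro i j
      exact congrFun (congrFun h0 i) j
    · intro j
      exact kA (A₁ 0 j, A₁ 1 j) (Submodule.subset_span ⟨j, rfl⟩)
  · show Matrix.rank _ = 1
    rw [← Matrix.rank_transpose]
    refine rank_one_of _ ?_ σ' τ' hστ' ?_
    · intro h0
      apply hφ0
      apply scroll_zero B₁ hSB
      intro i j
      exact congrFun (congrFun h0 j) i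
    · intro j
      exact kB (B₁ j 0, B₁ j 1) (Submodule.subset_span ⟨j, rfl⟩)

/-!
STATEMENT 14: Let `k` be algebraically closed, `V ≅ k⁵`, and let `A₁` (2×4) and `B₁` (3×2)
be matrices with entries in `V` such that the rank-1 locus `C_A` of `A₁` in `P(V*)` is a
smooth rational normal quartic curve and the rank-1 locus `S_B` of `B₁` is a rational cubic
surface scroll.  If `Z_A ∩ Z_B` is finite and contains four points that lie on a common
line both in `P(V_A)` and in `P(V_B)`, then `C_A` and `S_B` intersect.

The four common points are given by representatives `p s ∈ V_A`, `q s ∈ V_B` whose wedges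
are nonzero and proportional (so they define the same point of `Z_A ∩ Z_B`), pairwise
non-proportional (so the four points are distinct); lying on a common line in `P(V_A)`
(resp. `P(V_B)`) means that the `p s` (resp. `q s`) span a subspace of dimension at most 2.
-/
theorem stmt14 (k : Type*) [Field k] [IsAlgClosed k]
    (A₁ : Matrix (Fin 2) (Fin 4) (Fin 5 → k)) (B₁ : Matrix (Fin 3) (Fin 2) (Fin 5 → k))
    (hCA : IsRNQuartic A₁) (hSB : IsCubicScroll B₁)
    (hVA : Module.finrank k (colSpace A₁) = 4)
    (hVB : Module.finrank k (rowSpace B₁) = 3)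
    (hfin : (gammaSet A₁ B₁).Finite)
    (p q : Fin 4 → (Fin 5 → k) × (Fin 5 → k))
    (hp : ∀ s, p s ∈ colSpace A₁) (hq : ∀ s, q s ∈ rowSpace B₁)
    (hne : ∀ s, ι k (p s).1 * ι k (p s).2 ≠ 0)
    (hprop : ∀ s, ∃ c : kˣ,
      ι k (q s).1 * ι k (q s).2 = c • (ι k (p s).1 * ι k (p s).2))
    (hdistinct : ∀ s t, s ≠ t → ∀ c : k,
      ι k (p t).1 * ι k (p t).2 ≠ c • (ι k (p s).1 * ι k (p s).2))
    (hlineA : Module.finrank k (Submodule.span k (Set.range p)) ≤ 2)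
    (hlineB : Module.finrank k (Submodule.span k (Set.range q)) ≤ 2) :
    (rankOneLocus A₁ ∩ rankOneLocus B₁).Nonempty := by
  change ∀ s, wd (p s) ≠ 0 at hne
  change ∀ s, ∃ c : kˣ, wd (q s) = c • wd (p s) at hprop
  change ∀ s t, s ≠ t → ∀ c : k, wd (p t) ≠ c • wd (p s) at hdistinct
  have hprop' : ∀ s, ∃ c : k, c ≠ 0 ∧ wd (q s) = c • wd (p s) := by
    intro s
    obtain ⟨c, hc⟩ := hprop s
    exact ⟨c, c.ne_zero, hc⟩
  have hdq : ∀ s t, s ≠ t → ∀ c : k, wd (q t) ≠ c • wd (q s) := by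
    intro s t hst c h
    obtain ⟨c1, h1, e1⟩ := hprop' s
    obtain ⟨c2, h2, e2⟩ := hprop' t
    apply hdistinct s t hst (c2⁻¹ * (c * c1))
    rw [e1, e2] at h
    rw [mul_smul, mul_smul, ← h, smul_smul, inv_mul_cancel₀ h2, one_smul]
  obtain ⟨hli, α, β, hα, hβ, hp2⟩ := line_lemma p hdistinct hlineA
  obtain ⟨hli', α', β', hα', hβ', hq2⟩ := line_lemma q hdq hlineB
  obtain ⟨c0, hc0, e0⟩ := hprop' 0
  obtain ⟨c1, hc1, e1⟩ := hprop' 1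
  obtain ⟨c2, hc2, e2⟩ := hprop' 2
  by_cases hθ : wd (p 0) * wd (p 1) = 0
  · -- degenerate case: everything lives in a three dimensional space
    have hnl : ¬ LinearIndependent k ![(p 0).1, (p 0).2, (p 1).1, (p 1).2] := by
      intro h
      apply wedge_ne_zero _ h
      simpa [ιMulti_apply, wd, List.ofFn_succ, mul_assoc] using hθ
    let U := Submodule.span k (Set.range ![(p 0).1, (p 0).2, (p 1).1, (p 1).2])
    have hU : Module.finrank k U ≤ 3 := by
      rw [linearIndependent_iff_card_le_finrank_span] at hnl
      simp only [Fintype.card_fin, not_le] at hnl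
      exact Nat.lt_succ_iff.1 hnl
    have m0 : (p 0).1 ∈ U := Submodule.subset_span ⟨0, rfl⟩
    have m1 : (p 0).2 ∈ U := Submodule.subset_span ⟨1, rfl⟩
    have m2 : (p 1).1 ∈ U := Submodule.subset_span ⟨2, rfl⟩
    have m3 : (p 1).2 ∈ U := Submodule.subset_span ⟨3, rfl⟩
    have hle : ∀ x y : Fin 5 → k, x ∈ U → y ∈ U →
        Submodule.span k (Set.range ![x, y]) ≤ U := by
      intro x y hx hy
      rw [Submodule.span_le]
      rintro _ ⟨i, rfl⟩
      fin_cases i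
      · exact hx
      · exact hy
    obtain ⟨n0, n1⟩ := mem_of_wd (p 0) (q 0) c0 (hne 0) e0 hc0
    obtain ⟨n2, n3⟩ := mem_of_wd (p 1) (q 1) c1 (hne 1) e1 hc1
    exact degenerate A₁ B₁ hCA hSB hVA hVB (p 0) (p 1) (q 0) (q 1) (hp 0) (hp 1) (hq 0) (hq 1)
      hli hli' U hU ⟨m0, m1⟩ ⟨m2, m3⟩ ⟨hle _ _ m0 m1 n0, hle _ _ m0 m1 n1⟩
      ⟨hle _ _ m2 m3 n2, hle _ _ m2 m3 n3⟩
  · -- otherwise the two conics agree, so the intersection is infinite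
    exfalso
    set a := α • p 0 with hadef
    set b := β • p 1 with hbdef
    set a' := α' • q 0 with hadef'
    set b' := β' • q 1 with hbdef'
    have hab : wd a * wd b ≠ 0 := by
      rw [hadef, hbdef, wd_smul, wd_smul, smul_mul_smul_comm]
      exact smul_ne_zero (mul_ne_zero (pow_ne_zero _ hα) (pow_ne_zero _ hβ)) hθ
    have ea : wd a' = (α' ^ 2 * c0 * (α ^ 2)⁻¹) • wd a := by
      rw [hadef, hadef', wd_smul, wd_smul, e0, smul_smul, smul_smul]
      congr 1
      field_simp
    have eb : wd b' = (β' ^ 2 * c1 * (β ^ 2)⁻¹) • wd b := by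
      rw [hbdef, hbdef', wd_smul, wd_smul, e1, smul_smul, smul_smul]
      congr 1
      field_simp
    have hca : α' ^ 2 * c0 * (α ^ 2)⁻¹ ≠ 0 := by positivity
    have hcb : β' ^ 2 * c1 * (β ^ 2)⁻¹ ≠ 0 := by positivity
    have hconic := core a b a' b' _ _ c2 ea eb hca hcb (by rw [← hp2, ← hq2, e2]) hab
    obtain ⟨r, hr⟩ := IsAlgClosed.exists_eq_mul_self (α' ^ 2 * c0 * (α ^ 2)⁻¹)
    have hr0 : r ≠ 0 := by
      rintro rfl
      exact hca (by simpa using hr)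
    have hz : ∀ t : k, wd (a + t • b) ≠ 0 := by
      intro t h
      have h1 := wd_inj a b hab t (t + 1) 0 (by rw [h, zero_smul])
      simp at h1
    refine Set.infinite_of_injective_forall_mem
      (f := fun t : k => Projectivization.mk k (wd (a + t • b)) (hz t)) ?_ ?_ hfin
    · intro t u htu
      obtain ⟨c, hc⟩ := (Projectivization.mk_eq_mk_iff' k _ _ _ _).1 htu
      exact wd_inj a b hab t u c hc.symm
    · intro t
      refine ⟨_, hz t, rfl, ⟨a + t • b, ?_, rfl⟩, ⟨r⁻¹ • (a' + t • b'), ?_, ?_⟩⟩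
      · exact Submodule.add_mem _ (Submodule.smul_mem _ _ (hp 0))
          (Submodule.smul_mem _ _ (Submodule.smul_mem _ _ (hp 1)))
      · exact Submodule.smul_mem _ _ (Submodule.add_mem _ (Submodule.smul_mem _ _ (hq 0))
          (Submodule.smul_mem _ _ (Submodule.smul_mem _ _ (hq 1))))
      · change wd (a + t • b) = wd (r⁻¹ • (a' + t • b'))
        rw [wd_smul, hconic t, hr, ← mul_smul (r⁻¹ ^ 2)]
        have : r⁻¹ ^ 2 * (r * r) = 1 := by field_simp
        rw [this, one_smul]
end
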